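/- Let r be a positive integer and G ⊆ ℝ^N a definable group: a definable set equipped with a group structure whose multiplication G × G → G and inversion G → G are definable maps. Then G admits a definable C^r group structure: there exist a definable C^r group H (a definable C^r submanifold of some ℝ^k that is a group whose multiplication and inversion are definable C^r maps) and a group isomorphism ι: G → H which is a definable map. Moreover this structure is unique up to equivalence: for any two definable C^r group structures (H₁, ι₁) and (H₂, ι₂) on G, the composition ι₂ ∘ ι₁⁻¹: H₁ → H₂ is a definable C^r diffeomorphism. -/

import Mathlib

open FirstOrder Set Topology

namespace Paper

variable (L : FirstOrder.Language) [L.Structure ℝ]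

/-- A subset of `ℝⁿ` is definable in the structure (with parameters from `ℝ`). -/
def Def (n : ℕ) (s : Set (Fin n → ℝ)) : Prop :=
  Set.Definable (Set.univ : Set ℝ) L s

/-- A subset of `ℝ` is definable. -/
def Def1 (s : Set ℝ) : Prop := Def L 1 {x | x 0 ∈ s}

/-- The structure expands the ordered field `(ℝ, <, +, ·, 0, 1)`:
the order and the field operations (and the constants) are definable. -/
def ExpandsOrderedField : Prop :=
  Def L 2 {x | x 0 < x 1} ∧ Def L 3 {x | x 0 + x 1 = x 2} ∧
  Def L 3 {x | x 0 * x 1 = x 2} ∧ Def L 1 {x | x 0 = 0} ∧ Def L 1 {x | x 0 = 1}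

/-- Local o-minimality: every definable subset of `ℝ` is, near each point, a finite
union of points and open intervals. -/
def LocallyOMinimal : Prop :=
  ∀ X : Set ℝ, Def1 L X → ∀ a : ℝ,
    ∃ b c : ℝ, b < a ∧ a < c ∧
      ∃ (P : Finset ℝ) (J : Finset (ℝ × ℝ)),
        X ∩ Set.Ioo b c = ↑P ∪ ⋃ p ∈ J, Set.Ioo p.1 p.2

/-- First component of a point of `ℝ^(m+n) = ℝ^m × ℝ^n`. -/
def fstFun {m n : ℕ} (z : Fin (m + n) → ℝ) : Fin m → ℝ := fun i => z (Fin.castAdd n i)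

/-- Second component of a point of `ℝ^(m+n) = ℝ^m × ℝ^n`. -/
def sndFun {m n : ℕ} (z : Fin (m + n) → ℝ) : Fin n → ℝ := fun j => z (Fin.natAdd m j)

/-- The map `f : X → ℝⁿ`, `X ⊆ ℝ^m`, is definable (its graph over `X` is definable). -/
def DefMapOn (m n : ℕ) (X : Set (Fin m → ℝ)) (f : (Fin m → ℝ) → (Fin n → ℝ)) : Prop :=
  Def L (m + n) {z | fstFun z ∈ X ∧ sndFun z = f (fstFun z)}

/-- The function `f : X → ℝ`, `X ⊆ ℝ^m`, is definable. -/
def DefFunOn (m : ℕ) (X : Set (Fin m → ℝ)) (f : (Fin m → ℝ) → ℝ) : Prop :=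
  DefMapOn L m 1 X fun x _ => f x

/-- `f` is of class `C^r` on `X` in the sense that near every point of `X` it agrees on `X`
with a `C^r` map defined on an open neighborhood in the ambient space. -/
def CrMapOn (r m n : ℕ) (X : Set (Fin m → ℝ)) (f : (Fin m → ℝ) → (Fin n → ℝ)) : Prop :=
  ∀ a ∈ X, ∃ (W : Set (Fin m → ℝ)) (g : (Fin m → ℝ) → (Fin n → ℝ)),
    a ∈ W ∧ IsOpen W ∧ ContDiffOn ℝ r g W ∧ Set.EqOn f g (X ∩ W)

/-- Real-valued version of `CrMapOn`. -/
def CrFunOn (r m : ℕ) (X : Set (Fin m → ℝ)) (f : (Fin m → ℝ) → ℝ) : Prop :=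
  ∀ a ∈ X, ∃ (W : Set (Fin m → ℝ)) (g : (Fin m → ℝ) → ℝ),
    a ∈ W ∧ IsOpen W ∧ ContDiffOn ℝ r g W ∧ Set.EqOn f g (X ∩ W)

/-- A definable `C^r` map `X → ℝⁿ`. -/
def DefCrMapOn (r m n : ℕ) (X : Set (Fin m → ℝ)) (f : (Fin m → ℝ) → (Fin n → ℝ)) : Prop :=
  DefMapOn L m n X f ∧ CrMapOn r m n X f

/-- A definable `C^r` function `X → ℝ`. -/
def DefCrFunOn (r m : ℕ) (X : Set (Fin m → ℝ)) (f : (Fin m → ℝ) → ℝ) : Prop :=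
  DefFunOn L m X f ∧ CrFunOn r m X f

/-- A definable `C^r` submanifold of `ℝⁿ` of dimension `d`: around every point there is a
definable `C^r` chart of `ℝⁿ` straightening `M` to the first `d` coordinates. -/
def IsDefCrSubmanifold (r n d : ℕ) (M : Set (Fin n → ℝ)) : Prop :=
  Def L n M ∧
  ∀ a ∈ M, ∃ (U V : Set (Fin n → ℝ)) (φ ψ : (Fin n → ℝ) → (Fin n → ℝ)),
    a ∈ U ∧ IsOpen U ∧ Def L n U ∧
    (0 : Fin n → ℝ) ∈ V ∧ IsOpen V ∧ Def L n V ∧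
    DefMapOn L n n U φ ∧ DefMapOn L n n V ψ ∧
    ContDiffOn ℝ r φ U ∧ ContDiffOn ℝ r ψ V ∧
    Set.BijOn φ U V ∧ Set.InvOn ψ φ U V ∧
    φ a = 0 ∧
    φ '' (M ∩ U) = {x ∈ V | ∀ i : Fin n, d ≤ (i : ℕ) → x i = 0}

/-- The Euclidean norm on `ℝⁿ`. -/
noncomputable def eunorm {n : ℕ} (x : Fin n → ℝ) : ℝ := Real.sqrt (∑ i, x i ^ 2)

/-- Projection of `ℝⁿ` onto the `d` coordinates selected by `σ`. -/
def coordProj {n : ℕ} (d : ℕ) (σ : Fin d → Fin n) (x : Fin n → ℝ) : Fin d → ℝ :=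
  fun i => x (σ i)

/-- `X ⊆ ℝⁿ` has dimension `d`: `d` is the largest integer such that some coordinate
projection of `X` onto `ℝ^d` has nonempty interior. -/
def HasDim {n : ℕ} (X : Set (Fin n → ℝ)) (d : ℕ) : Prop :=
  (∃ σ : Fin d → Fin n, Function.Injective σ ∧ (interior (coordProj d σ '' X)).Nonempty) ∧
  ∀ (e : ℕ) (σ : Fin e → Fin n), Function.Injective σ →
    (interior (coordProj e σ '' X)).Nonempty → e ≤ d

/-- A (bounded) open box in `ℝⁿ`. -/
def IsOpenBox {n : ℕ} (B : Set (Fin n → ℝ)) : Prop :=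
  ∃ a b : Fin n → ℝ, (∀ i, a i < b i) ∧ B = Set.pi Set.univ fun i => Set.Ioo (a i) (b i)

/-- A definable `C^r` group structure on a definable group `(G, mul, inv)`:
a definable `C^r` group `H` (a definable `C^r` submanifold with definable `C^r`
multiplication and inversion) together with a definable group isomorphism `ι : G → H`. -/
structure DefCrGroupStructure (r N : ℕ) (G : Set (Fin N → ℝ))
    (mul : (Fin N → ℝ) → (Fin N → ℝ) → (Fin N → ℝ))
    (inv : (Fin N → ℝ) → (Fin N → ℝ)) : Type where
  k : ℕ
  d : ℕ
  H : Set (Fin k → ℝ)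
  hsub : IsDefCrSubmanifold L r k d H
  mulH : (Fin k → ℝ) → (Fin k → ℝ) → (Fin k → ℝ)
  invH : (Fin k → ℝ) → (Fin k → ℝ)
  hmulH_mem : ∀ x ∈ H, ∀ y ∈ H, mulH x y ∈ H
  hinvH_mem : ∀ x ∈ H, invH x ∈ H
  hmulH_cr : DefCrMapOn L r (k + k) k {z | fstFun z ∈ H ∧ sndFun z ∈ H}
    (fun z => mulH (fstFun z) (sndFun z))
  hinvH_cr : DefCrMapOn L r k k H invH
  iota : (Fin N → ℝ) → (Fin k → ℝ)
  hiota_def : DefMapOn L N k G iota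
  hiota_bij : Set.BijOn iota G H
  hiota_mul : ∀ x ∈ G, ∀ y ∈ G, iota (mul x y) = mulH (iota x) (iota y)
  hiota_inv : ∀ x ∈ G, iota (inv x) = invH (iota x)

section Definability

/-- Types equipped with an injection onto a definable subset of a finite power of `ℝ`. -/
class Dt (L : FirstOrder.Language) [L.Structure ℝ] (X : Type) where
  idx : Type
  fin : Finite idx
  emb : X → idx → ℝ
  inj : Function.Injective emb
  def_range : Set.Definable (Set.univ : Set ℝ) L (range emb)

attribute [instance] Dt.fin

variable (L : FirstOrder.Language) [L.Structure ℝ]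

/-- The coordinate vector of a point of a definable type. -/
abbrev em {X : Type} [Dt L X] : X → Dt.idx L X → ℝ := Dt.emb

/-- A predicate on a definable type is definable. -/
def DPred {X : Type} [Dt L X] (P : X → Prop) : Prop :=
  Set.Definable (Set.univ : Set ℝ) L (em L '' {x | P x})

variable {L}

theorem definable_coord_eq {κ : Type} (i : κ) (a : ℝ) :
    Set.Definable (Set.univ : Set ℝ) L {v : κ → ℝ | v i = a} :=
  (Definable.singleton_of_mem L (A := univ) (a := a) trivial).preimage_comp (fun _ => i)

theorem definable_coord_eq_coord {κ : Type} (i j : κ) :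
    Set.Definable (Set.univ : Set ℝ) L {v : κ → ℝ | v i = v j} :=
  (Definable.diagonal (L := L) (univ : Set ℝ)).preimage_comp ![i, j]

theorem definable_singleton_vec {κ : Type} [Finite κ] (a : κ → ℝ) :
    Set.Definable (Set.univ : Set ℝ) L {a} := by
  convert Set.definable_iInter_of_finite fun i => definable_coord_eq (L := L) i (a i)
  ext v; simp [funext_iff]

instance instDtReal : Dt L ℝ where
  idx := Unit
  fin := inferInstance
  emb x _ := x
  inj x y h := congrFun h ()
  def_range := by
    convert Set.definable_univ
    exact eq_univ_of_forall fun v => ⟨v (), rfl⟩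

noncomputable instance instDtProp : Dt L Prop where
  idx := Unit
  fin := inferInstance
  emb p _ := open Classical in if p then 1 else 0
  inj p q h := by
    have := congrFun h ()
    by_cases hp : p <;> by_cases hq : q <;> simp_all
  def_range := by
    convert (definable_coord_eq (L := L) () 1).union (definable_coord_eq (L := L) () 0)
    ext v
    constructor
    · rintro ⟨p, rfl⟩
      by_cases hp : p <;> simp [hp]
    · rintro (h | h)
      · exact ⟨True, by ext; simp [h.symm]⟩
      · exact ⟨False, by ext; simp [h.symm]⟩

instance instDtProd {X Y : Type} [Dt L X] [Dt L Y] : Dt L (X × Y) where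
  idx := Dt.idx L X ⊕ Dt.idx L Y
  fin := inferInstance
  emb p := Sum.elim (em L p.1) (em L p.2)
  inj p q h := by
    refine Prod.ext (Dt.inj (L := L) ?_) (Dt.inj (L := L) ?_)
    · exact funext fun i => congrFun h (.inl i)
    · exact funext fun i => congrFun h (.inr i)
  def_range := by
    convert ((Dt.def_range (L := L) (X := X)).preimage_comp Sum.inl).inter
      ((Dt.def_range (L := L) (X := Y)).preimage_comp Sum.inr)
    ext v
    constructor
    · rintro ⟨p, rfl⟩
      exact ⟨⟨p.1, rfl⟩, ⟨p.2, rfl⟩⟩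
    · rintro ⟨⟨x, hx⟩, ⟨y, hy⟩⟩
      exact ⟨(x, y), by ext (i | i); exacts [congrFun hx i, congrFun hy i]⟩

instance instDtPi {κ X : Type} [Finite κ] [Dt L X] : Dt L (κ → X) where
  idx := κ × Dt.idx L X
  fin := inferInstance
  emb f p := em L (f p.1) p.2
  inj f g h := funext fun k => Dt.inj (L := L) <| funext fun i => congrFun h (k, i)
  def_range := by
    convert Set.definable_iInter_of_finite fun k : κ =>
      (Dt.def_range (L := L) (X := X)).preimage_comp fun i => (k, i)
    ext v
    simp only [mem_iInter]
    constructor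
    · rintro ⟨f, rfl⟩ k
      exact ⟨f k, rfl⟩
    · intro h
      choose f hf using h
      exact ⟨f, funext fun p => congrFun (hf p.1) p.2⟩

/-- The definable type structure on a definable subset. -/
@[reducible] def dtSubtype {X : Type} [Dt L X] {P : X → Prop} (hP : DPred L P) :
    Dt L {x // P x} where
  idx := Dt.idx L X
  fin := inferInstance
  emb x := em L x.1
  inj x y h := Subtype.ext (Dt.inj (L := L) h)
  def_range := by
    unfold DPred at hP
    convert hP
    ext v
    simp only [mem_range, Subtype.exists, mem_image, mem_ofPred_eq]
    tauto

variable {X Y Z W : Type} [Dt L X] [Dt L Y] [Dt L Z] [Dt L W]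

theorem em_inj {x y : X} : em L x = em L y ↔ x = y := (Dt.inj (L := L)).eq_iff

namespace DPred

theorem and {P Q : X → Prop} (hP : DPred L P) (hQ : DPred L Q) : DPred L fun x => P x ∧ Q x := by
  have := Definable.inter hP hQ
  rwa [← image_inter Dt.inj] at this

theorem not {P : X → Prop} (hP : DPred L P) : DPred L fun x => ¬ P x := by
  have := Definable.sdiff (Dt.def_range (L := L) (X := X)) hP
  rw [← image_univ, ← image_sdiff Dt.inj] at this
  unfold DPred
  convert this using 2
  ext; simp

theorem reindex {P : Y → Prop} (hP : DPred L P) (g : X → Y) (σ : Dt.idx L Y → Dt.idx L X)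
    (h : ∀ x, em L (g x) = em L x ∘ σ) : DPred L fun x => P (g x) := by
  unfold DPred
  convert Definable.inter (Dt.def_range (L := L) (X := X)) (Definable.preimage_comp σ hP)
  ext v
  constructor
  · rintro ⟨x, hx, rfl⟩
    exact ⟨⟨x, rfl⟩, ⟨g x, hx, h x⟩⟩
  · rintro ⟨⟨x, rfl⟩, ⟨y, hy, hxy⟩⟩
    refine ⟨x, ?_, rfl⟩
    have : y = g x := Dt.inj (L := L) (hxy.trans (h x).symm)
    show P (g x)
    rw [← this]; exact hy

theorem ex {P : X → Y → Prop} (hP : DPred L fun p : X × Y => P p.1 p.2) :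
    DPred L fun x => ∃ y, P x y := by
  unfold DPred
  convert Definable.image_comp hP Sum.inl
  ext v
  constructor
  · rintro ⟨x, ⟨y, hxy⟩, rfl⟩
    exact ⟨_, ⟨(x, y), hxy, rfl⟩, rfl⟩
  · rintro ⟨_, ⟨⟨x, y⟩, hxy, rfl⟩, rfl⟩
    exact ⟨x, ⟨y, hxy⟩, rfl⟩

theorem or {P Q : X → Prop} (hP : DPred L P) (hQ : DPred L Q) : DPred L fun x => P x ∨ Q x := by
  convert (hP.not.and hQ.not).not using 2
  tauto

theorem forall_fin {κ : Type} [Finite κ] {P : κ → X → Prop} (hP : ∀ k, DPred L (P k)) :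
    DPred L fun x => ∀ k, P k x := by
  unfold DPred
  convert Definable.inter (Dt.def_range (L := L) (X := X)) (definable_iInter_of_finite hP)
  ext v
  constructor
  · rintro ⟨x, hx, rfl⟩
    exact ⟨⟨x, rfl⟩, mem_iInter.2 fun k => ⟨x, hx k, rfl⟩⟩
  · rintro ⟨⟨x, rfl⟩, h⟩
    refine ⟨x, fun k => ?_, rfl⟩
    obtain ⟨y, hy, hxy⟩ := mem_iInter.1 h k
    exact Dt.inj (L := L) hxy ▸ hy

theorem eq_diag : DPred L fun p : X × X => p.1 = p.2 := by
  unfold DPred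
  convert Definable.inter (Dt.def_range (L := L) (X := X × X))
    (definable_iInter_of_finite fun i : Dt.idx L X =>
      definable_coord_eq_coord (L := L) (Sum.inl i : Dt.idx L X ⊕ Dt.idx L X) (Sum.inr i))
  ext v
  constructor
  · rintro ⟨p, hp, rfl⟩
    refine ⟨⟨p, rfl⟩, mem_iInter.2 fun k : Dt.idx L X => ?_⟩
    show em L p.1 k = em L p.2 k
    rw [show p.1 = p.2 from hp]
  · rintro ⟨⟨p, rfl⟩, h⟩
    exact ⟨p, Dt.inj (L := L) (funext fun k => mem_iInter.1 h k), rfl⟩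

theorem eq_const (c : X) : DPred L fun x => x = c := by
  have := definable_singleton_vec (L := L) (em L c)
  rwa [← image_singleton] at this

end DPred

variable (L) in
/-- A map between definable types has definable graph. Maps into `Prop` are predicates. -/
@[fun_prop]
def Dmap (f : X → Y) : Prop := DPred L fun p : X × Y => f p.1 = p.2

theorem Dmap.of_reindex (g : X → Y) (σ : Dt.idx L Y → Dt.idx L X)
    (h : ∀ x, em L (g x) = em L x ∘ σ) : Dmap L g :=
  (DPred.eq_diag (X := Y)).reindex (fun p : X × Y => (g p.1, p.2)) (Sum.map σ id) fun p => by
    funext i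
    rcases i with i | i
    · exact congrFun (h p.1) i
    · rfl

namespace Dmap

theorem dpred_comp {P : Y → Prop} {f : X → Y} (hP : DPred L P) (hf : Dmap L f) :
    DPred L fun x => P (f x) := by
  have := (DPred.and hf (hP.reindex (fun p : X × Y => p.2) Sum.inr fun _ => rfl)).ex
    (P := fun x y => f x = y ∧ P y)
  simpa using this

@[fun_prop] theorem id : Dmap L fun x : X => x := of_reindex _ _root_.id fun _ => rfl

@[fun_prop] theorem const (c : Y) : Dmap L fun _ : X => c := by
  have := (DPred.eq_const (L := L) c).reindex (fun p : X × Y => p.2) Sum.inr fun _ => rfl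
  simpa only [Dmap, eq_comm (a := c)] using this

theorem _root_.Paper.dmap_fst : Dmap L fun p : X × Y => p.1 := of_reindex _ Sum.inl fun _ => rfl

theorem _root_.Paper.dmap_snd : Dmap L fun p : X × Y => p.2 := of_reindex _ Sum.inr fun _ => rfl

@[fun_prop] theorem comp {g : Y → Z} {f : X → Y} (hg : Dmap L g) (hf : Dmap L f) :
    Dmap L fun x => g (f x) := by
  have h1 : DPred L fun p : (X × Z) × Y => f p.1.1 = p.2 :=
    DPred.reindex (P := fun p : X × Y => f p.1 = p.2) hf (fun p : (X × Z) × Y => (p.1.1, p.2))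
      (Sum.elim (Sum.inl ∘ Sum.inl) Sum.inr) fun p => by funext i; rcases i with i | i <;> rfl
  have h2 : DPred L fun p : (X × Z) × Y => g p.2 = p.1.2 :=
    DPred.reindex (P := fun p : Y × Z => g p.1 = p.2) hg (fun p : (X × Z) × Y => (p.2, p.1.2))
      (Sum.elim Sum.inr (Sum.inl ∘ Sum.inr)) fun p => by funext i; rcases i with i | i <;> rfl
  have := (h1.and h2).ex (P := fun (p : X × Z) y => f p.1 = y ∧ g y = p.2)
  simpa [Dmap] using this

@[fun_prop] theorem fst {f : X → Y × Z} (hf : Dmap L f) : Dmap L fun x => (f x).1 :=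
  dmap_fst.comp hf

@[fun_prop] theorem snd {f : X → Y × Z} (hf : Dmap L f) : Dmap L fun x => (f x).2 :=
  dmap_snd.comp hf

@[fun_prop] theorem prodMk {f : X → Y} {g : X → Z} (hf : Dmap L f) (hg : Dmap L g) :
    Dmap L fun x => (f x, g x) := by
  have h1 : DPred L fun p : X × (Y × Z) => f p.1 = p.2.1 :=
    DPred.reindex (P := fun p : X × Y => f p.1 = p.2) hf (fun p : X × (Y × Z) => (p.1, p.2.1))
      (Sum.elim Sum.inl (Sum.inr ∘ Sum.inl)) fun p => by funext i; rcases i with i | i <;> rfl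
  have h2 : DPred L fun p : X × (Y × Z) => g p.1 = p.2.2 :=
    DPred.reindex (P := fun p : X × Z => g p.1 = p.2) hg (fun p : X × (Y × Z) => (p.1, p.2.2))
      (Sum.elim Sum.inl (Sum.inr ∘ Sum.inr)) fun p => by funext i; rcases i with i | i <;> rfl
  simpa [Dmap, Prod.ext_iff] using h1.and h2

@[fun_prop] theorem apply {κ : Type} [Finite κ] (k : κ) : Dmap L fun f : κ → X => f k :=
  of_reindex _ (fun i => (k, i)) fun _ => rfl

@[fun_prop] theorem pi {κ : Type} [Finite κ] {f : X → κ → Y} (hf : ∀ k, Dmap L fun x => f x k) :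
    Dmap L fun x => f x := by
  have h1 (k : κ) : DPred L fun p : X × (κ → Y) => f p.1 k = p.2 k :=
    DPred.reindex (P := fun p : X × Y => f p.1 k = p.2) (hf k)
      (fun p : X × (κ → Y) => (p.1, p.2 k))
      (Sum.elim Sum.inl (fun i => Sum.inr (k, i))) fun p => by funext i; rcases i with i | i <;> rfl
  simpa [Dmap, funext_iff] using DPred.forall_fin h1

end Dmap

theorem dpred_iff {P : X → Prop} : DPred L P ↔ Dmap L P := by
  have hT : DPred L fun q : Prop => q := by simpa using DPred.eq_const (L := L) True
  constructor
  · intro h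
    have h1 := (h.reindex (fun p : X × Prop => p.1) Sum.inl fun _ => rfl)
    have h2 := (hT.reindex (fun p : X × Prop => p.2) Sum.inr fun _ => rfl)
    have h3 := (h1.and h2).or (h1.not.and h2.not)
    unfold Dmap
    convert h3 using 2
    rename_i p
    by_cases hp : P p.1 <;> by_cases hq : p.2 <;> simp [hp, hq]
  · exact fun h => Dmap.dpred_comp (P := fun q : Prop => q) hT h

theorem DPred.dmap {P : X → Prop} (h : DPred L P) : Dmap L P := dpred_iff.1 h

theorem Dmap.dpred {P : X → Prop} (h : Dmap L P) : DPred L P := dpred_iff.2 h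

end Definability

section Definability

variable {L : FirstOrder.Language} [L.Structure ℝ]
variable {X Y Z W : Type} [Dt L X] [Dt L Y] [Dt L Z] [Dt L W]

namespace Dmap

@[fun_prop] theorem and {P Q : X → Prop} (hP : Dmap L P) (hQ : Dmap L Q) :
    Dmap L fun x => P x ∧ Q x := (hP.dpred.and hQ.dpred).dmap

@[fun_prop] theorem or {P Q : X → Prop} (hP : Dmap L P) (hQ : Dmap L Q) :
    Dmap L fun x => P x ∨ Q x := (hP.dpred.or hQ.dpred).dmap

@[fun_prop] theorem not {P : X → Prop} (hP : Dmap L P) : Dmap L fun x => ¬ P x :=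
  hP.dpred.not.dmap

theorem imp {P Q : X → Prop} (hP : Dmap L P) (hQ : Dmap L Q) : Dmap L fun x => P x → Q x := by
  simpa only [imp_iff_not_or] using hP.not.or hQ

@[fun_prop] theorem iff {P Q : X → Prop} (hP : Dmap L P) (hQ : Dmap L Q) :
    Dmap L fun x => P x ↔ Q x := by
  simpa only [iff_iff_implies_and_implies] using (hP.imp hQ).and (hQ.imp hP)

theorem ex {P : X → Y → Prop} (hP : Dmap L fun p : X × Y => P p.1 p.2) :
    Dmap L fun x => ∃ y, P x y := (DPred.ex hP.dpred).dmap

theorem all {P : X → Y → Prop} (hP : Dmap L fun p : X × Y => P p.1 p.2) :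
    Dmap L fun x => ∀ y, P x y := by
  simpa using (ex (P := fun x y => ¬ P x y) hP.not).not

theorem all_fin {κ : Type} [Finite κ] {P : X → κ → Prop} (hP : ∀ k, Dmap L fun x => P x k) :
    Dmap L fun x => ∀ k, P x k := (DPred.forall_fin fun k => (hP k).dpred).dmap

theorem ex_fin {κ : Type} [Finite κ] {P : X → κ → Prop} (hP : ∀ k, Dmap L fun x => P x k) :
    Dmap L fun x => ∃ k, P x k := by
  simpa using (all_fin (P := fun x k => ¬ P x k) fun k => (hP k).not).not

theorem eq_pred : Dmap L fun p : X × X => p.1 = p.2 := DPred.eq_diag.dmap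

@[fun_prop] theorem eq {f g : X → Y} (hf : Dmap L f) (hg : Dmap L g) :
    Dmap L fun x => f x = g x := eq_pred.comp (hf.prodMk hg)

theorem of_graph {f : X → Y} (hf : Dmap L fun p : X × Y => f p.1 = p.2) : Dmap L f := hf.dpred

theorem of_graph' {f : X → Y} {P : X → Y → Prop} (hP : Dmap L fun p : X × Y => P p.1 p.2)
    (h : ∀ x y, f x = y ↔ P x y) : Dmap L f := of_graph (by simpa only [h] using hP)

@[fun_prop] theorem ite {P : X → Prop} [∀ x, Decidable (P x)] {f g : X → Y} (hP : Dmap L P) (hf : Dmap L f)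
    (hg : Dmap L g) : Dmap L fun x => if P x then f x else g x := by
  refine of_graph' (P := fun x y => (P x ∧ f x = y) ∨ (¬ P x ∧ g x = y)) (by fun_prop) fun x y => ?_
  split_ifs with h <;> simp [h]

theorem coe_subtype {P : X → Prop} (hP : DPred L P) :
    letI := dtSubtype hP
    Dmap L fun x : {x // P x} => x.1 :=
  letI := dtSubtype hP
  of_reindex _ _root_.id fun _ => rfl

end Dmap

theorem def_iff {n : ℕ} {S : Set (Fin n → ℝ)} : Def L n S ↔ Dmap L fun x => x ∈ S := by
  rw [← dpred_iff]
  unfold Def DPred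
  let σ : Fin n × Unit ≃ Fin n := Equiv.prodPUnit _
  constructor
  · intro h
    exact h.image_comp_equiv σ
  · intro h
    convert h.image_comp_equiv σ.symm
    ext x
    constructor
    · intro hx; exact ⟨_, ⟨x, hx, rfl⟩, rfl⟩
    · rintro ⟨_, ⟨y, hy, rfl⟩, rfl⟩; exact hy

theorem def1_iff {S : Set ℝ} : Def1 L S ↔ Dmap L fun x => x ∈ S := by
  unfold Def1
  rw [def_iff]
  constructor
  · intro h
    exact h.comp (f := fun (x : ℝ) (_ : Fin 1) => x) (by fun_prop)
  · intro h
    exact h.comp (f := fun x : Fin 1 → ℝ => x 0) (by fun_prop)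

/-- Definability by structural recursion on the expression. -/
theorem Dmap.auto {f : X → Y} (h : Dmap L f := by
    repeat' first
      | fun_prop
      | with_reducible refine Dmap.all ?_
      | with_reducible refine Dmap.ex ?_
      | with_reducible refine Dmap.imp ?_ ?_
      | with_reducible refine Dmap.and ?_ ?_
      | with_reducible refine Dmap.or ?_ ?_
      | with_reducible refine Dmap.not ?_
      | with_reducible refine Dmap.iff ?_ ?_
      | with_reducible refine Dmap.all_fin fun _ => ?_
      | with_reducible refine Dmap.ex_fin fun _ => ?_
      | with_reducible refine Dmap.pi fun _ => ?_
      | with_reducible refine Dmap.prodMk ?_ ?_) : Dmap L f := h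

variable (L) in
/-- A locally o-minimal expansion of the real field. -/
class OM : Prop where
  field : ExpandsOrderedField L
  lom : LocallyOMinimal L

variable [OM L]

namespace Dmap

theorem lt_pred : Dmap L fun p : ℝ × ℝ => p.1 < p.2 :=
  (def_iff.1 (OM.field (L := L)).1).comp (f := fun p : ℝ × ℝ => ![p.1, p.2])
    (by refine pi fun k => ?_; fin_cases k <;> simp <;> fun_prop)

@[fun_prop] theorem lt {f g : X → ℝ} (hf : Dmap L f) (hg : Dmap L g) :
    Dmap L fun x => f x < g x := lt_pred.comp (hf.prodMk hg)

@[fun_prop] theorem le {f g : X → ℝ} (hf : Dmap L f) (hg : Dmap L g) :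
    Dmap L fun x => f x ≤ g x := by simpa using (hg.lt hf).not

theorem add_pred : Dmap L fun p : ℝ × ℝ => p.1 + p.2 :=
  of_graph <| (def_iff.1 (OM.field (L := L)).2.1).comp
    (f := fun p : (ℝ × ℝ) × ℝ => ![p.1.1, p.1.2, p.2])
    (by refine pi fun k => ?_; fin_cases k <;> simp <;> fun_prop)

@[fun_prop] theorem add {f g : X → ℝ} (hf : Dmap L f) (hg : Dmap L g) :
    Dmap L fun x => f x + g x := add_pred.comp (hf.prodMk hg)

theorem mul_pred : Dmap L fun p : ℝ × ℝ => p.1 * p.2 :=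
  of_graph <| (def_iff.1 (OM.field (L := L)).2.2.1).comp
    (f := fun p : (ℝ × ℝ) × ℝ => ![p.1.1, p.1.2, p.2])
    (by refine pi fun k => ?_; fin_cases k <;> simp <;> fun_prop)

@[fun_prop] theorem mul {f g : X → ℝ} (hf : Dmap L f) (hg : Dmap L g) :
    Dmap L fun x => f x * g x := mul_pred.comp (hf.prodMk hg)

@[fun_prop] theorem neg {f : X → ℝ} (hf : Dmap L f) : Dmap L fun x => - f x := by
  simpa using (const (L := L) (X := X) (-1 : ℝ)).mul hf

@[fun_prop] theorem sub {f g : X → ℝ} (hf : Dmap L f) (hg : Dmap L g) :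
    Dmap L fun x => f x - g x := by
  simpa only [sub_eq_add_neg] using hf.add hg.neg

@[fun_prop] theorem inv {f : X → ℝ} (hf : Dmap L f) : Dmap L fun x => (f x)⁻¹ := by
  refine of_graph' (P := fun x y => (f x = 0 ∧ y = 0) ∨ (f x * y = 1)) (by fun_prop) fun x y => ?_
  by_cases h : f x = 0
  · simp [h, eq_comm]
  · simp only [h, false_and, false_or]
    exact ⟨fun e => e ▸ mul_inv_cancel₀ h, fun e => inv_eq_of_mul_eq_one_right e⟩

@[fun_prop] theorem div {f g : X → ℝ} (hf : Dmap L f) (hg : Dmap L g) :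
    Dmap L fun x => f x / g x := by
  simpa only [div_eq_mul_inv] using hf.mul hg.inv

@[fun_prop] theorem pow {f : X → ℝ} (hf : Dmap L f) (n : ℕ) : Dmap L fun x => f x ^ n := by
  induction n with
  | zero => simp only [pow_zero]; fun_prop
  | succ n ih => simp only [pow_succ]; fun_prop

@[fun_prop] theorem max {f g : X → ℝ} (hf : Dmap L f) (hg : Dmap L g) :
    Dmap L fun x => max (f x) (g x) := by
  classical
  simp only [max_def]; fun_prop

@[fun_prop] theorem min {f g : X → ℝ} (hf : Dmap L f) (hg : Dmap L g) :
    Dmap L fun x => min (f x) (g x) := by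
  classical
  simp only [min_def]; fun_prop

@[fun_prop] theorem abs {f : X → ℝ} (hf : Dmap L f) : Dmap L fun x => |f x| := by
  simp only [_root_.abs]; exact hf.max hf.neg

@[fun_prop] theorem vsub {κ : Type} [Finite κ] {f g : X → κ → ℝ} (hf : Dmap L f) (hg : Dmap L g) :
    Dmap L fun x => f x - g x := by
  refine pi fun k => ?_; simp only [Pi.sub_apply]; fun_prop

@[fun_prop] theorem finset_sum {κ : Type} {s : Finset κ} {f : κ → X → ℝ}
    (hf : ∀ k, Dmap L (f k)) : Dmap L fun x => ∑ k ∈ s, f k x := by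
  classical
  induction s using Finset.induction_on with
  | empty => simp only [Finset.sum_empty]; fun_prop
  | insert a s ha ih => simp only [Finset.sum_insert ha]; fun_prop

@[fun_prop] theorem finset_prod {κ : Type} {s : Finset κ} {f : κ → X → ℝ}
    (hf : ∀ k, Dmap L (f k)) : Dmap L fun x => ∏ k ∈ s, f k x := by
  classical
  induction s using Finset.induction_on with
  | empty => simp only [Finset.prod_empty]; fun_prop
  | insert a s ha ih => simp only [Finset.prod_insert ha]; fun_prop

@[fun_prop] theorem norm {κ : Type} [Fintype κ] {f : X → κ → ℝ} (hf : Dmap L f) :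
    Dmap L fun x => ‖f x‖ := by
  have : Dmap L fun p : X × ℝ => ∃ k, |f p.1 k| = p.2 := ex_fin fun k => by fun_prop
  have h2 : Dmap L fun p : X × ℝ => ∀ k, |f p.1 k| ≤ p.2 := all_fin fun k => by fun_prop
  refine of_graph' (P := fun x y => 0 ≤ y ∧ (∀ k, |f x k| ≤ y) ∧ (y = 0 ∨ ∃ k, |f x k| = y))
    (by fun_prop) fun x y => ?_
  constructor
  · rintro rfl
    refine ⟨norm_nonneg _, fun k => norm_le_pi_norm (f x) k, ?_⟩
    by_cases h : Nonempty κ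
    · right; obtain ⟨k, hk⟩ := Finite.exists_max fun k => |f x k|
      exact ⟨k, le_antisymm (norm_le_pi_norm (f x) k)
        ((pi_norm_le_iff_of_nonneg (abs_nonneg _)).2 hk)⟩
    · left
      have := not_nonempty_iff.1 h
      exact norm_of_subsingleton _
  · rintro ⟨h0, h1, h2⟩
    refine le_antisymm ((pi_norm_le_iff_of_nonneg h0).2 h1) ?_
    rcases h2 with rfl | ⟨k, rfl⟩
    · exact norm_nonneg _
    · exact norm_le_pi_norm (f x) k

@[fun_prop] theorem finSnoc {n : ℕ} {f : X → Fin n → Y} {g : X → Y} (hf : Dmap L f)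
    (hg : Dmap L g) : Dmap L fun x => (Fin.snoc (α := fun _ => Y) (f x) (g x) : Fin (n + 1) → Y) := by
  refine pi fun k => Fin.lastCases ?_ (fun i => ?_) k
  · simpa using hg
  · simp only [Fin.snoc_castSucc]; fun_prop

end Dmap

end Definability

section Thin

variable {L : FirstOrder.Language} [L.Structure ℝ] [OM L] {X : Type} [Dt L X]

/-- A definable set of reals has either finitely many points or nonempty interior. -/
theorem finite_of_interior_eq_empty {S : Set ℝ} (hS : Dmap L fun x => x ∈ S)
    (hi : interior S = ∅) : S.Finite := by
  have key : ∀ T : Set ℝ, (Dmap L fun x => x ∈ T) → interior T = ∅ → (T ∩ Icc (-1) 1).Finite := by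
    intro T hT hT0
    have hloc : ∀ a ∈ Icc (-1 : ℝ) 1, ∃ V ∈ 𝓝[Icc (-1) 1] a, (T ∩ V).Finite := by
      intro a _
      obtain ⟨b, c, hb, hc, P, J, h⟩ := OM.lom (L := L) T (def1_iff.2 hT) a
      refine ⟨Ioo b c, mem_nhdsWithin_of_mem_nhds (Ioo_mem_nhds hb hc),
        P.finite_toSet.subset fun x hx => ?_⟩
      rw [h] at hx
      refine hx.resolve_right fun hx => ?_
      simp only [mem_iUnion] at hx
      obtain ⟨p, hp, hx⟩ := hx
      have : x ∈ interior T := mem_interior.2 ⟨Ioo p.1 p.2, fun y hy => ?_, isOpen_Ioo, hx⟩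
      · simp [hT0] at this
      · have : y ∈ T ∩ Ioo b c := by
          rw [h]; right; simp only [mem_iUnion]; exact ⟨p, hp, hy⟩
        exact this.1
    have := isCompact_Icc.induction_on (p := fun V => (T ∩ V).Finite) (by simp)
      (fun s t hst ht => ht.subset (inter_subset_inter_right _ hst))
      (fun s t hs ht => by rw [inter_union_distrib_left]; exact hs.union ht) hloc
    exact this
  have h2 := key {y | y⁻¹ ∈ S ∧ y ≠ 0} (by simp only [mem_ofPred_eq]; exact .auto) (by
    by_contra hne
    obtain ⟨x, hx⟩ := nonempty_iff_ne_empty.2 hne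
    have hx0 : x ≠ 0 := (interior_subset hx).2
    have h3 : ∀ᶠ y in 𝓝 x⁻¹, y⁻¹ ∈ {y | y⁻¹ ∈ S ∧ y ≠ 0} :=
      (continuousAt_inv₀ (inv_ne_zero hx0)).eventually
        (by rw [inv_inv]; exact mem_interior_iff_mem_nhds.1 hx)
    have : x⁻¹ ∈ interior S := mem_interior_iff_mem_nhds.2 (by
      filter_upwards [h3] with y hy
      simpa using hy.1)
    simp [hi] at this)
  refine ((key S hS hi).union (h2.image (·⁻¹))).subset fun x hx => ?_
  by_cases h : |x| ≤ 1
  · exact Or.inl ⟨hx, abs_le.1 h⟩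
  · push Not at h
    have hx0 : x ≠ 0 := by rintro rfl; norm_num at h
    refine Or.inr ⟨x⁻¹, ⟨⟨by simpa using hx, inv_ne_zero hx0⟩, abs_le.1 ?_⟩, inv_inv x⟩
    rw [abs_inv]
    exact inv_le_one_of_one_le₀ h.le

theorem eventually_or_eventually_not {P : ℝ → Prop} (hP : Dmap L P) (a : ℝ) :
    (∀ᶠ x in 𝓝[>] a, P x) ∨ ∀ᶠ x in 𝓝[>] a, ¬ P x := by
  obtain ⟨b, c, hb, hc, F, J, h⟩ := OM.lom (L := L) {x | P x} (def1_iff.2 hP) a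
  have hI : ∀ᶠ x in 𝓝[>] a, x ∈ Ioo b c := nhdsWithin_le_nhds (Ioo_mem_nhds hb hc)
  have hgt : ∀ᶠ x in 𝓝[>] a, a < x := self_mem_nhdsWithin
  have hmem : ∀ x ∈ Ioo b c, P x ↔ (x ∈ F ∨ ∃ p ∈ J, x ∈ Ioo p.1 p.2) := by
    intro x hx
    have : x ∈ {x | P x} ∩ Ioo b c ↔ x ∈ (F : Set ℝ) ∪ ⋃ p ∈ J, Ioo p.1 p.2 := by rw [h]
    simpa [hx, -mem_Ioo] using this
  by_cases hJ : ∃ p ∈ J, p.1 ≤ a ∧ a < p.2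
  · left
    obtain ⟨p, hp, h1, h2⟩ := hJ
    have : ∀ᶠ x in 𝓝[>] a, x < p.2 := nhdsWithin_le_nhds (Iio_mem_nhds h2)
    filter_upwards [hI, hgt, this] with x hx hax hx2
    exact (hmem x hx).2 (Or.inr ⟨p, hp, h1.trans_lt hax, hx2⟩)
  · right
    push Not at hJ
    have h1 : ∀ᶠ x in 𝓝[>] a, ∀ y ∈ F, x ≠ y := by
      rw [Filter.eventually_all_finset]
      intro y _
      rcases le_or_gt y a with hy | hy
      · filter_upwards [hgt] with x hx using (hy.trans_lt hx).ne'
      · filter_upwards [nhdsWithin_le_nhds (Iio_mem_nhds hy)] with x hx using ne_of_lt hx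
    have h2 : ∀ᶠ x in 𝓝[>] a, ∀ p ∈ J, x ∉ Ioo p.1 p.2 := by
      rw [Filter.eventually_all_finset]
      intro p hp
      rcases le_or_gt p.1 a with hy | hy
      · filter_upwards [hgt] with x hx h
        exact absurd (h.2.trans_le (hJ p hp hy)) (not_lt.2 hx.le)
      · filter_upwards [nhdsWithin_le_nhds (Iio_mem_nhds hy)] with x hx h
        exact absurd h.1 (not_lt.2 (le_of_lt hx))
    filter_upwards [hI, h1, h2] with x hx hx1 hx2
    rw [hmem x hx]
    rintro (h | ⟨p, hp, h⟩)
    exacts [hx1 x h rfl, hx2 p hp h]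

theorem Dmap.eventually_nhds {n : ℕ} {P : X → (Fin n → ℝ) → Prop} {f : X → Fin n → ℝ}
    (hP : Dmap L fun p : X × (Fin n → ℝ) => P p.1 p.2) (hf : Dmap L f) :
    Dmap L fun x => ∀ᶠ y in 𝓝 (f x), P x y := by
  simp only [Metric.eventually_nhds_iff, dist_eq_norm]
  exact .auto

theorem Dmap.eventually_nhds_real {P : X → ℝ → Prop} {f : X → ℝ}
    (hP : Dmap L fun p : X × ℝ => P p.1 p.2) (hf : Dmap L f) :
    Dmap L fun x => ∀ᶠ y in 𝓝 (f x), P x y := by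
  simp only [Metric.eventually_nhds_iff, Real.dist_eq]
  exact .auto

/-- A set with empty interior. -/
def Thin {E : Type*} [TopologicalSpace E] (S : Set E) : Prop := interior S = ∅

section TopologicalSpace
variable {E : Type*} [TopologicalSpace E]

theorem not_thin_iff {S : Set E} : ¬ Thin S ↔ ∃ U ⊆ S, IsOpen U ∧ U.Nonempty := by
  rw [Thin, ← Ne, ← nonempty_iff_ne_empty]
  exact ⟨fun h => ⟨_, interior_subset, isOpen_interior, h⟩,
    fun ⟨U, hUS, hU, hne⟩ => hne.mono (interior_maximal hUS hU)⟩

theorem not_thin_iff_nhds {S : Set E} : ¬ Thin S ↔ ∃ x, ∀ᶠ y in 𝓝 x, y ∈ S := by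
  rw [Thin, ← Ne, ← nonempty_iff_ne_empty]
  exact ⟨fun ⟨x, hx⟩ => ⟨x, mem_interior_iff_mem_nhds.1 hx⟩,
    fun ⟨x, hx⟩ => ⟨x, mem_interior_iff_mem_nhds.2 hx⟩⟩

theorem Thin.mono {S T : Set E} (hT : Thin T) (h : S ⊆ T) : Thin S :=
  subset_eq_empty (interior_mono h) hT

theorem Thin.exists_notMem {S U : Set E} (hS : Thin S) (hU : IsOpen U) (hne : U.Nonempty) :
    ∃ x ∈ U, x ∉ S := by
  by_contra! h
  exact not_thin_iff.2 ⟨U, h, hU, hne⟩ hS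

end TopologicalSpace

theorem Dmap.thin {n : ℕ} {P : X → (Fin n → ℝ) → Prop}
    (hP : Dmap L fun p : X × (Fin n → ℝ) => P p.1 p.2) :
    Dmap L fun x => Thin {y | P x y} := by
  have : ∀ x, Thin {y | P x y} ↔ ¬ ∃ y, ∀ᶠ y' in 𝓝 y, P x y' := fun x =>
    not_iff_comm.1 not_thin_iff_nhds |>.symm
  simp only [this]
  refine (Dmap.ex (Dmap.eventually_nhds (P := fun p : X × (Fin n → ℝ) => fun y => P p.1 y) ?_ ?_)).not <;> fun_prop

theorem Dmap.mem_interior {n : ℕ} {S : Set (Fin n → ℝ)} (hS : Dmap L fun x => x ∈ S) :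
    Dmap L fun x => x ∈ interior S := by
  simp only [mem_interior_iff_mem_nhds]
  exact Dmap.eventually_nhds (P := fun _ y => y ∈ S) (f := fun x => x) (by fun_prop) (by fun_prop)

theorem Dmap.mem_ball {n : ℕ} (x : Fin n → ℝ) (r : ℝ) : Dmap L fun y => y ∈ Metric.ball x r := by
  simp only [Metric.mem_ball, dist_eq_norm]
  exact .auto

variable (L) in
/-- A countable family of definable open sets that is cofinal for inclusion. -/
theorem exists_definable_basis (n : ℕ) : ∃ B : ℕ → Set (Fin n → ℝ), (∀ i, IsOpen (B i)) ∧
    (∀ i, (B i).Nonempty) ∧ (∀ i, Dmap L fun x => x ∈ B i) ∧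
    ∀ U, IsOpen U → U.Nonempty → ∃ i, B i ⊆ U := by
  let B : ℕ × ℕ → Set (Fin n → ℝ) := fun p =>
    Metric.ball (TopologicalSpace.denseSeq (Fin n → ℝ) p.1) (1 / (p.2 + 1))
  have hpos : ∀ k : ℕ, (0 : ℝ) < 1 / (k + 1) := fun k => by positivity
  refine ⟨fun i => B i.unpair, fun i => Metric.isOpen_ball,
    fun i => Metric.nonempty_ball.2 (hpos _), fun i => Dmap.mem_ball _ _, fun U hU ⟨x, hx⟩ => ?_⟩
  obtain ⟨ε, hε, hεU⟩ := Metric.isOpen_iff.1 hU x hx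
  obtain ⟨k, hk⟩ := exists_nat_one_div_lt (half_pos hε)
  obtain ⟨m, hm⟩ := (TopologicalSpace.denseRange_denseSeq (Fin n → ℝ)).exists_mem_open
    Metric.isOpen_ball (Metric.nonempty_ball.2 (hpos k) : (Metric.ball x (1 / ((k : ℝ) + 1))).Nonempty)
  refine ⟨Nat.pair m k, fun y hy => hεU ?_⟩
  simp only [Nat.unpair_pair, B, Metric.mem_ball] at hy hm ⊢
  calc dist y x ≤ dist y (TopologicalSpace.denseSeq (Fin n → ℝ) m) + dist _ x :=
        dist_triangle _ _ _
    _ < ε := by linarith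

theorem continuous_snoc (n : ℕ) :
    Continuous fun p : (Fin n → ℝ) × ℝ => (Fin.snoc (α := fun _ => ℝ) p.1 p.2 : Fin (n + 1) → ℝ) :=
  Continuous.finSnoc (A := fun _ => ℝ) continuous_fst continuous_snd

theorem isOpen_snoc_box {n : ℕ} {V : Set (Fin n → ℝ)} {I : Set ℝ} (hV : IsOpen V) (hI : IsOpen I) :
    IsOpen {z : Fin (n + 1) → ℝ | Fin.init z ∈ V ∧ z (Fin.last n) ∈ I} :=
  (hV.preimage (by unfold Fin.init; fun_prop)).inter (hI.preimage (by fun_prop))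

theorem exists_snoc_box_subset {n : ℕ} {U : Set (Fin (n + 1) → ℝ)} (hU : IsOpen U)
    (hne : U.Nonempty) : ∃ (V : Set (Fin n → ℝ)) (a b : ℝ), IsOpen V ∧ V.Nonempty ∧ a < b ∧
      ∀ x ∈ V, ∀ t ∈ Ioo a b, (Fin.snoc (α := fun _ => ℝ) x t : Fin (n + 1) → ℝ) ∈ U := by
  obtain ⟨z, hz⟩ := hne
  have h1 : (fun p : (Fin n → ℝ) × ℝ => (Fin.snoc (α := fun _ => ℝ) p.1 p.2 : Fin (n + 1) → ℝ)) ⁻¹' U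
      ∈ 𝓝 ((Fin.init z : Fin n → ℝ), z (Fin.last n)) :=
    (continuous_snoc n).continuousAt.preimage_mem_nhds
      (by simpa using hU.mem_nhds hz)
  rw [nhds_prod_eq, Filter.mem_prod_iff] at h1
  obtain ⟨V, hV, I, hI, h⟩ := h1
  obtain ⟨a, b, hab, hI⟩ := mem_nhds_iff_exists_Ioo_subset.1 hI
  obtain ⟨V', hV', hVo, hzV⟩ := mem_nhds_iff.1 hV
  exact ⟨V', a, b, hVo, ⟨_, hzV⟩, hab.1.trans hab.2, fun x hx t ht =>
    h (mk_mem_prod (hV' hx) (hI ht))⟩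

theorem thin_iUnion {n : ℕ} {κ : Type} [Countable κ] {S : κ → Set (Fin n → ℝ)}
    (hS : ∀ k, Dmap L fun x => x ∈ S k) (ht : ∀ k, Thin (S k)) : Thin (⋃ k, S k) := by
  induction n generalizing κ with
  | zero =>
    by_contra h
    obtain ⟨U, hU, -, x, hx⟩ := not_thin_iff.1 h
    obtain ⟨k, hk⟩ := mem_iUnion.1 (hU hx)
    refine not_thin_iff.2 ⟨{x}, by simpa using hk, ?_, singleton_nonempty x⟩ (ht k)
    exact isOpen_discrete _
  | succ n ih =>
    by_contra h
    obtain ⟨U, hUS, hUo, hne⟩ := not_thin_iff.1 h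
    obtain ⟨V, a, b, hV, hVne, hab, hVU⟩ := exists_snoc_box_subset hUo hne
    let T : κ × ℚ × ℚ → Set (Fin n → ℝ) := fun p =>
      {x | p.2.1 < p.2.2 ∧ ∀ t : ℝ, p.2.1 < t → t < p.2.2 →
        (Fin.snoc (α := fun _ => ℝ) x t : Fin (n + 1) → ℝ) ∈ S p.1}
    have hT : Thin (⋃ p, T p) := by
      refine ih (fun p => ?_) (fun p => ?_)
      · have := hS p.1
        simp only [T, mem_ofPred_eq]; exact .auto
      · by_contra hp
        obtain ⟨W, hWT, hW, x, hx⟩ := not_thin_iff.1 hp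
        refine not_thin_iff.2 ⟨_, ?_, isOpen_snoc_box hW (isOpen_Ioo (a := (p.2.1 : ℝ)) (b := p.2.2)),
          ?_⟩ (ht p.1)
        · rintro z ⟨h1, h2⟩
          have := (hWT h1).2 _ h2.1 h2.2
          rwa [Fin.snoc_init_self] at this
        · have : (p.2.1 : ℝ) < p.2.2 := by exact_mod_cast (hWT hx).1
          obtain ⟨t, ht⟩ := exists_between this
          exact ⟨Fin.snoc (α := fun _ => ℝ) x t, by simpa using hx, by simpa using ht⟩
    obtain ⟨x, hxV, hx⟩ := hT.exists_notMem hV hVne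
    have hfin : ∀ k, {t : ℝ | (Fin.snoc (α := fun _ => ℝ) x t : Fin (n + 1) → ℝ) ∈ S k}.Finite := by
      intro k
      have := hS k
      refine finite_of_interior_eq_empty (L := L) (by simp only [mem_ofPred_eq]; exact .auto) ?_
      by_contra hk
      obtain ⟨I, hIS, hI, t, htI⟩ := not_thin_iff.1 hk
      obtain ⟨c, d, hcd, hI⟩ := mem_nhds_iff_exists_Ioo_subset.1 (hI.mem_nhds htI)
      obtain ⟨q, hq1, hq2⟩ := exists_rat_btwn hcd.1
      obtain ⟨q', hq1', hq2'⟩ := exists_rat_btwn hcd.2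
      refine hx (mem_iUnion.2 ⟨(k, q, q'), ?_, fun t h1 h2 => hIS (hI ⟨?_, ?_⟩)⟩)
      · exact_mod_cast hq2.trans hq1'
      · exact hq1.trans h1
      · exact h2.trans hq2'
    have hc : (Ioo a b).Countable := (countable_iUnion fun k => (hfin k).countable).mono
      fun t ht => by simpa using hUS (hVU x hxV t ht)
    exact absurd (Cardinal.mk_Ioo_real hab ▸ hc.le_aleph0) (not_le.2 Cardinal.aleph0_lt_continuum)

theorem thin_union {n : ℕ} {S T : Set (Fin n → ℝ)} (hS : Dmap L fun x => x ∈ S)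
    (hT : Dmap L fun x => x ∈ T) (hS' : Thin S) (hT' : Thin T) : Thin (S ∪ T) := by
  rw [union_eq_iUnion]
  exact thin_iUnion (L := L) (by rintro (_ | _) <;> simpa) (by rintro (_ | _) <;> simpa)

theorem exists_open_subset_or {n : ℕ} {S U : Set (Fin n → ℝ)} (hS : Dmap L fun x => x ∈ S)
    (hU : IsOpen U) (hne : U.Nonempty) :
    (∃ V ⊆ U, IsOpen V ∧ V.Nonempty ∧ V ⊆ S) ∨ ∃ V ⊆ U, IsOpen V ∧ V.Nonempty ∧ V ⊆ Sᶜ := by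
  obtain ⟨B, hBo, hBne, hBd, hB⟩ := exists_definable_basis L n
  obtain ⟨i, hi⟩ := hB U hU hne
  have hd := hBd i
  by_contra! h
  have h1 : ∀ T : Set (Fin n → ℝ), (∀ V ⊆ U, IsOpen V → V.Nonempty → ¬ V ⊆ T) → Thin (B i ∩ T) := by
    intro T hT
    by_contra h
    obtain ⟨V, hV, hVo, hVne⟩ := not_thin_iff.1 h
    exact hT V (fun x hx => hi (hV hx).1) hVo hVne fun x hx => (hV hx).2
  have := thin_union (L := L) (S := B i ∩ S) (T := B i ∩ Sᶜ)
    (by simp only [mem_inter_iff]; fun_prop)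
    (by simp only [mem_inter_iff, mem_compl_iff]; fun_prop) (h1 _ h.1) (h1 _ h.2)
  rw [inter_union_compl] at this
  exact not_thin_iff.2 ⟨_, subset_rfl, hBo i, hBne i⟩ this

/-- If generic fibres over the first factor are thin, then so are those over the second. -/
theorem thin_swap {m n : ℕ} {P : (Fin m → ℝ) → (Fin n → ℝ) → Prop}
    (hP : Dmap L fun p : (Fin m → ℝ) × (Fin n → ℝ) => P p.1 p.2)
    (h : Thin {x | ¬ Thin {y | P x y}}) : Thin {y | ¬ Thin {x | P x y}} := by
  obtain ⟨B, hBo, hBne, hBd, hB⟩ := exists_definable_basis L m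
  have key : Thin (⋃ i, {y | ∀ x, x ∈ B i → P x y}) := by
    refine thin_iUnion (L := L) (fun i => ?_) (fun i => ?_)
    · have := hBd i
      simp only [mem_ofPred_eq]; exact .auto
    · by_contra hi
      obtain ⟨V, hV, hVo, hVne⟩ := not_thin_iff.1 hi
      refine not_thin_iff.2 ⟨B i, fun x hx => ?_, hBo i, hBne i⟩ h
      exact not_thin_iff.2 ⟨V, fun y hy => hV hy x hx, hVo, hVne⟩
  refine key.mono fun y hy => ?_
  obtain ⟨U, hU, hUo, hUne⟩ := not_thin_iff.1 hy
  obtain ⟨i, hi⟩ := hB U hUo hUne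
  exact mem_iUnion.2 ⟨i, fun x hx => hU (hi hx)⟩

end Thin

section Generic

variable {L : FirstOrder.Language} [L.Structure ℝ] [OM L] {X : Type} [Dt L X]

theorem Thin.exists_open {n : ℕ} {P : (Fin n → ℝ) → Prop} (hP : Dmap L P) (h : Thin {x | ¬ P x})
    {U : Set (Fin n → ℝ)} (hU : IsOpen U) (hne : U.Nonempty) :
    ∃ V ⊆ U, IsOpen V ∧ V.Nonempty ∧ ∀ x ∈ V, P x := by
  rcases exists_open_subset_or (L := L) (S := {x | P x}) hP hU hne with h1 | ⟨V, _, hV, hVne, hVP⟩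
  · exact h1
  · exact absurd h (not_thin_iff.2 ⟨V, hVP, hV, hVne⟩)

theorem Thin.not_eventually {n : ℕ} {P : (Fin n → ℝ) → Prop} (hP : Dmap L P)
    (h : Thin {x | ¬ P x}) : Thin {x | ¬ ∀ᶠ y in 𝓝 x, P y} := by
  by_contra hc
  obtain ⟨U, hU, hUo, hne⟩ := not_thin_iff.1 hc
  obtain ⟨V, hVU, hV, ⟨x, hx⟩, hVP⟩ := h.exists_open hP hUo hne
  exact hU (hVU hx) (Filter.mem_of_superset (hV.mem_nhds hx) hVP)

theorem thin_and {n : ℕ} {P Q : (Fin n → ℝ) → Prop} (hP : Dmap L P) (hQ : Dmap L Q)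
    (h : Thin {x | ¬ P x}) (h' : Thin {x | ¬ Q x}) : Thin {x | ¬ (P x ∧ Q x)} := by
  refine (thin_union (L := L) hP.not hQ.not h h').mono fun x hx => ?_
  exact not_and_or.1 hx

theorem thin_forall_fin {n : ℕ} {κ : Type} [Finite κ] {P : κ → (Fin n → ℝ) → Prop}
    (hP : ∀ k, Dmap L (P k)) (h : ∀ k, Thin {x | ¬ P k x}) : Thin {x | ¬ ∀ k, P k x} := by
  refine (thin_iUnion (L := L) (fun k => (hP k).not) h).mono fun x hx => ?_
  exact mem_iUnion.2 (not_forall.1 hx)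

theorem thin_real_iUnion {κ : Type} [Countable κ] {S : κ → Set ℝ}
    (hS : ∀ k, Dmap L fun x => x ∈ S k) (ht : ∀ k, Thin (S k)) : Thin (⋃ k, S k) := by
  have hc : (⋃ k, S k).Countable :=
    countable_iUnion fun k => (finite_of_interior_eq_empty (hS k) (ht k)).countable
  exact interior_eq_empty_iff_dense_compl.2 (hc.dense_compl ℝ)

theorem Dmap.continuousAt {n : ℕ} {F : X → (Fin n → ℝ) → ℝ}
    (hF : Dmap L fun p : X × (Fin n → ℝ) => F p.1 p.2) {a : X → Fin n → ℝ} (ha : Dmap L a) :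
    Dmap L fun x => ContinuousAt (F x) (a x) := by
  simp only [Metric.continuousAt_iff, dist_eq_norm, Real.norm_eq_abs]
  exact .auto

theorem thin_not_continuousAt {n : ℕ} {f : (Fin n → ℝ) → ℝ} (hf : Dmap L f) :
    Thin {x | ¬ ContinuousAt f x} := by
  let D : ℕ → Set (Fin n → ℝ) := fun k =>
    {x | ∀ δ : ℝ, 0 < δ → ∃ y, ‖y - x‖ < δ ∧ 1 / ((k : ℝ) + 1) ≤ |f y - f x|}
  have hD : Thin (⋃ k, D k) := by
    refine thin_iUnion (L := L) (fun k => by simp only [D, mem_ofPred_eq]; exact .auto) fun k => ?_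
    by_contra h
    obtain ⟨U, hUD, hU, hne⟩ := not_thin_iff.1 h
    obtain ⟨B, hBo, hBne, hBd, hB⟩ := exists_definable_basis L n
    obtain ⟨i, hi⟩ := hB U hU hne
    have hBi := hBd i
    have : ∃ j : ℤ, ¬ Thin (B i ∩ {x | (j : ℝ) ≤ ((k : ℝ) + 1) * f x ∧ ((k : ℝ) + 1) * f x < j + 1}) := by
      by_contra! hj
      refine not_thin_iff.2 ⟨B i, fun x hx => ?_, hBo i, hBne i⟩
        (thin_iUnion (L := L) (fun j => by simp only [mem_inter_iff, mem_ofPred_eq]; exact .auto) hj)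
      exact mem_iUnion.2 ⟨⌊((k : ℝ) + 1) * f x⌋, hx, Int.floor_le _, Int.lt_floor_add_one _⟩
    obtain ⟨j, hj⟩ := this
    obtain ⟨V, hV, hVo, x, hx⟩ := not_thin_iff.1 hj
    obtain ⟨δ, hδ, hball⟩ := Metric.isOpen_iff.1 hVo x hx
    obtain ⟨y, hy, hxy⟩ := hUD (hi (hV hx).1) δ hδ
    have h1 := (hV hx).2
    have h2 := (hV (hball (by rwa [Metric.mem_ball, dist_eq_norm]) : y ∈ V)).2
    simp only [mem_ofPred_eq] at h1 h2
    have hk : (0 : ℝ) < k + 1 := by positivity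
    rw [div_le_iff₀' hk] at hxy
    have : |((k : ℝ) + 1) * f y - ((k : ℝ) + 1) * f x| < 1 := abs_lt.2 ⟨by linarith, by linarith⟩
    rw [← mul_sub, abs_mul, abs_of_pos hk] at this
    linarith
  refine hD.mono fun x hx => ?_
  simp only [mem_ofPred_eq, Metric.continuousAt_iff, dist_eq_norm, Real.norm_eq_abs] at hx
  push Not at hx
  obtain ⟨ε, hε, h⟩ := hx
  obtain ⟨k, hk⟩ := exists_nat_one_div_lt hε
  refine mem_iUnion.2 ⟨k, fun δ hδ => ?_⟩
  obtain ⟨y, hy, hxy⟩ := h δ hδ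
  exact ⟨y, hy, hk.le.trans hxy⟩

/-- A definable function is continuous on a subinterval of any interval. -/
theorem exists_continuousOn_Ioo {f : ℝ → ℝ} (hf : Dmap L f) {a b : ℝ} (hab : a < b) :
    ∃ c d, a ≤ c ∧ c < d ∧ d ≤ b ∧ ∀ x ∈ Ioo c d, ContinuousAt f x := by
  have hg : Dmap L fun x : Fin 1 → ℝ => f (x 0) := by fun_prop
  have hU : IsOpen {x : Fin 1 → ℝ | x 0 ∈ Ioo a b} := isOpen_Ioo.preimage (continuous_apply 0)
  obtain ⟨t, ht⟩ := exists_between hab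
  obtain ⟨V, hVU, hV, ⟨x, hx⟩, hVc⟩ := (thin_not_continuousAt hg).exists_open
    (.continuousAt (F := fun _ : Fin 1 → ℝ => fun x => f (x 0)) (a := fun x => x) .auto .auto)
    hU ⟨fun _ => t, ht⟩
  have hW : IsOpen ((fun (t : ℝ) (_ : Fin 1) => t) ⁻¹' V) := hV.preimage (by fun_prop)
  have hxV : x 0 ∈ (fun (t : ℝ) (_ : Fin 1) => t) ⁻¹' V := by
    have : (fun _ : Fin 1 => x 0) = x := by ext i; rw [Subsingleton.elim i 0]
    simpa [this]
  obtain ⟨c, d, hcd, hcdV⟩ := mem_nhds_iff_exists_Ioo_subset.1 (hW.mem_nhds hxV)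
  have hx0 := hVU hx
  refine ⟨max a c, min b d, le_max_left _ _, ?_, min_le_left _ _, fun y hy => ?_⟩
  · exact (max_lt hx0.1 hcd.1).trans (lt_min hx0.2 hcd.2)
  · have hyV := hcdV (show y ∈ Ioo c d from ⟨(le_max_right _ _).trans_lt hy.1,
      hy.2.trans_le (min_le_right _ _)⟩)
    have := ContinuousAt.comp (g := fun x : Fin 1 → ℝ => f (x 0))
      (f := fun (t : ℝ) (_ : Fin 1) => t) (x := y) (hVc _ hyV) (by fun_prop)
    exact this

theorem exists_differentiableAt_of_isLocalMax {f : ℝ → ℝ} (hf : Dmap L f) {a b : ℝ} (hab : a < b)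
    (h : ∀ x ∈ Ioo a b, IsLocalMax f x) : ∃ x ∈ Ioo a b, DifferentiableAt ℝ f x := by
  have : ∃ k : ℕ, ¬ Thin {x | x ∈ Ioo a b ∧ ∀ y, |y - x| < 1 / ((k : ℝ) + 1) → f y ≤ f x} := by
    by_contra! hk
    refine not_thin_iff.2 ⟨Ioo a b, fun x hx => ?_, isOpen_Ioo, nonempty_Ioo.2 hab⟩
      (thin_real_iUnion (L := L) (fun k => by simp only [mem_Ioo, mem_ofPred_eq]; exact .auto) hk)
    obtain ⟨ε, hε, h1⟩ := Metric.eventually_nhds_iff.1 (h x hx)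
    obtain ⟨k, hk⟩ := exists_nat_one_div_lt hε
    exact mem_iUnion.2 ⟨k, hx, fun y hy => h1 (hy.trans hk)⟩
  obtain ⟨k, hk⟩ := this
  obtain ⟨U, hU, hUo, x, hx⟩ := not_thin_iff.1 hk
  refine ⟨x, (hU hx).1, ?_⟩
  have hc : f =ᶠ[𝓝 x] fun _ => f x := by
    have h0 : (0 : ℝ) < 1 / ((k : ℝ) + 1) := by positivity
    filter_upwards [hUo.mem_nhds hx, Metric.ball_mem_nhds x h0] with y hy hyx
    rw [Metric.mem_ball, Real.dist_eq] at hyx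
    exact le_antisymm ((hU hx).2 y hyx) ((hU hy).2 x (by rwa [abs_sub_comm]))
  exact (differentiableAt_const (f x)).congr_of_eventuallyEq hc

theorem exists_differentiableAt {f : ℝ → ℝ} (hf : Dmap L f) {a b : ℝ} (hab : a < b) :
    ∃ x ∈ Ioo a b, DifferentiableAt ℝ f x := by
  obtain ⟨c, d, hac, hcd, hdb, hcont⟩ := exists_continuousOn_Ioo hf hab
  by_contra! hnd
  have hmax : ∀ g : ℝ → ℝ, Dmap L g → (∀ x ∈ Ioo a b, ¬ DifferentiableAt ℝ g x) →
      Thin {x | x ∈ Ioo c d ∧ IsLocalMax g x} := by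
    intro g hg hgd
    by_contra ht
    obtain ⟨x, hx⟩ := not_thin_iff_nhds.1 ht
    obtain ⟨p, q, hpq, hpqs⟩ := mem_nhds_iff_exists_Ioo_subset.1 hx
    obtain ⟨y, hy, hyd⟩ := exists_differentiableAt_of_isLocalMax hg (hpq.1.trans hpq.2)
      fun y hy => (hpqs hy).2
    have := (hpqs hy).1
    exact hgd y ⟨hac.trans_lt this.1, this.2.trans_le hdb⟩ hyd
  have hfin : {x | x ∈ Ioo c d ∧ IsLocalExtr f x}.Finite := by
    have hd : ∀ g : ℝ → ℝ, Dmap L g → Dmap L fun x => x ∈ Ioo c d ∧ IsLocalMax g x := by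
      intro g hg
      simp only [mem_Ioo, IsLocalMax, IsMaxFilter]
      refine .and .auto (Dmap.eventually_nhds_real (P := fun x y => g y ≤ g x) .auto .auto)
    refine ((finite_of_interior_eq_empty (hd _ hf) (hmax _ hf hnd)).union
      (finite_of_interior_eq_empty (hd _ hf.neg) (hmax _ hf.neg fun x hx h => hnd x hx ?_))).subset ?_
    · simpa using h.neg
    · rintro x ⟨hx, h | h⟩
      · exact Or.inr ⟨hx, h.neg⟩
      · exact Or.inl ⟨hx, h⟩
  have hdense : (Ioo c d \ {x | x ∈ Ioo c d ∧ IsLocalExtr f x}).Nonempty := by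
    by_contra he
    rw [not_nonempty_iff_eq_empty, sdiff_eq_empty] at he
    exact (Ioo_infinite hcd) (hfin.subset he)
  obtain ⟨x, hx, hx'⟩ := hdense
  have hnhds : Ioo c d ∩ {x | x ∈ Ioo c d ∧ IsLocalExtr f x}ᶜ ∈ 𝓝 x :=
    Filter.inter_mem (Ioo_mem_nhds hx.1 hx.2) (hfin.isClosed.isOpen_compl.mem_nhds hx')
  obtain ⟨p, q, hpq, hpqs⟩ := mem_nhds_iff_exists_Ioo_subset.1 hnhds
  obtain ⟨q', hq', hqq'⟩ := exists_between hpq.2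
  have hxq : Icc x q' ⊆ Ioo p q := fun y hy => ⟨hpq.1.trans_le hy.1, hy.2.trans_lt hqq'⟩
  have hcon : ContinuousOn f (Icc x q') := fun y hy =>
    (hcont y (hpqs (hxq hy)).1).continuousWithinAt
  have hinj : InjOn f (Icc x q') := by
    intro y hy z hz hyz
    by_contra hne
    wlog hlt : y < z generalizing y z
    · exact this hz hy hyz.symm (Ne.symm hne) (lt_of_le_of_ne (not_lt.1 hlt) (Ne.symm hne))
    obtain ⟨w, hw, hext⟩ := exists_isLocalExtr_Ioo hlt
      (hcon.mono (Icc_subset_Icc hy.1 hz.2)) hyz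
    have hw' : w ∈ Ioo p q := hxq ⟨hy.1.trans hw.1.le, hw.2.le.trans hz.2⟩
    exact (hpqs hw').2 ⟨(hpqs hw').1, hext⟩
  have hae : ∃ y ∈ Ioo x q', DifferentiableAt ℝ f y := by
    have key : ∀ g : ℝ → ℝ, MonotoneOn g (Icc x q') → ∃ y ∈ Ioo x q', DifferentiableAt ℝ g y := by
      intro g hg
      have h1 := (hg.mono Ioo_subset_Icc_self).ae_differentiableWithinAt measurableSet_Ioo
      have : (MeasureTheory.ae (MeasureTheory.volume.restrict (Ioo x q'))).NeBot := by
        rw [MeasureTheory.ae_restrict_neBot]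
        simp [hq']
      obtain ⟨y, hy, hy'⟩ := (h1.and (MeasureTheory.ae_restrict_mem measurableSet_Ioo)).exists
      exact ⟨y, hy', hy.differentiableAt (Ioo_mem_nhds hy'.1 hy'.2)⟩
    rcases hcon.strictMonoOn_of_injOn_Icc' hq'.le hinj with h | h
    · exact key f h.monotoneOn
    · obtain ⟨y, hy, hd⟩ := key (fun y => - f y) fun y hy z hz hyz => neg_le_neg (h.antitoneOn hy hz hyz)
      exact ⟨y, hy, by simpa using hd.neg⟩
  obtain ⟨y, hy, hd⟩ := hae
  have := (hpqs (hxq (Ioo_subset_Icc_self hy))).1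
  exact hnd y ⟨hac.trans_lt this.1, this.2.trans_le hdb⟩ hd

end Generic

section Smooth

/-- A function whose partial derivatives exist nearby and are continuous at the point is
differentiable there. -/
theorem hasFDerivAt_of_partial {n : ℕ} {f : (Fin n → ℝ) → ℝ} {g : Fin n → (Fin n → ℝ) → ℝ}
    {x : Fin n → ℝ}
    (h : ∀ i, ∀ᶠ y in 𝓝 x, HasDerivAt (fun t => f (Function.update y i t)) (g i y) (y i))
    (hg : ∀ i, ContinuousAt (g i) x) :
    HasFDerivAt f (∑ i, g i x • (ContinuousLinearMap.proj i : (Fin n → ℝ) →L[ℝ] ℝ)) x := by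
  classical
  rw [hasFDerivAt_iff_isLittleO, Asymptotics.isLittleO_iff]
  intro ε hε
  set ε' := ε / (n + 1) with hε'
  have hε'0 : 0 < ε' := by positivity
  have h1 : ∀ᶠ y in 𝓝 x, ∀ i, HasDerivAt (fun t => f (Function.update y i t)) (g i y) (y i) ∧
      |g i y - g i x| < ε' := by
    refine Filter.eventually_all.2 fun i => (h i).and ?_
    have := Metric.continuousAt_iff'.1 (hg i) ε' hε'0
    simpa only [Real.dist_eq] using this
  obtain ⟨δ, hδ, hball⟩ := Metric.eventually_nhds_iff_ball.1 h1
  filter_upwards [Metric.ball_mem_nhds x hδ] with y hy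
  have hyi : ∀ i, dist (y i) (x i) < δ := fun i => (dist_le_pi_dist y x i).trans_lt hy
  let w : ℕ → Fin n → ℝ := fun k i => if (i : ℕ) < k then y i else x i
  have hw0 : w 0 = x := by ext i; simp [w]
  have hwn : w n = y := by ext i; simp [w]
  have hwx : ∀ (k : Fin n), Function.update (w k) k (x k) = w k := fun k => by
    ext i; by_cases hik : i = k
    · subst hik; simp [w]
    · simp [Function.update_of_ne hik]
  have hwy : ∀ (k : Fin n), Function.update (w k) k (y k) = w (k + 1) := fun k => by
    ext i; by_cases hik : i = k
    · subst hik; simp [w]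
    · have : (i : ℕ) ≠ k := fun e => hik (Fin.ext e)
      simp only [Function.update_of_ne hik, w]
      split_ifs <;> first | rfl | omega
  have hmem : ∀ (k : Fin n), ∀ t ∈ Metric.ball (x k) δ,
      Function.update (w k) k t ∈ Metric.ball x δ := by
    intro k t ht
    rw [Metric.mem_ball, dist_pi_lt_iff hδ]
    intro i; by_cases hik : i = k
    · subst hik; simpa using ht
    · simp only [Function.update_of_ne hik, w]
      split_ifs
      · exact hyi i
      · simpa using hδ
  have hstep : ∀ k : Fin n, |f (w (k + 1)) - f (w k) - g k x * (y k - x k)| ≤ ε' * ‖y - x‖ := by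
    intro k
    have hd : ∀ t ∈ Metric.ball (x k) δ, HasDerivWithinAt
        (fun t => f (Function.update (w k) k t) - g k x * t)
        (g k (Function.update (w k) k t) - g k x) (Metric.ball (x k) δ) t := by
      intro t ht
      have := (hball _ (hmem k t ht) k).1
      simp only [Function.update_idem, Function.update_self] at this
      exact (this.sub (by simpa using (hasDerivAt_id t).const_mul (g k x))).hasDerivWithinAt
    have := (convex_ball (x k) δ).norm_image_sub_le_of_norm_hasDerivWithin_le hd
      (fun t ht => (hball _ (hmem k t ht) k).2.le) (Metric.mem_ball_self hδ) (hyi k)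
    rw [hwx, hwy] at this
    calc |f (w (k + 1)) - f (w k) - g k x * (y k - x k)|
        = ‖f (w (k + 1)) - g k x * y k - (f (w k) - g k x * x k)‖ := by
          rw [Real.norm_eq_abs]; congr 1; ring
      _ ≤ ε' * ‖y k - x k‖ := this
      _ ≤ _ := mul_le_mul_of_nonneg_left (norm_le_pi_norm (y - x) k) hε'0.le
  have hsum : f y - f x = ∑ k : Fin n, (f (w (k + 1)) - f (w k)) := by
    have := Finset.sum_range_sub (fun k => f (w k)) n
    rw [Finset.sum_range, hwn, hw0] at this
    exact this.symm
  have hlin : (∑ i, g i x • (ContinuousLinearMap.proj i : (Fin n → ℝ) →L[ℝ] ℝ)) (y - x) =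
      ∑ k, g k x * (y k - x k) := by simp
  rw [hsum, hlin, ← Finset.sum_sub_distrib]
  calc ‖∑ k : Fin n, (f (w (k + 1)) - f (w k) - g k x * (y k - x k))‖
      ≤ ∑ k : Fin n, ε' * ‖y - x‖ := norm_sum_le_of_le _ fun k _ => hstep k
    _ = (n : ℝ) * ε' * ‖y - x‖ := by simp [mul_assoc]
    _ ≤ ε * ‖y - x‖ := by
      refine mul_le_mul_of_nonneg_right ?_ (norm_nonneg _)
      rw [hε', mul_div_assoc', div_le_iff₀ (by positivity)]
      nlinarith

/-- The `i`-th partial derivative. -/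
noncomputable def pd {n : ℕ} (f : (Fin n → ℝ) → ℝ) (i : Fin n) (x : Fin n → ℝ) : ℝ :=
  fderiv ℝ f x (Pi.single i 1)

theorem clm_eq_sum {n : ℕ} (A : (Fin n → ℝ) →L[ℝ] ℝ) :
    A = ∑ i, A (Pi.single i 1) • (ContinuousLinearMap.proj i : (Fin n → ℝ) →L[ℝ] ℝ) := by
  ext x
  conv_lhs => rw [pi_eq_sum_univ' x]
  simp [mul_comm]

theorem contDiffAt_succ_iff_pd {n : ℕ} {f : (Fin n → ℝ) → ℝ} {x : Fin n → ℝ} {r : ℕ} :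
    ContDiffAt ℝ (r + 1 : ℕ) f x ↔
      (∀ᶠ y in 𝓝 x, DifferentiableAt ℝ f y) ∧ ∀ i, ContDiffAt ℝ r (pd f i) x := by
  rw [Nat.cast_succ, contDiffAt_succ_iff_hasFDerivAt]
  constructor
  · rintro ⟨f', ⟨u, hu, hf⟩, h⟩
    refine ⟨Filter.mem_of_superset hu fun y hy => (hf y hy).differentiableAt, fun i => ?_⟩
    have h1 : ContDiffAt ℝ r (fun y => f' y (Pi.single i 1)) x := h.clm_apply contDiffAt_const
    refine h1.congr_of_eventuallyEq ?_
    filter_upwards [hu] with y hy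
    rw [pd, (hf y hy).fderiv]
  · rintro ⟨h, hi⟩
    refine ⟨fderiv ℝ f, ⟨_, h, fun y hy => hy.hasFDerivAt⟩, ?_⟩
    have : fderiv ℝ f = fun y => ∑ i, pd f i y •
        (ContinuousLinearMap.proj i : (Fin n → ℝ) →L[ℝ] ℝ) := funext fun y => clm_eq_sum _
    rw [this]
    exact ContDiffAt.sum fun i _ => (hi i).smul contDiffAt_const

variable {L : FirstOrder.Language} [L.Structure ℝ] [OM L] {X : Type} [Dt L X]

theorem hasFDerivAt_sum_iff {n : ℕ} {f : (Fin n → ℝ) → ℝ} {x c : Fin n → ℝ} :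
    HasFDerivAt f (∑ i, c i • (ContinuousLinearMap.proj i : (Fin n → ℝ) →L[ℝ] ℝ)) x ↔
      ∀ ε : ℝ, 0 < ε → ∃ δ : ℝ, 0 < δ ∧ ∀ y : Fin n → ℝ, ‖y - x‖ < δ →
        |f y - f x - ∑ i, c i * (y i - x i)| ≤ ε * ‖y - x‖ := by
  rw [hasFDerivAt_iff_isLittleO, Asymptotics.isLittleO_iff]
  simp only [Metric.eventually_nhds_iff, dist_eq_norm, Real.norm_eq_abs]
  simp

theorem Dmap.hasFDerivAt {n : ℕ} {F : X → (Fin n → ℝ) → ℝ} {a c : X → Fin n → ℝ}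
    (hF : Dmap L fun p : X × (Fin n → ℝ) => F p.1 p.2) (ha : Dmap L a) (hc : Dmap L c) :
    Dmap L fun x => HasFDerivAt (F x)
      (∑ i, c x i • (ContinuousLinearMap.proj i : (Fin n → ℝ) →L[ℝ] ℝ)) (a x) := by
  simp only [hasFDerivAt_sum_iff]
  exact .auto

theorem differentiableAt_iff_exists_coeff {n : ℕ} {f : (Fin n → ℝ) → ℝ} {x : Fin n → ℝ} :
    DifferentiableAt ℝ f x ↔ ∃ c : Fin n → ℝ,
      HasFDerivAt f (∑ i, c i • (ContinuousLinearMap.proj i : (Fin n → ℝ) →L[ℝ] ℝ)) x :=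
  ⟨fun h => ⟨_, by rw [← clm_eq_sum]; exact h.hasFDerivAt⟩, fun ⟨_, h⟩ => h.differentiableAt⟩

theorem Dmap.differentiableAt {n : ℕ} {F : X → (Fin n → ℝ) → ℝ} {a : X → Fin n → ℝ}
    (hF : Dmap L fun p : X × (Fin n → ℝ) => F p.1 p.2) (ha : Dmap L a) :
    Dmap L fun x => DifferentiableAt ℝ (F x) (a x) := by
  simp only [differentiableAt_iff_exists_coeff]
  refine Dmap.ex (P := fun x (c : Fin n → ℝ) => HasFDerivAt (F x)
      (∑ i, c i • (ContinuousLinearMap.proj i : (Fin n → ℝ) →L[ℝ] ℝ)) (a x)) ?_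
  exact .hasFDerivAt (F := fun p : X × (Fin n → ℝ) => F p.1) (a := fun p => a p.1)
    (c := fun p => p.2) (by fun_prop) (by fun_prop) (by fun_prop)

theorem Dmap.pd {n : ℕ} {F : X → (Fin n → ℝ) → ℝ} {a : X → Fin n → ℝ} (i : Fin n)
    (hF : Dmap L fun p : X × (Fin n → ℝ) => F p.1 p.2) (ha : Dmap L a) :
    Dmap L fun x => pd (F x) i (a x) := by
  have h0 := Dmap.hasFDerivAt (F := fun p : X × (Fin n → ℝ) => F p.1) (a := fun p => a p.1)
    (c := fun p => p.2) (L := L) (by fun_prop) (by fun_prop) (by fun_prop)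
  have h1 := Dmap.differentiableAt hF ha
  refine .of_graph' (P := fun x y => (∃ c : Fin n → ℝ, HasFDerivAt (F x)
      (∑ i, c i • (ContinuousLinearMap.proj i : (Fin n → ℝ) →L[ℝ] ℝ)) (a x) ∧ y = c i) ∨
      (¬ DifferentiableAt ℝ (F x) (a x) ∧ y = 0)) ?_ fun x y => ?_
  · refine .or (.ex (.and ?_ .auto)) (.and (Dmap.comp (f := Prod.fst) h1 .auto).not .auto)
    exact Dmap.comp (f := fun q : (X × ℝ) × (Fin n → ℝ) => (q.1.1, q.2)) h0 .auto
  · constructor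
    · rintro rfl
      by_cases h : DifferentiableAt ℝ (F x) (a x)
      · refine Or.inl ⟨fun i => fderiv ℝ (F x) (a x) (Pi.single i 1), ?_, rfl⟩
        rw [← clm_eq_sum]; exact h.hasFDerivAt
      · exact Or.inr ⟨h, by simp [Paper.pd, fderiv_zero_of_not_differentiableAt h]⟩
    · rintro (⟨c, hc, rfl⟩ | ⟨h, rfl⟩)
      · rw [Paper.pd, hc.fderiv]
        simp [Pi.single_apply]
      · simp [Paper.pd, fderiv_zero_of_not_differentiableAt h]

theorem Dmap.contDiffAt_real {n : ℕ} (r : ℕ) {F : X → (Fin n → ℝ) → ℝ} {a : X → Fin n → ℝ}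
    (hF : Dmap L fun p : X × (Fin n → ℝ) => F p.1 p.2) (ha : Dmap L a) :
    Dmap L fun x => ContDiffAt ℝ r (F x) (a x) := by
  induction r generalizing F with
  | zero =>
    have : ∀ x, ContDiffAt ℝ (0 : ℕ) (F x) (a x) ↔ ∀ᶠ y in 𝓝 (a x), ContinuousAt (F x) y := by
      intro x
      rw [Nat.cast_zero, contDiffAt_zero]
      constructor
      · rintro ⟨u, hu, h⟩
        filter_upwards [eventually_mem_nhds_iff.2 hu] with y hy using h.continuousAt hy
      · exact fun h => ⟨_, h, fun y hy => ContinuousAt.continuousWithinAt hy⟩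
    simp only [this]
    refine Dmap.eventually_nhds (P := fun x y => ContinuousAt (F x) y) ?_ ha
    exact Dmap.continuousAt (F := fun p : X × (Fin n → ℝ) => F p.1) (a := fun p => p.2) .auto .auto
  | succ r ih =>
    simp only [contDiffAt_succ_iff_pd]
    refine .and (Dmap.eventually_nhds (P := fun x y => DifferentiableAt ℝ (F x) y) ?_ ha)
      (.all_fin fun i => ih ?_)
    · exact Dmap.differentiableAt (F := fun p : X × (Fin n → ℝ) => F p.1) (a := fun p => p.2)
        .auto .auto
    · exact Dmap.pd i (F := fun p : X × (Fin n → ℝ) => F p.1) (a := fun p => p.2) .auto .auto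

theorem Dmap.contDiffAt {n m : ℕ} (r : ℕ) {F : X → (Fin n → ℝ) → (Fin m → ℝ)}
    {a : X → Fin n → ℝ}
    (hF : Dmap L fun p : X × (Fin n → ℝ) => F p.1 p.2) (ha : Dmap L a) :
    Dmap L fun x => ContDiffAt ℝ r (F x) (a x) := by
  simp only [contDiffAt_pi]
  exact .all_fin fun i => .contDiffAt_real r (F := fun x y => F x y i) .auto ha

theorem hasDerivAt_iff_eps {f : ℝ → ℝ} {x c : ℝ} : HasDerivAt f c x ↔
    ∀ ε : ℝ, 0 < ε → ∃ δ : ℝ, 0 < δ ∧ ∀ y : ℝ, |y - x| < δ →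
      |f y - f x - (y - x) * c| ≤ ε * |y - x| := by
  rw [hasDerivAt_iff_isLittleO, Asymptotics.isLittleO_iff]
  simp only [Metric.eventually_nhds_iff, dist_eq_norm, Real.norm_eq_abs, smul_eq_mul]

theorem Dmap.hasDerivAt {F : X → ℝ → ℝ} {a c : X → ℝ}
    (hF : Dmap L fun p : X × ℝ => F p.1 p.2) (ha : Dmap L a) (hc : Dmap L c) :
    Dmap L fun x => HasDerivAt (F x) (c x) (a x) := by
  simp only [hasDerivAt_iff_eps]
  exact .auto

theorem Dmap.deriv {F : X → ℝ → ℝ} {a : X → ℝ}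
    (hF : Dmap L fun p : X × ℝ => F p.1 p.2) (ha : Dmap L a) :
    Dmap L fun x => deriv (F x) (a x) := by
  have h0 := Dmap.hasDerivAt (F := fun p : X × ℝ => F p.1) (a := fun p => a p.1)
    (c := fun p => p.2) (L := L) (by fun_prop) (by fun_prop) (by fun_prop)
  refine .of_graph' (P := fun x y => HasDerivAt (F x) y (a x) ∨
      (¬ (∃ y : ℝ, HasDerivAt (F x) y (a x)) ∧ y = 0)) ?_ fun x y => ?_
  · refine .or h0 (.and (.not (.ex ?_)) .auto)
    exact Dmap.comp (f := fun q : (X × ℝ) × ℝ => (q.1.1, q.2)) h0 .auto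
  · by_cases h : DifferentiableAt ℝ (F x) (a x)
    · have h2 : ∃ y, HasDerivAt (F x) y (a x) := ⟨_, h.hasDerivAt⟩
      simp only [h2, not_true, false_and, or_false]
      exact ⟨fun e => e ▸ h.hasDerivAt, fun e => e.deriv⟩
    · have h2 : ¬ ∃ y, HasDerivAt (F x) y (a x) := fun ⟨y, hy⟩ => h hy.differentiableAt
      simp only [not_exists.1 h2 y, h2, not_false_eq_true, true_and, false_or,
        deriv_zero_of_not_differentiableAt h, eq_comm]

theorem Dmap.update {n : ℕ} {a : X → Fin n → ℝ} {t : X → ℝ} (ha : Dmap L a) (i : Fin n)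
    (ht : Dmap L t) : Dmap L fun x => Function.update (a x) i (t x) := by
  refine .pi fun j => ?_
  by_cases h : j = i
  · subst h; simpa using ht
  · simp only [Function.update_of_ne h]; fun_prop

theorem thin_not_differentiableAt_update {n : ℕ} {f : (Fin n → ℝ) → ℝ} (hf : Dmap L f)
    (i : Fin n) : Thin {x | ¬ HasDerivAt (fun t => f (Function.update x i t))
      (deriv (fun t => f (Function.update x i t)) (x i)) (x i)} := by
  by_contra hc
  obtain ⟨x, hx⟩ := not_thin_iff_nhds.1 hc
  obtain ⟨δ, hδ, hb⟩ := Metric.eventually_nhds_iff_ball.1 hx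
  have hg : Dmap L fun t : ℝ => f (Function.update x i t) :=
    Dmap.comp hf (Dmap.update .auto i .auto)
  obtain ⟨t, ht, htd⟩ := exists_differentiableAt hg (show x i - δ < x i + δ by linarith)
  have hmem : Function.update x i t ∈ Metric.ball x δ := by
    rw [Metric.mem_ball, dist_pi_lt_iff hδ]
    intro j; by_cases hji : j = i
    · subst hji
      rw [Function.update_self, Real.dist_eq, abs_lt]
      constructor <;> linarith [ht.1, ht.2]
    · simpa [Function.update_of_ne hji] using hδ
  refine hb _ hmem ?_
  simpa only [Function.update_idem, Function.update_self] using htd.hasDerivAt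

theorem thin_not_differentiableAt {n : ℕ} {f : (Fin n → ℝ) → ℝ} (hf : Dmap L f) :
    Thin {x | ¬ DifferentiableAt ℝ f x} := by
  let g : Fin n → (Fin n → ℝ) → ℝ := fun i x => deriv (fun t => f (Function.update x i t)) (x i)
  have hF : ∀ i, Dmap L fun p : (Fin n → ℝ) × ℝ => f (Function.update p.1 i p.2) := fun i =>
    Dmap.comp hf (Dmap.update .auto i .auto)
  have hg : ∀ i, Dmap L (g i) := fun i =>
    .deriv (F := fun x t => f (Function.update x i t)) (hF i) .auto
  have hd : ∀ i, Dmap L fun x : Fin n → ℝ =>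
      HasDerivAt (fun t => f (Function.update x i t)) (g i x) (x i) := fun i =>
    .hasDerivAt (F := fun x t => f (Function.update x i t)) (hF i) .auto (hg i)
  have h1 : Thin {x | ¬ ((∀ i, ∀ᶠ y in 𝓝 x,
      HasDerivAt (fun t => f (Function.update y i t)) (g i y) (y i)) ∧
      ∀ i, ContinuousAt (g i) x)} := by
    refine thin_and (L := L) (.all_fin fun i => ?_) (.all_fin fun i => ?_)
      (thin_forall_fin (L := L) (fun i => ?_) fun i => ?_) (thin_forall_fin (L := L) (fun i => ?_) fun i => ?_)
    · exact Dmap.eventually_nhds (P := fun _ y =>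
        HasDerivAt (fun t => f (Function.update y i t)) (g i y) (y i)) ((hd i).comp .auto) .auto
    · exact Dmap.continuousAt (F := fun _ => g i) (by have := hg i; fun_prop) .auto
    · exact Dmap.eventually_nhds (P := fun _ y =>
        HasDerivAt (fun t => f (Function.update y i t)) (g i y) (y i)) ((hd i).comp .auto) .auto
    · exact Thin.not_eventually (hd i) (thin_not_differentiableAt_update hf i)
    · exact Dmap.continuousAt (F := fun _ => g i) (by have := hg i; fun_prop) .auto
    · exact thin_not_continuousAt (hg i)
  refine h1.mono fun x hx h => hx (hasFDerivAt_of_partial h.1 h.2).differentiableAt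

/-- A definable function is `C^r` off a set with empty interior. -/
theorem thin_not_contDiffAt_real {n : ℕ} (r : ℕ) {f : (Fin n → ℝ) → ℝ} (hf : Dmap L f) :
    Thin {x | ¬ ContDiffAt ℝ r f x} := by
  induction r generalizing f with
  | zero =>
    refine (Thin.not_eventually (.continuousAt (F := fun _ => f) .auto .auto)
      (thin_not_continuousAt hf)).mono fun x hx h => hx ?_
    rw [Nat.cast_zero]
    exact contDiffAt_zero.2 ⟨_, h, fun y hy => ContinuousAt.continuousWithinAt hy⟩
  | succ r ih =>
    have hp : ∀ i, Dmap L (pd f i) := fun i => .pd i (F := fun _ => f) (a := fun x => x) .auto .auto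
    have hd : Dmap L (fun y => DifferentiableAt ℝ f y) :=
      Dmap.differentiableAt (F := fun _ => f) (a := fun x => x) .auto .auto
    refine (thin_and (L := L) (.eventually_nhds (P := fun _ y => DifferentiableAt ℝ f y) .auto .auto)
      (.all_fin fun i => ?_) (Thin.not_eventually hd (thin_not_differentiableAt hf))
      (thin_forall_fin (L := L) (P := fun i x => ContDiffAt ℝ r (pd f i) x)
        (fun i => ?_) fun i => ih (hp i))).mono fun x hx h => hx (contDiffAt_succ_iff_pd.2 h)
    · exact .contDiffAt_real r (F := fun _ => pd f i) (by have := hp i; fun_prop) .auto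
    · exact .contDiffAt_real r (F := fun _ => pd f i) (by have := hp i; fun_prop) .auto

theorem thin_not_contDiffAt {n m : ℕ} (r : ℕ) {f : (Fin n → ℝ) → (Fin m → ℝ)} (hf : Dmap L f) :
    Thin {x | ¬ ContDiffAt ℝ r f x} := by
  simp only [contDiffAt_pi]
  exact thin_forall_fin (L := L) (fun i => .contDiffAt_real r (F := fun _ x => f x i) .auto .auto)
    fun i => thin_not_contDiffAt_real r (by fun_prop)

end Smooth

section UniformFiniteness

variable {L : FirstOrder.Language} [L.Structure ℝ] [OM L] {X : Type} [Dt L X]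

theorem le_ncard_iff {S : Set ℝ} (hS : S.Finite) (k : ℕ) :
    k ≤ S.ncard ↔ ∃ v : Fin k → ℝ, (∀ i j, v i = v j → i = j) ∧ ∀ i, v i ∈ S := by
  constructor
  · intro h
    obtain ⟨T, hT, hc⟩ := exists_subset_card_eq h
    have hTf : T.Finite := hS.subset hT
    have : Nat.card T = k := hc
    have := hTf.to_subtype
    let e := (Finite.equivFinOfCardEq ‹Nat.card T = k›).symm
    exact ⟨fun i => e i, fun i j h => e.injective (Subtype.ext h), fun i => hT (e i).2⟩
  · rintro ⟨v, hv, hS'⟩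
    have h1 : (range v).ncard = k := by
      rw [← image_univ, ncard_image_of_injective _ fun i j => hv i j]
      simp
    rw [← h1]
    exact ncard_le_ncard (range_subset_iff.2 hS') hS

theorem Dmap.le_ncard {A : X → Set ℝ} (hA : Dmap L fun p : X × ℝ => p.2 ∈ A p.1)
    (hfin : ∀ x, (A x).Finite) (k : ℕ) : Dmap L fun x => k ≤ (A x).ncard := by
  simp only [fun x => le_ncard_iff (hfin x) k]
  have : ∀ i : Fin k, Dmap L fun p : X × (Fin k → ℝ) => p.2 i ∈ A p.1 := fun i =>
    Dmap.comp (f := fun p : X × (Fin k → ℝ) => (p.1, p.2 i)) hA .auto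
  exact .auto

theorem Dmap.csInf {A : X → Set ℝ} (hA : Dmap L fun p : X × ℝ => p.2 ∈ A p.1)
    (hfin : ∀ x, (A x).Finite) : Dmap L fun x => sInf (A x) := by
  refine .of_graph' (P := fun x y => (y ∈ A x ∧ ∀ z : ℝ, z ∈ A x → y ≤ z) ∨
    ((∀ z : ℝ, ¬ z ∈ A x) ∧ y = 0)) ?_ fun x y => ?_
  · have : Dmap L fun p : (X × ℝ) × ℝ => p.2 ∈ A p.1.1 :=
      Dmap.comp (f := fun p : (X × ℝ) × ℝ => (p.1.1, p.2)) hA .auto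
    exact .auto
  · rcases (A x).eq_empty_or_nonempty with h | h
    · simp [h, eq_comm]
    · have h1 := h.csInf_mem (hfin x)
      have h2 : ∀ z ∈ A x, sInf (A x) ≤ z := fun z hz => csInf_le (hfin x).bddBelow hz
      constructor
      · rintro rfl; exact Or.inl ⟨h1, h2⟩
      · rintro (⟨h3, h4⟩ | ⟨h3, _⟩)
        · exact le_antisymm (h2 _ h3) (h4 _ h1)
        · exact absurd h1 (h3 _)

/-- Finite fibres of bounded cardinality are covered by finitely many definable functions. -/
theorem exists_enum {A : X → Set ℝ} (hA : Dmap L fun p : X × ℝ => p.2 ∈ A p.1)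
    (hfin : ∀ x, (A x).Finite) (K : ℕ) (hK : ∀ x, (A x).ncard ≤ K) :
    ∃ f : Fin K → X → ℝ, (∀ i, Dmap L (f i)) ∧ ∀ x, ∀ y ∈ A x, ∃ i, f i x = y := by
  induction K generalizing A with
  | zero =>
    refine ⟨fun i => i.elim0, fun i => i.elim0, fun x y hy => ?_⟩
    have := (ncard_eq_zero (hfin x)).1 (Nat.le_zero.1 (hK x))
    simp [this] at hy
  | succ K ih =>
    obtain ⟨m, hm, hmA⟩ : ∃ m : X → ℝ, Dmap L m ∧ ∀ x, sInf (A x) = m x :=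
      ⟨_, Dmap.csInf hA hfin, fun _ => rfl⟩
    obtain ⟨f, hf, hfA⟩ := ih (A := fun x => A x \ {m x})
      (by simp only [mem_sdiff, mem_singleton_iff]; exact .auto)
      (fun x => (hfin x).subset sdiff_subset) fun x => by
        rcases (A x).eq_empty_or_nonempty with h | h
        · simp [h]
        · have := ncard_sdiff_singleton_add_one (hmA x ▸ h.csInf_mem (hfin x)) (hfin x)
          have := hK x
          omega
    refine ⟨Fin.cons m f, fun i => ?_, fun x y hy => ?_⟩
    · refine Fin.cases ?_ (fun i => ?_) i
      · simpa using hm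
      · simpa using hf i
    · by_cases h : y = m x
      · exact ⟨0, by simp [h]⟩
      · obtain ⟨i, hi⟩ := hfA x y ⟨hy, h⟩
        exact ⟨i.succ, by simpa using hi⟩

/-- Near `x₀` the fibres of `A` move continuously without merging or splitting. -/
def Tame1 (A : ℝ → Set ℝ) (x₀ : ℝ) : Prop :=
  ∃ ε : ℝ, 0 < ε ∧ (∀ y : ℝ, y ∈ A x₀ → ∀ z : ℝ, z ∈ A x₀ → |y - z| < 2 * ε → y = z) ∧
    ∀ᶠ x in 𝓝 x₀, (∀ y : ℝ, y ∈ A x₀ → ∃ z : ℝ, z ∈ A x ∧ |z - y| < ε) ∧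
      (∀ y : ℝ, y ∈ A x₀ → ∀ z : ℝ, z ∈ A x → ∀ z' : ℝ, z' ∈ A x → |z - y| < ε → |z' - y| < ε →
        z = z') ∧
      ∀ z : ℝ, z ∈ A x → ∃ y : ℝ, y ∈ A x₀ ∧ |z - y| < ε

theorem Tame1.eventually_ncard {A : ℝ → Set ℝ} {x₀ : ℝ} (h : Tame1 A x₀) :
    ∀ᶠ x in 𝓝 x₀, (A x).ncard = (A x₀).ncard := by
  obtain ⟨ε, hε, hsep, hev⟩ := h
  filter_upwards [hev] with x ⟨h1, h2, h3⟩
  choose! g hg hgε using h3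
  refine ncard_congr (fun z _ => g z) hg (fun z z' hz hz' he => ?_) fun y hy => ?_
  · exact h2 (g z) (hg z hz) z hz z' hz' (hgε z hz) (by
      rw [show g z = g z' from he]; exact hgε z' hz')
  · obtain ⟨z, hz, hzy⟩ := h1 y hy
    refine ⟨z, hz, hsep _ (hg z hz) _ hy ?_⟩
    have := hgε z hz
    rw [abs_lt] at *
    constructor <;> linarith

theorem Dmap.tame1 {A : X → ℝ → Set ℝ} (hA : Dmap L fun p : X × ℝ × ℝ => p.2.2 ∈ A p.1 p.2.1)
    {a : X → ℝ} (ha : Dmap L a) : Dmap L fun x => Tame1 (A x) (a x) := by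
  unfold Tame1
  have h0 : Dmap L fun p : ((X × ℝ) × ℝ) × ℝ => p.2 ∈ A p.1.1.1 p.1.2 :=
    Dmap.comp (f := fun p : ((X × ℝ) × ℝ) × ℝ => (p.1.1.1, p.1.2, p.2)) hA .auto
  have key : ∀ {Y : Type} [Dt L Y] {u : Y → X} {s t : Y → ℝ}, Dmap L u → Dmap L s → Dmap L t →
      Dmap L fun y => t y ∈ A (u y) (s y) := fun hu hs ht =>
    Dmap.comp (f := fun y => (_, _, _)) hA (hu.prodMk (hs.prodMk ht))
  refine .ex (.and .auto (.and (.all (.imp (key .auto .auto .auto) (.all (.imp (key .auto .auto .auto)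
    .auto)))) (Dmap.eventually_nhds_real (P := fun (p : X × ℝ) x => _) ?_ .auto)))
  refine .and (.all (.imp (key .auto .auto .auto) (.ex (.and (key .auto .auto .auto) .auto)))) (.and
    (.all (.imp (key .auto .auto .auto) (.all (.imp (key .auto .auto .auto) (.all (.imp
    (key .auto .auto .auto) .auto)))))) (.all (.imp (key .auto .auto .auto) (.ex
      (.and (key .auto .auto .auto) .auto)))))

theorem tame1_of_continuousAt {A : ℝ → Set ℝ} {x₀ : ℝ} {k : ℕ} {f : Fin k → ℝ → ℝ}
    (hf : ∀ i, ContinuousAt (f i) x₀) (hA : ∀ᶠ x in 𝓝 x₀, A x = range fun i => f i x)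
    (hinj : Function.Injective fun i => f i x₀) : Tame1 A x₀ := by
  obtain ⟨ε, hε, hsep⟩ : ∃ ε : ℝ, 0 < ε ∧ ∀ i j, |f i x₀ - f j x₀| < 2 * ε → i = j := by
    have : ∀ i j, ∃ ε : ℝ, 0 < ε ∧ (|f i x₀ - f j x₀| < 2 * ε → i = j) := fun i j => by
      by_cases h : i = j
      · exact ⟨1, one_pos, fun _ => h⟩
      · have : 0 < |f i x₀ - f j x₀| := abs_pos.2 (sub_ne_zero.2 fun e => h (hinj e))
        exact ⟨|f i x₀ - f j x₀| / 2, by positivity, fun h => by linarith⟩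
    choose ε hε h using this
    rcases isEmpty_or_nonempty (Fin k) with hk | hk
    · exact ⟨1, one_pos, fun i => hk.elim i⟩
    · obtain ⟨p, hp⟩ := Finite.exists_min fun p : Fin k × Fin k => ε p.1 p.2
      exact ⟨ε p.1 p.2, hε _ _, fun i j hij => h i j (hij.trans_le (by linarith [hp (i, j)]))⟩
  have hA0 := hA.self_of_nhds
  refine ⟨ε, hε, ?_, ?_⟩
  · rw [hA0]
    rintro _ ⟨i, rfl⟩ _ ⟨j, rfl⟩ h
    rw [hsep i j h]
  · have hclose : ∀ᶠ x in 𝓝 x₀, ∀ i, |f i x - f i x₀| < ε := Filter.eventually_all.2 fun i => by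
      simpa only [Real.dist_eq] using Metric.continuousAt_iff'.1 (hf i) ε hε
    filter_upwards [hA, hclose] with x hx hc
    have key : ∀ i j, |f j x - f i x₀| < ε → j = i := fun i j h => hsep j i (by
      have := hc j
      rw [abs_lt] at *
      constructor <;> linarith)
    rw [hA0, hx]
    refine ⟨?_, ?_, ?_⟩
    · rintro _ ⟨i, rfl⟩; exact ⟨_, ⟨i, rfl⟩, hc i⟩
    · rintro _ ⟨i, rfl⟩ _ ⟨j, rfl⟩ _ ⟨l, rfl⟩ h h'
      rw [key i j h, key i l h']
    · rintro _ ⟨i, rfl⟩; exact ⟨_, ⟨i, rfl⟩, hc i⟩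

theorem exists_continuousOn_Ioo_finite {k : ℕ} {f : Fin k → ℝ → ℝ} (hf : ∀ i, Dmap L (f i))
    {a b : ℝ} (hab : a < b) :
    ∃ c d, a ≤ c ∧ c < d ∧ d ≤ b ∧ ∀ i, ∀ x ∈ Ioo c d, ContinuousAt (f i) x := by
  induction k with
  | zero => exact ⟨a, b, le_rfl, hab, le_rfl, fun i => i.elim0⟩
  | succ k ih =>
    obtain ⟨c, d, hac, hcd, hdb, h⟩ := ih fun i => hf i.castSucc
    obtain ⟨c', d', hc, hcd', hd, h'⟩ := exists_continuousOn_Ioo (hf (Fin.last k)) hcd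
    refine ⟨c', d', hac.trans hc, hcd', hd.trans hdb, fun i => ?_⟩
    refine Fin.lastCases h' (fun i x hx => h i x ⟨hc.trans_lt hx.1, hx.2.trans_le hd⟩) i

theorem finite_not_tame1 {A : ℝ → Set ℝ} (hA : Dmap L fun p : ℝ × ℝ => p.2 ∈ A p.1)
    (hfin : ∀ x, (A x).Finite) : {x | ¬ Tame1 A x}.Finite := by
  refine finite_of_interior_eq_empty (L := L)
    (Dmap.not (Dmap.tame1 (A := fun _ : ℝ => A) (Dmap.comp (f := Prod.snd) hA .auto) .auto)) ?_
  by_contra hne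
  obtain ⟨U, hU, hUo, x₀, hx₀⟩ := not_thin_iff.1 hne
  obtain ⟨a, b, hab, habU⟩ := mem_nhds_iff_exists_Ioo_subset.1 (hUo.mem_nhds hx₀)
  have hab' := hab.1.trans hab.2
  obtain ⟨k, hk⟩ : ∃ k : ℕ, ¬ Thin {x | x ∈ Ioo a b ∧ (A x).ncard = k} := by
    by_contra! hk
    refine not_thin_iff.2 ⟨Ioo a b, fun x hx => ?_, isOpen_Ioo, x₀, hab⟩
      (thin_real_iUnion (L := L) (fun k => ?_) hk)
    · exact mem_iUnion.2 ⟨_, hx, rfl⟩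
    · have h1 := Dmap.le_ncard hA hfin
      have : ∀ x, (A x).ncard = k ↔ k ≤ (A x).ncard ∧ ¬ k + 1 ≤ (A x).ncard := fun x => by omega
      simp only [mem_ofPred_eq, this, mem_Ioo]
      have := h1 k
      have := h1 (k + 1)
      exact .auto
  obtain ⟨V, hV, hVo, x₁, hx₁⟩ := not_thin_iff.1 hk
  obtain ⟨c, d, hcd, hcdV⟩ := mem_nhds_iff_exists_Ioo_subset.1 (hVo.mem_nhds hx₁)
  obtain ⟨f, hf, hfA⟩ := exists_enum (L := L) (A := fun x => {y | y ∈ A x ∧ x ∈ Ioo c d})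
    (by simp only [mem_ofPred_eq, mem_Ioo]; exact .auto) (fun x => (hfin x).subset fun y h => h.1) k
    (fun x => by
      by_cases hx : x ∈ Ioo c d
      · rw [← (hV (hcdV hx)).2]
        exact ncard_le_ncard (fun y h => h.1) (hfin x)
      · simp [-mem_Ioo, hx])
  obtain ⟨c', d', hc, hcd', hd, hcont⟩ := exists_continuousOn_Ioo_finite hf (hcd.1.trans hcd.2)
  have hrange : ∀ x ∈ Ioo c' d', (A x = range fun i => f i x) ∧
      Function.Injective fun i => f i x := by
    intro x hx
    have hx' : x ∈ Ioo c d := ⟨hc.trans_lt hx.1, hx.2.trans_le hd⟩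
    have hsub : A x ⊆ range fun i => f i x := fun y hy => hfA x y ⟨hy, hx'⟩
    have hcard := (hV (hcdV hx')).2
    have h1 : (range fun i => f i x).ncard ≤ k := by
      rw [← image_univ]; exact (ncard_image_le finite_univ).trans (by simp)
    have heq := eq_of_subset_of_ncard_le hsub (hcard ▸ h1) (finite_range _)
    refine ⟨heq, ?_⟩
    have h2 : (range fun i => f i x).ncard = k := heq ▸ hcard
    rw [← injOn_univ]
    refine injOn_of_ncard_image_eq ?_ finite_univ
    rw [image_univ, h2]; simp
  obtain ⟨x, hx⟩ := exists_between hcd'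
  have hxU : x ∈ U := habU (hV (hcdV ⟨hc.trans_lt hx.1, hx.2.trans_le hd⟩)).1
  refine hU hxU (tame1_of_continuousAt (fun i => hcont i x hx) ?_ (hrange x hx).2)
  filter_upwards [Ioo_mem_nhds hx.1 hx.2] with y hy using (hrange y hy).1

/-- Points meeting every component of the complement of a finite set. -/
noncomputable def sample {K : ℕ} (q : Fin K → ℝ) : Option (Fin K × Fin K ⊕ Fin K ⊕ Fin K) → ℝ
  | none => 0
  | some (Sum.inl p) => (q p.1 + q p.2) / 2
  | some (Sum.inr (Sum.inl i)) => q i + 1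
  | some (Sum.inr (Sum.inr i)) => q i - 1

theorem exists_sample {K : ℕ} (q : Fin K → ℝ) {x : ℝ} (hx : ∀ i, q i ≠ x) :
    ∃ l, ∀ i, q i ∉ uIcc x (sample q l) := by
  have hlow : (∃ i, q i < x ∧ ∀ j, q j < x → q j ≤ q i) ∨ ∀ j, ¬ q j < x := by
    by_cases h : ∃ j, q j < x
    · left
      obtain ⟨i, hi, hm⟩ := (toFinite {j | q j < x}).exists_maximalFor q _ h
      exact ⟨i, hi, fun j hj => by
        by_contra hc; exact hc (hm hj (le_of_not_ge hc))⟩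
    · exact Or.inr (not_exists.1 h)
  have hhigh : (∃ i, x < q i ∧ ∀ j, x < q j → q i ≤ q j) ∨ ∀ j, ¬ x < q j := by
    by_cases h : ∃ j, x < q j
    · left
      obtain ⟨i, hi, hm⟩ := (toFinite {j | x < q j}).exists_minimalFor q _ h
      exact ⟨i, hi, fun j hj => by
        by_contra hc; exact hc (hm hj (le_of_not_ge hc))⟩
    · exact Or.inr (not_exists.1 h)
  have hcase : ∀ t, (∀ j, q j < x → q j < t) → (∀ j, x < q j → t < q j) →
      ∀ j, q j ∉ uIcc x t := by
    intro t h1 h2 j hj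
    rw [mem_uIcc] at hj
    rcases lt_or_gt_of_ne (hx j) with h | h
    · have := h1 j h
      rcases hj with hj | hj <;> linarith
    · have := h2 j h
      rcases hj with hj | hj <;> linarith
  rcases hlow with ⟨i, hi, hmi⟩ | hlow <;> rcases hhigh with ⟨j, hj, hmj⟩ | hhigh
  · refine ⟨some (Sum.inl (i, j)), hcase _ (fun l hl => ?_) fun l hl => ?_⟩
    · have := hmi l hl; simp only [sample]; linarith
    · have := hmj l hl; simp only [sample]; linarith
  · refine ⟨some (Sum.inr (Sum.inl i)), hcase _ (fun l hl => ?_) fun l hl => absurd hl (hhigh l)⟩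
    have := hmi l hl; simp only [sample]; linarith
  · refine ⟨some (Sum.inr (Sum.inr j)), hcase _ (fun l hl => absurd hl (hlow l)) fun l hl => ?_⟩
    have := hmj l hl; simp only [sample]; linarith
  · exact ⟨none, hcase _ (fun l hl => absurd hl (hlow l)) fun l hl => absurd hl (hhigh l)⟩

theorem eq_of_eventually_eq_uIcc {N : ℝ → ℕ} {x t : ℝ}
    (h : ∀ y ∈ uIcc x t, ∀ᶠ z in 𝓝 y, N z = N y) : N x = N t := by
  have hc : ContinuousOn N (uIcc x t) := fun y hy =>
    (continuousAt_const.congr (Filter.EventuallyEq.symm (h y hy)) :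
      ContinuousAt N y).continuousWithinAt
  exact isPreconnected_uIcc.constant hc left_mem_uIcc right_mem_uIcc

variable (L) in
/-- Uniform bounds for finite fibres over `X`. -/
def UnifFin (X : Type) [Dt L X] : Prop :=
  ∀ A : X → Set ℝ, Dmap L (fun p : X × ℝ => p.2 ∈ A p.1) → (∀ x, (A x).Finite) →
    ∃ K, ∀ x, (A x).ncard ≤ K

theorem UnifFin.prod (hX : UnifFin L X) : UnifFin L (X × ℝ) := by
  intro A hA hfin
  let B : X → Set ℝ := fun x => {t | ¬ Tame1 (fun t => A (x, t)) t}
  have hA' : Dmap L fun p : X × ℝ × ℝ => p.2.2 ∈ A (p.1, p.2.1) :=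
    Dmap.comp (f := fun p : X × ℝ × ℝ => ((p.1, p.2.1), p.2.2)) hA .auto
  have hB : Dmap L fun p : X × ℝ => p.2 ∈ B p.1 := by
    refine Dmap.not (Dmap.tame1 (A := fun (p : X × ℝ) t => A (p.1, t)) (a := Prod.snd) ?_ .auto)
    exact Dmap.comp (f := fun p : (X × ℝ) × ℝ × ℝ => (p.1.1, p.2.1, p.2.2)) hA' .auto
  have hBfin : ∀ x, (B x).Finite := fun x =>
    finite_not_tame1 (A := fun t => A (x, t)) (L := L)
      (Dmap.comp (f := fun p : ℝ × ℝ => (x, p.1, p.2)) hA' .auto) fun t => hfin _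
  obtain ⟨K, hK⟩ := hX B hB hBfin
  obtain ⟨q, hq, hqB⟩ := exists_enum hB hBfin K hK
  let s : Fin K ⊕ Option (Fin K × Fin K ⊕ Fin K ⊕ Fin K) → X → ℝ :=
    fun l x => Sum.elim (fun i => q i x) (sample fun i => q i x) l
  have hs : ∀ l, Dmap L (s l) := by
    rintro (i | l)
    · exact hq i
    · rcases l with _ | (p | i | i) <;> simp only [s, Sum.elim_inr, sample] <;> exact .auto
  have hu : ∀ l, ∃ K, ∀ x, (A (x, s l x)).ncard ≤ K := fun l =>
    hX (fun x => A (x, s l x)) (Dmap.comp (f := fun p : X × ℝ => (p.1, s l p.1, p.2)) hA'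
      (by have := hs l; fun_prop)) fun x => hfin _
  choose M hM using hu
  refine ⟨∑ l, M l, fun p => ?_⟩
  obtain ⟨l, hl⟩ : ∃ l, (A p).ncard = (A (p.1, s l p.1)).ncard := by
    by_cases h : ∃ i, q i p.1 = p.2
    · obtain ⟨i, hi⟩ := h
      exact ⟨Sum.inl i, by simp [s, hi]⟩
    · obtain ⟨l, hl⟩ := exists_sample (fun i => q i p.1) (not_exists.1 h)
      refine ⟨Sum.inr l, eq_of_eventually_eq_uIcc (N := fun t => (A (p.1, t)).ncard) fun t ht => ?_⟩
      have : t ∉ B p.1 := fun htB => by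
        obtain ⟨i, hi⟩ := hqB p.1 t htB
        exact hl i (by rw [hi]; exact ht)
      exact (not_not.1 this).eventually_ncard
  rw [hl]
  exact (hM l _).trans (Finset.single_le_sum (fun _ _ => Nat.zero_le _) (Finset.mem_univ l))

theorem UnifFin.of_dmap {Y : Type} [Dt L Y] (hX : UnifFin L X) {g : X → Y} {h : Y → X}
    (hg : Dmap L g) (hgh : ∀ y, g (h y) = y) : UnifFin L Y := by
  intro A hA hfin
  obtain ⟨K, hK⟩ := hX (fun x => A (g x))
    (Dmap.comp (f := fun p : X × ℝ => (g p.1, p.2)) hA .auto) fun x => hfin _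
  exact ⟨K, fun y => by simpa only [hgh] using hK (h y)⟩

variable (L) in
theorem unifFin_pi (n : ℕ) : UnifFin L (Fin n → ℝ) := by
  induction n with
  | zero =>
    intro A _ _
    exact ⟨(A default).ncard, fun x => by rw [Subsingleton.elim x default]⟩
  | succ n ih =>
    exact ih.prod.of_dmap (g := fun p => Fin.snoc (α := fun _ => ℝ) p.1 p.2)
      (h := fun x => (fun i => x i.castSucc, x (Fin.last n))) .auto
      fun x => Fin.snoc_init_self x

/-- Finite fibres over `ℝⁿ` are covered by finitely many definable functions. -/
theorem exists_finite_enum {n : ℕ} {A : (Fin n → ℝ) → Set ℝ}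
    (hA : Dmap L fun p : (Fin n → ℝ) × ℝ => p.2 ∈ A p.1) (hfin : ∀ x, (A x).Finite) :
    ∃ (K : ℕ) (f : Fin K → (Fin n → ℝ) → ℝ), (∀ i, Dmap L (f i)) ∧
      ∀ x, ∀ y ∈ A x, ∃ i, f i x = y := by
  obtain ⟨K, hK⟩ := unifFin_pi L n A hA hfin
  exact ⟨K, exists_enum hA hfin K hK⟩

end UniformFiniteness

section Cells

/-- The open unit cube. -/
def Q (n : ℕ) : Set (Fin n → ℝ) := {x | ∀ i, 0 < x i ∧ x i < 1}

/-- Dropping the last coordinate. -/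
def pinit {n : ℕ} (x : Fin (n + 1) → ℝ) : Fin n → ℝ := fun i => x i.castSucc

@[simp] theorem pinit_snoc {n : ℕ} (x : Fin n → ℝ) (t : ℝ) :
    pinit (Fin.snoc (α := fun _ => ℝ) x t) = x := by ext i; simp [pinit]

@[simp] theorem snoc_pinit {n : ℕ} (p : Fin (n + 1) → ℝ) :
    Fin.snoc (α := fun _ => ℝ) (pinit p) (p (Fin.last n)) = p := Fin.snoc_init_self p

theorem mem_Q_succ {n : ℕ} {p : Fin (n + 1) → ℝ} :
    p ∈ Q (n + 1) ↔ pinit p ∈ Q n ∧ 0 < p (Fin.last n) ∧ p (Fin.last n) < 1 :=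
  Fin.forall_fin_succ'

theorem isOpen_Q (n : ℕ) : IsOpen (Q n) := by
  have : Q n = ⋂ i, {x | 0 < x i ∧ x i < 1} := by ext x; simp [Q]
  rw [this]
  exact isOpen_iInter_of_finite fun i => (isOpen_lt continuous_const (continuous_apply i)).inter
    (isOpen_lt (continuous_apply i) continuous_const)

theorem nonempty_Q (n : ℕ) : (Q n).Nonempty := ⟨fun _ => 1 / 2, fun _ => by norm_num⟩

theorem continuous_pinit {n : ℕ} : Continuous (pinit (n := n)) := by unfold pinit; fun_prop

theorem contDiff_pinit {n : ℕ} {r : ℕ} : ContDiff ℝ r (pinit (n := n)) := by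
  unfold pinit; fun_prop

theorem contDiffAt_snoc {n m r : ℕ} {f : (Fin m → ℝ) → (Fin n → ℝ)} {g : (Fin m → ℝ) → ℝ}
    {x : Fin m → ℝ} (hf : ContDiffAt ℝ r f x) (hg : ContDiffAt ℝ r g x) :
    ContDiffAt ℝ r (fun x => (Fin.snoc (α := fun _ => ℝ) (f x) (g x) : Fin (n + 1) → ℝ)) x := by
  refine contDiffAt_pi.2 fun i => Fin.lastCases ?_ (fun i => ?_) i
  · simpa using hg
  · simpa using contDiffAt_pi.1 hf i

variable {L : FirstOrder.Language} [L.Structure ℝ] {X : Type} [Dt L X]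

@[fun_prop] theorem Dmap.pinit {n : ℕ} {f : X → Fin (n + 1) → ℝ} (hf : Dmap L f) :
    Dmap L fun x => pinit (f x) := by unfold Paper.pinit; fun_prop

variable [OM L]

variable (L) in
theorem dmap_mem_Q (n : ℕ) : Dmap L fun x => x ∈ Q n := by
  simp only [Q, mem_ofPred_eq]; exact .auto

@[fun_prop] theorem Dmap.mem_Q {n : ℕ} {f : X → Fin n → ℝ} (hf : Dmap L f) :
    Dmap L fun x => f x ∈ Q n := Dmap.comp (dmap_mem_Q L n) hf

variable (L) in
/-- An open cell with a definable `C^r` parametrization by the cube. -/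
def IsTop (r : ℕ) {n : ℕ} (C : Set (Fin n → ℝ)) : Prop :=
  ∃ h w : (Fin n → ℝ) → (Fin n → ℝ), Dmap L h ∧ Dmap L w ∧ IsOpen C ∧ C = h '' Q n ∧
    (∀ s ∈ Q n, ContDiffAt ℝ r h s ∧ w (h s) = s) ∧ ∀ x ∈ C, ContDiffAt ℝ r w x

variable (L) in
/-- An injective definable image of a cube of smaller dimension. -/
def IsLow {n : ℕ} (C : Set (Fin n → ℝ)) : Prop :=
  ∃ j < n, ∃ h : (Fin j → ℝ) → (Fin n → ℝ), Dmap L h ∧ InjOn h (Q j) ∧ C = h '' Q j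

variable (L) in
/-- Finite unions of cells. -/
def Cellular (r : ℕ) {n : ℕ} (S : Set (Fin n → ℝ)) : Prop :=
  ∃ 𝒞 : Set (Set (Fin n → ℝ)), 𝒞.Finite ∧ ⋃₀ 𝒞 = S ∧ ∀ C ∈ 𝒞, IsTop L r C ∨ IsLow L C

variable {r n : ℕ}

theorem Cellular.of_cell {C : Set (Fin n → ℝ)} (h : IsTop L r C ∨ IsLow L C) : Cellular L r C :=
  ⟨{C}, finite_singleton C, sUnion_singleton C, fun _ hD => by rwa [mem_singleton_iff.1 hD]⟩

theorem Cellular.iUnion {κ : Type*} [Finite κ] {S : κ → Set (Fin n → ℝ)}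
    (h : ∀ k, Cellular L r (S k)) : Cellular L r (⋃ k, S k) := by
  choose 𝒞 hf hU hC using h
  refine ⟨⋃ k, 𝒞 k, finite_iUnion hf, ?_, fun C hCm => ?_⟩
  · rw [sUnion_iUnion]; simp only [hU]
  · obtain ⟨k, hk⟩ := mem_iUnion.1 hCm
    exact hC k C hk

theorem Cellular.union {S T : Set (Fin n → ℝ)} (h : Cellular L r S) (h' : Cellular L r T) :
    Cellular L r (S ∪ T) := by
  rw [union_eq_iUnion]
  exact .iUnion fun b => by cases b <;> assumption

theorem Cellular.fibre {Z : Set (Fin n → ℝ)} (hZ : Cellular L r Z) {S : Set (Fin (n + 1) → ℝ)}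
    (hS : ∀ p ∈ S, pinit p ∈ Z)
    (h : ∀ C ⊆ Z, IsTop L r C ∨ IsLow L C → Cellular L r {p | p ∈ S ∧ pinit p ∈ C}) :
    Cellular L r S := by
  obtain ⟨𝒞, hf, hU, hC⟩ := hZ
  have := hf.to_subtype
  have h1 : Cellular L r (⋃ C : 𝒞, {p | p ∈ S ∧ pinit p ∈ (C : Set (Fin n → ℝ))}) :=
    .iUnion fun C => h C (hU ▸ subset_sUnion_of_mem C.2) (hC C C.2)
  convert h1
  ext p
  simp only [mem_iUnion, mem_ofPred_eq, Subtype.exists, exists_prop]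
  constructor
  · intro hp
    obtain ⟨C, hC, hpC⟩ := mem_sUnion.1 (hU.symm ▸ hS p hp)
    exact ⟨C, hC, hp, hpC⟩
  · rintro ⟨C, -, hp, -⟩; exact hp

theorem exists_param {C : Set (Fin n → ℝ)} (h : IsTop L r C ∨ IsLow L C) :
    ∃ j ≤ n, ∃ h : (Fin j → ℝ) → (Fin n → ℝ), Dmap L h ∧ InjOn h (Q j) ∧ C = h '' Q j := by
  rcases h with ⟨h, w, hh, -, -, rfl, h1, -⟩ | ⟨j, hj, h, hh, hi, rfl⟩
  · exact ⟨n, le_rfl, h, hh, fun s hs t ht e => by rw [← (h1 s hs).2, e, (h1 t ht).2], rfl⟩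
  · exact ⟨j, hj.le, h, hh, hi, rfl⟩

theorem graph_isLow {C : Set (Fin n → ℝ)} (hC : IsTop L r C ∨ IsLow L C) {f : (Fin n → ℝ) → ℝ}
    (hf : Dmap L f) : IsLow L {p : Fin (n + 1) → ℝ | pinit p ∈ C ∧ p (Fin.last n) = f (pinit p)} := by
  obtain ⟨j, hj, h, hh, hi, rfl⟩ := exists_param hC
  refine ⟨j, Nat.lt_succ_of_le hj, fun s => Fin.snoc (α := fun _ => ℝ) (h s) (f (h s)), .auto,
    fun s hs t ht e => hi hs ht ?_, ?_⟩
  · simpa using congrArg pinit e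
  · ext p
    simp only [mem_ofPred_eq, mem_image]
    constructor
    · rintro ⟨⟨s, hs, hsp⟩, h2⟩
      exact ⟨s, hs, by rw [hsp, ← h2, snoc_pinit]⟩
    · rintro ⟨s, hs, rfl⟩
      exact ⟨⟨s, hs, by simp⟩, by simp⟩

/-- The parametrization of the band between the graphs of `a` and `b` over the cell of `h`. -/
def bandMap {m n : ℕ} (h : (Fin m → ℝ) → (Fin n → ℝ)) (a b : (Fin n → ℝ) → ℝ)
    (s : Fin (m + 1) → ℝ) : Fin (n + 1) → ℝ :=
  Fin.snoc (α := fun _ => ℝ) (h (pinit s))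
    (a (h (pinit s)) + (b (h (pinit s)) - a (h (pinit s))) * s (Fin.last m))

theorem bandMap_image {m : ℕ} {h : (Fin m → ℝ) → (Fin n → ℝ)} {a b : (Fin n → ℝ) → ℝ}
    (hab : ∀ x ∈ h '' Q m, a x < b x) : {p : Fin (n + 1) → ℝ | pinit p ∈ h '' Q m ∧
      a (pinit p) < p (Fin.last n) ∧ p (Fin.last n) < b (pinit p)} = bandMap h a b '' Q (m + 1) := by
  ext p
  simp only [mem_ofPred_eq]
  constructor
  · rintro ⟨⟨s, hs, hsp⟩, h1, h2⟩
    have h0 := sub_pos.2 (hab _ ⟨s, hs, hsp⟩)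
    refine ⟨Fin.snoc (α := fun _ => ℝ) s ((p (Fin.last n) - a (pinit p)) /
      (b (pinit p) - a (pinit p))), mem_Q_succ.2 ⟨by simpa using hs, ?_, ?_⟩, ?_⟩
    · simpa using div_pos (sub_pos.2 h1) h0
    · simp only [Fin.snoc_last]
      rw [div_lt_one h0]; linarith
    · simp only [bandMap, pinit_snoc, hsp, Fin.snoc_last]
      rw [mul_div_cancel₀ _ h0.ne', add_sub_cancel, snoc_pinit]
  · rintro ⟨s, hs, rfl⟩
    obtain ⟨hs, h1, h2⟩ := mem_Q_succ.1 hs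
    have h0 := sub_pos.2 (hab _ ⟨_, hs, rfl⟩)
    refine ⟨⟨_, hs, by simp [bandMap]⟩, ?_, ?_⟩ <;>
    simp only [bandMap, pinit_snoc, Fin.snoc_last] <;> nlinarith

theorem injOn_bandMap {m : ℕ} {h : (Fin m → ℝ) → (Fin n → ℝ)} {a b : (Fin n → ℝ) → ℝ}
    (hab : ∀ x ∈ h '' Q m, a x < b x) (hi : InjOn h (Q m)) : InjOn (bandMap h a b) (Q (m + 1)) := by
  intro s hs t ht e
  have hs := mem_Q_succ.1 hs
  have ht := mem_Q_succ.1 ht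
  have h1 : pinit s = pinit t := hi hs.1 ht.1 (by simpa [bandMap] using congrArg pinit e)
  have h2 := congrFun e (Fin.last n)
  simp only [bandMap, h1, Fin.snoc_last, add_right_inj] at h2
  have h0 := sub_pos.2 (hab _ ⟨_, ht.1, rfl⟩)
  rw [← snoc_pinit s, ← snoc_pinit t, h1, mul_left_cancel₀ h0.ne' h2]

theorem band_isLow {C : Set (Fin n → ℝ)} (hC : IsLow L C) {a b : (Fin n → ℝ) → ℝ}
    (ha : Dmap L a) (hb : Dmap L b) (hab : ∀ x ∈ C, a x < b x) :
    IsLow L {p : Fin (n + 1) → ℝ | pinit p ∈ C ∧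
      a (pinit p) < p (Fin.last n) ∧ p (Fin.last n) < b (pinit p)} := by
  obtain ⟨j, hj, h, hh, hi, rfl⟩ := hC
  exact ⟨j + 1, Nat.succ_lt_succ hj, bandMap h a b, by unfold bandMap; exact .auto,
    injOn_bandMap hab hi, bandMap_image hab⟩

theorem band_isTop {C : Set (Fin n → ℝ)} (hC : IsTop L r C) {a b : (Fin n → ℝ) → ℝ}
    (ha : Dmap L a) (hb : Dmap L b) (hab : ∀ x ∈ C, a x < b x)
    (har : ∀ x ∈ C, ContDiffAt ℝ r a x) (hbr : ∀ x ∈ C, ContDiffAt ℝ r b x) :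
    IsTop L r {p : Fin (n + 1) → ℝ | pinit p ∈ C ∧
      a (pinit p) < p (Fin.last n) ∧ p (Fin.last n) < b (pinit p)} := by
  obtain ⟨h, w, hh, hw, ho, rfl, h1, h2⟩ := hC
  refine ⟨bandMap h a b, fun p => Fin.snoc (α := fun _ => ℝ) (w (pinit p))
    ((p (Fin.last n) - a (pinit p)) / (b (pinit p) - a (pinit p))), by unfold bandMap; exact .auto,
    .auto, ?_, bandMap_image hab, fun s hs => ⟨?_, ?_⟩, fun p hp => ?_⟩
  · rw [isOpen_iff_mem_nhds]
    rintro p ⟨hp, hp1, hp2⟩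
    have hpc : ContinuousAt (pinit (n := n)) p := continuous_pinit.continuousAt
    have hl : ContinuousAt (fun p : Fin (n + 1) → ℝ => p (Fin.last n)) p :=
      (continuous_apply _).continuousAt
    have hac : ContinuousAt (fun p => a (pinit p)) p :=
      ContinuousAt.comp (har _ hp).continuousAt hpc
    have hbc : ContinuousAt (fun p => b (pinit p)) p :=
      ContinuousAt.comp (hbr _ hp).continuousAt hpc
    filter_upwards [hpc.preimage_mem_nhds (ho.mem_nhds hp), hac.eventually_lt hl hp1,
      hl.eventually_lt hbc hp2] with q hq hq1 hq2 using ⟨hq, hq1, hq2⟩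
  · have hs' := (mem_Q_succ.1 hs).1
    have hh' : ContDiffAt ℝ r (fun s => h (pinit s)) s :=
      ContDiffAt.comp s (h1 _ hs').1 contDiff_pinit.contDiffAt
    have ha' : ContDiffAt ℝ r (fun s => a (h (pinit s))) s :=
      ContDiffAt.comp s (har _ ⟨_, hs', rfl⟩) hh'
    have hb' : ContDiffAt ℝ r (fun s => b (h (pinit s))) s :=
      ContDiffAt.comp s (hbr _ ⟨_, hs', rfl⟩) hh'
    exact contDiffAt_snoc hh' (ha'.add ((hb'.sub ha').mul (by fun_prop)))
  · have hs' := (mem_Q_succ.1 hs).1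
    have h0 := sub_pos.2 (hab _ ⟨_, hs', rfl⟩)
    simp only [bandMap, pinit_snoc, Fin.snoc_last, add_sub_cancel_left]
    rw [mul_div_cancel_left₀ _ h0.ne', (h1 _ hs').2, snoc_pinit]
  · obtain ⟨hp, -, -⟩ := hp
    have hpi : ContDiffAt ℝ r (pinit (n := n)) p := contDiff_pinit.contDiffAt
    have ha' : ContDiffAt ℝ r (fun s => a (pinit s)) p := ContDiffAt.comp p (har _ hp) hpi
    have hb' : ContDiffAt ℝ r (fun s => b (pinit s)) p := ContDiffAt.comp p (hbr _ hp) hpi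
    exact contDiffAt_snoc (ContDiffAt.comp p (h2 _ hp) hpi)
      ((ContDiffAt.sub (by fun_prop) ha').div (hb'.sub ha') (sub_pos.2 (hab _ hp)).ne')

theorem IsTop.not_thin {C : Set (Fin n → ℝ)} (hC : IsTop L r C) : ¬ Thin C := by
  obtain ⟨h, w, -, -, ho, rfl, -⟩ := hC
  exact not_thin_iff.2 ⟨_, Subset.rfl, ho, (nonempty_Q n).image h⟩

theorem band_cellular (ih : ∀ Z ⊆ Q n, Dmap L (fun x => x ∈ Z) → Cellular L r Z)
    {Z : Set (Fin n → ℝ)} (hZQ : Z ⊆ Q n) (hZ : Dmap L fun x => x ∈ Z) {a b : (Fin n → ℝ) → ℝ}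
    (ha : Dmap L a) (hb : Dmap L b) (hab : ∀ x ∈ Z, a x < b x) :
    Cellular L r {p : Fin (n + 1) → ℝ | pinit p ∈ Z ∧
      a (pinit p) < p (Fin.last n) ∧ p (Fin.last n) < b (pinit p)} := by
  let R : (Fin n → ℝ) → Prop := fun x => ContDiffAt ℝ r a x ∧ ContDiffAt ℝ r b x
  have ha' : Dmap L fun x => ContDiffAt ℝ r a x :=
    .contDiffAt_real r (F := fun _ => a) (a := fun x => x) .auto .auto
  have hb' : Dmap L fun x => ContDiffAt ℝ r b x :=
    .contDiffAt_real r (F := fun _ => b) (a := fun x => x) .auto .auto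
  have hR : Dmap L R := .and ha' hb'
  have hRt : Thin {x | ¬ R x} :=
    thin_and ha' hb' (thin_not_contDiffAt_real r ha) (thin_not_contDiffAt_real r hb)
  have key : ∀ W ⊆ Z, Dmap L (fun x => x ∈ W) → (∀ C ⊆ W, IsTop L r C → ∀ x ∈ C, R x) →
      Cellular L r {p : Fin (n + 1) → ℝ | pinit p ∈ W ∧
      a (pinit p) < p (Fin.last n) ∧ p (Fin.last n) < b (pinit p)} := by
    intro W hWZ hW hWR
    refine (ih W (hWZ.trans hZQ) hW).fibre (fun p hp => hp.1) fun C hCW hC => .of_cell ?_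
    have : {p : Fin (n + 1) → ℝ | p ∈ {p : Fin (n + 1) → ℝ | pinit p ∈ W ∧
      a (pinit p) < p (Fin.last n) ∧ p (Fin.last n) < b (pinit p)} ∧ pinit p ∈ C} =
      {p : Fin (n + 1) → ℝ | pinit p ∈ C ∧
      a (pinit p) < p (Fin.last n) ∧ p (Fin.last n) < b (pinit p)} := by
      ext p; simp only [mem_ofPred_eq]
      exact ⟨fun h => ⟨h.2, h.1.2⟩, fun h => ⟨⟨hCW h.1, h.2⟩, h.1⟩⟩
    rw [this]
    have hab' : ∀ x ∈ C, a x < b x := fun x hx => hab x (hWZ (hCW hx))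
    rcases hC with hC | hC
    · exact Or.inl (band_isTop hC ha hb hab' (fun x hx => (hWR C hCW hC x hx).1)
        fun x hx => (hWR C hCW hC x hx).2)
    · exact Or.inr (band_isLow hC ha hb hab')
  convert (key {x | x ∈ Z ∧ R x} (fun x h => h.1) (by simp only [mem_ofPred_eq]; exact .auto)
    fun C hC _ x hx => (hC hx).2).union (key {x | x ∈ Z ∧ ¬ R x} (fun x h => h.1)
    (by simp only [mem_ofPred_eq]; exact .auto)
    fun C hC hT => absurd (hRt.mono fun x hx => (hC hx).2) hT.not_thin)
  ext p
  simp only [mem_ofPred_eq, mem_union]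
  tauto

theorem finite_not_eventually {P : ℝ → Prop} (hP : Dmap L P) :
    {t | ¬ ((∀ᶠ s in 𝓝 t, P s) ∨ ∀ᶠ s in 𝓝 t, ¬ P s)}.Finite := by
  refine finite_of_interior_eq_empty (L := L) (Dmap.not (.or
    (Dmap.eventually_nhds_real (P := fun _ s => P s) (f := fun x => x) .auto .auto)
    (Dmap.eventually_nhds_real (P := fun _ s => ¬ P s) (f := fun x => x) .auto .auto))) ?_
  by_contra hne
  obtain ⟨U, hU, hUo, x₀, hx₀⟩ := not_thin_iff.1 hne
  by_cases hc : ∃ x ∈ U, ∀ᶠ s in 𝓝 x, P s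
  · obtain ⟨x, hx, h⟩ := hc
    exact hU hx (Or.inl h)
  · have h1 : {s | P s ∧ ∃ a b : ℝ, a < x₀ ∧ x₀ < b ∧ a < s ∧ s < b ∧ Ioo a b ⊆ U}.Nonempty := by
      by_contra hn
      obtain ⟨a, b, hab, habU⟩ := mem_nhds_iff_exists_Ioo_subset.1 (hUo.mem_nhds hx₀)
      refine hU hx₀ (Or.inr ?_)
      filter_upwards [Ioo_mem_nhds hab.1 hab.2] with s hs hPs
      exact hn ⟨s, hPs, a, b, hab.1, hab.2, hs.1, hs.2, habU⟩
    obtain ⟨a, b, hab, habU⟩ := mem_nhds_iff_exists_Ioo_subset.1 (hUo.mem_nhds hx₀)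
    have hfin : {s | s ∈ Ioo a b ∧ P s}.Finite := by
      refine finite_of_interior_eq_empty (L := L) (by simp only [mem_Ioo, mem_ofPred_eq]; exact .auto) ?_
      by_contra hne
      obtain ⟨V, hV, hVo, x₁, hx₁⟩ := not_thin_iff.1 hne
      exact hc ⟨x₁, habU (hV hx₁).1, Filter.mem_of_superset (hVo.mem_nhds hx₁) fun y hy => (hV hy).2⟩
    obtain ⟨x, hx, hx'⟩ := ((Ioo_infinite (hab.1.trans hab.2)).sdiff hfin).nonempty
    refine hU (habU hx) (Or.inr ?_)
    filter_upwards [Ioo_mem_nhds hx.1 hx.2, hfin.isClosed.isOpen_compl.mem_nhds hx'] with s hs hs' hP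
    exact hs' ⟨hs, hP⟩

theorem iff_of_eventually_uIcc {P : ℝ → Prop} {x t : ℝ}
    (h : ∀ y ∈ uIcc x t, (∀ᶠ s in 𝓝 y, P s) ∨ ∀ᶠ s in 𝓝 y, ¬ P s) : P x ↔ P t := by
  classical
  have := eq_of_eventually_eq_uIcc (N := fun s => if P s then 1 else 0) (x := x) (t := t) fun y hy => by
    rcases h y hy with h | h
    · filter_upwards [h] with s hs
      simp [hs, h.self_of_nhds]
    · filter_upwards [h] with s hs
      simp [hs, h.self_of_nhds]
  by_cases h1 : P x <;> by_cases h2 : P t <;> simp_all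

variable (L r n) in
/-- Cell decomposition. -/
theorem cellular (S : Set (Fin n → ℝ)) (hSQ : S ⊆ Q n) (hS : Dmap L fun x => x ∈ S) :
    Cellular L r S := by
  induction n with
  | zero =>
    rcases S.eq_empty_or_nonempty with rfl | hne
    · exact ⟨∅, finite_empty, by simp, by simp⟩
    · refine .of_cell (Or.inl ⟨id, id, .id, .id, ?_, ?_, fun s _ => ⟨contDiffAt_id, rfl⟩,
        fun s _ => contDiffAt_id⟩)
      · rw [Subsingleton.eq_univ_of_nonempty hne]; exact isOpen_univ
      · rw [image_id, Subsingleton.eq_univ_of_nonempty hne,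
          Subsingleton.eq_univ_of_nonempty (nonempty_Q 0)]
  | succ n ih =>
    let A : (Fin n → ℝ) → Set ℝ := fun x => {t | t = 0 ∨ t = 1 ∨
      ¬ ((∀ᶠ s in 𝓝 t, Fin.snoc (α := fun _ => ℝ) x s ∈ S) ∨
        ∀ᶠ s in 𝓝 t, ¬ Fin.snoc (α := fun _ => ℝ) x s ∈ S)}
    have hA : Dmap L fun p : (Fin n → ℝ) × ℝ => p.2 ∈ A p.1 := by
      refine .or .auto (.or .auto (.not (.or ?_ ?_)))
      · exact Dmap.eventually_nhds_real (P := fun (p : (Fin n → ℝ) × ℝ) s =>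
          Fin.snoc (α := fun _ => ℝ) p.1 s ∈ S) .auto .auto
      · exact Dmap.eventually_nhds_real (P := fun (p : (Fin n → ℝ) × ℝ) s =>
          ¬ Fin.snoc (α := fun _ => ℝ) p.1 s ∈ S) .auto .auto
    have hfin : ∀ x, (A x).Finite := fun x => by
      have h1 : Dmap L fun s : ℝ => Fin.snoc (α := fun _ => ℝ) x s ∈ S := .auto
      refine (((finite_singleton 0).union (finite_singleton 1)).union
        (finite_not_eventually h1)).subset ?_
      rintro t (h | h | h)
      · exact Or.inl (Or.inl h)
      · exact Or.inl (Or.inr h)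
      · exact Or.inr h
    obtain ⟨K, f, hf, hfA⟩ := exists_finite_enum hA hfin
    let Zg : Fin K → Set (Fin n → ℝ) := fun i => {x | x ∈ Q n ∧ Fin.snoc (α := fun _ => ℝ) x (f i x) ∈ S}
    let Zb : Fin K × Fin K → Set (Fin n → ℝ) := fun k => {x | x ∈ Q n ∧ f k.1 x < f k.2 x ∧
      ∀ t : ℝ, f k.1 x < t → t < f k.2 x → Fin.snoc (α := fun _ => ℝ) x t ∈ S}
    have hZg : ∀ i, Dmap L fun x => x ∈ Zg i := fun i => by
      simp only [Zg, mem_ofPred_eq]; exact .auto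
    have hZb : ∀ k, Dmap L fun x => x ∈ Zb k := fun k => by
      simp only [Zb, mem_ofPred_eq]; exact .auto
    have hg : ∀ i, Cellular L r {p : Fin (n + 1) → ℝ | pinit p ∈ Zg i ∧
        p (Fin.last n) = f i (pinit p)} := fun i => by
      refine (ih (Zg i) (fun x hx => hx.1) (hZg i)).fibre (fun p hp => hp.1) fun C hCZ hC =>
        .of_cell (Or.inr ?_)
      convert graph_isLow hC (hf i) using 1
      ext p; simp only [mem_ofPred_eq]
      exact ⟨fun h => ⟨h.2, h.1.2⟩, fun h => ⟨⟨hCZ h.1, h.2⟩, h.1⟩⟩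
    have hb : ∀ k, Cellular L r {p : Fin (n + 1) → ℝ | pinit p ∈ Zb k ∧
        f k.1 (pinit p) < p (Fin.last n) ∧ p (Fin.last n) < f k.2 (pinit p)} := fun k =>
      band_cellular ih (fun x hx => hx.1) (hZb k) (hf _) (hf _) fun x hx => hx.2.1
    convert (Cellular.iUnion hg).union (Cellular.iUnion hb)
    ext p
    simp only [mem_union, mem_iUnion, mem_ofPred_eq]
    constructor
    · intro hp
      have hpQ := mem_Q_succ.1 (hSQ hp)
      by_cases hc : ∃ i, f i (pinit p) = p (Fin.last n)
      · obtain ⟨i, hi⟩ := hc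
        exact Or.inl ⟨i, ⟨hpQ.1, by rw [hi]; simpa using hp⟩, hi.symm⟩
      · right
        obtain ⟨i0, hi0⟩ := hfA (pinit p) 0 (Or.inl rfl)
        obtain ⟨i1, hi1⟩ := hfA (pinit p) 1 (Or.inr (Or.inl rfl))
        obtain ⟨i, hi, hmi⟩ := (toFinite {j | f j (pinit p) < p (Fin.last n)}).exists_maximalFor
          (fun j => f j (pinit p)) _ ⟨i0, by simpa [hi0] using hpQ.2.1⟩
        obtain ⟨j, hj, hmj⟩ := (toFinite {j | p (Fin.last n) < f j (pinit p)}).exists_minimalFor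
          (fun j => f j (pinit p)) _ ⟨i1, by simpa [hi1] using hpQ.2.2⟩
        refine ⟨(i, j), ⟨hpQ.1, lt_trans hi hj, fun t hit htj => ?_⟩, hi, hj⟩
        have := iff_of_eventually_uIcc (P := fun s => Fin.snoc (α := fun _ => ℝ) (pinit p) s ∈ S)
          (x := p (Fin.last n)) (t := t) fun y hy => by
            by_contra hn
            obtain ⟨l, hl⟩ := hfA (pinit p) y (Or.inr (Or.inr hn))
            have hy' : f i (pinit p) < y ∧ y < f j (pinit p) := by
              have hi' : f i (pinit p) < p (Fin.last n) := hi
              have hj' : p (Fin.last n) < f j (pinit p) := hj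
              simp only at hit htj
              rw [mem_uIcc] at hy
              rcases hy with hy | hy <;> constructor <;> linarith
            rcases lt_trichotomy y (p (Fin.last n)) with h | h | h
            · have := hmi (show f l (pinit p) < _ by rwa [hl]) (by simp only [hl]; exact hy'.1.le)
              simp only [hl] at this; linarith
            · exact hc ⟨l, hl.trans h⟩
            · have := hmj (show _ < f l (pinit p) by rwa [hl]) (by simp only [hl]; exact hy'.2.le)
              simp only [hl] at this; linarith
        exact this.1 (by simpa using hp)
    · rintro (⟨i, ⟨-, h1⟩, h2⟩ | ⟨k, ⟨-, -, h1⟩, h2, h3⟩)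
      · rw [← h2] at h1; simpa using h1
      · simpa using h1 _ h2 h3

end Cells

section Dimension

variable {L : FirstOrder.Language} [L.Structure ℝ] [OM L] {X Y : Type} [Dt L X] [Dt L Y]

theorem dimH_image_Q_le {n : ℕ} : ∀ (j : ℕ) (f : (Fin j → ℝ) → (Fin n → ℝ)), Dmap L f →
    dimH (f '' Q j) ≤ j := by
  intro j
  induction j using Nat.strong_induction_on with
  | _ j ih =>
    intro f hf
    let R : (Fin j → ℝ) → Prop := fun x => ContDiffAt ℝ (1 : ℕ) f x
    have hR : Dmap L R := .contDiffAt 1 (F := fun _ => f) (a := fun x => x) .auto .auto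
    have h1 : dimH (f '' {x | R x}) ≤ j := by
      have h := dimH_image_le_of_locally_lipschitzOn (f := f) (s := {x | R x}) fun x hx => by
        have hx' : ContDiffAt ℝ (1 : ℕ) f x := hx
        obtain ⟨K, t, ht, h⟩ := ContDiffAt.exists_lipschitzOnWith (by exact_mod_cast hx')
        exact ⟨K, t, mem_nhdsWithin_of_mem_nhds ht, h⟩
      refine h.trans ?_
      have := dimH_mono (subset_univ {x | R x})
      simpa [Real.dimH_univ_pi_fin] using this
    obtain ⟨𝒞, hfin, hU, hC⟩ := cellular L 0 j {x | x ∈ Q j ∧ ¬ R x} (fun x h => h.1)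
      (by simp only [mem_ofPred_eq]; exact .auto)
    have h2 : dimH (f '' {x | x ∈ Q j ∧ ¬ R x}) ≤ j := by
      rw [← hU, sUnion_eq_biUnion, image_iUnion₂, dimH_bUnion hfin.countable]
      refine iSup₂_le fun C hCm => ?_
      rcases hC C hCm with h | ⟨i, hi, h, hh, -, rfl⟩
      · exact absurd ((thin_not_contDiffAt 1 hf).mono fun x hx =>
          ((hU ▸ subset_sUnion_of_mem hCm : C ⊆ {x | x ∈ Q j ∧ ¬ R x}) hx).2) h.not_thin
      · rw [image_image]
        exact (ih i hi (fun x => f (h x)) .auto).trans (by exact_mod_cast hi.le)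
    have : f '' Q j ⊆ f '' {x | R x} ∪ f '' {x | x ∈ Q j ∧ ¬ R x} := by
      rw [← image_union]
      refine image_mono fun x hx => ?_
      by_cases h : R x
      · exact Or.inl h
      · exact Or.inr ⟨hx, h⟩
    refine (dimH_mono this).trans ?_
    rw [dimH_union]
    exact max_le h1 h2

variable (L) in
/-- Being covered by finitely many definable images of cubes of dimension less than `d`. -/
inductive Low (d : ℕ) : Set X → Prop
  | image {j : ℕ} (hj : j < d) (f : (Fin j → ℝ) → X) (hf : Dmap L f) : Low d (f '' Q j)
  | empty : Low d ∅
  | union {S T : Set X} (hS : Low d S) (hT : Low d T) : Low d (S ∪ T)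
  | mono {S T : Set X} (hT : Low d T) (h : S ⊆ T) : Low d S

theorem Low.iUnion {d : ℕ} {κ : Type*} [Finite κ] {S : κ → Set X} (h : ∀ k, Low L d (S k)) :
    Low L d (⋃ k, S k) := by
  classical
  have := Fintype.ofFinite κ
  have : ∀ F : Finset κ, Low L d (⋃ k ∈ F, S k) := fun F => by
    induction F using Finset.induction_on with
    | empty => simpa using Low.empty
    | insert a F _ ih => rw [Finset.set_biUnion_insert]; exact (h a).union ih
  simpa using this Finset.univ

theorem Low.map {d : ℕ} {S : Set X} (h : Low L d S) {f : X → Y} (hf : Dmap L f) :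
    Low L d (f '' S) := by
  induction h with
  | image hj g hg => rw [image_image]; exact .image hj (fun x => f (g x)) .auto
  | empty => rw [image_empty]; exact .empty
  | union _ _ h h' => rw [image_union]; exact h.union h'
  | mono _ h ih => exact ih.mono (image_mono h)

theorem Low.of_low_zero {S : Set X} (h : Low L 0 S) : S = ∅ := by
  induction h with
  | image hj => omega
  | empty => rfl
  | union _ _ h h' => rw [h, h', empty_union]
  | mono _ h ih => exact subset_empty_iff.1 (ih ▸ h)

theorem Low.dimH_le {d n : ℕ} {S : Set (Fin n → ℝ)} (h : Low L (d + 1) S) : dimH S ≤ d := by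
  induction h with
  | image hj g hg =>
    exact (dimH_image_Q_le _ g hg).trans (by exact_mod_cast Nat.le_of_lt_succ hj)
  | empty => simp
  | union _ _ h h' => rw [dimH_union]; exact max_le h h'
  | mono _ h ih => exact (dimH_mono h).trans ih

theorem Low.thin {n : ℕ} {S : Set (Fin n → ℝ)} (h : Low L n S) : Thin S := by
  cases n with
  | zero => rw [h.of_low_zero]; exact interior_empty
  | succ d =>
    by_contra hn
    have h1 := Real.dimH_of_nonempty_interior (nonempty_iff_ne_empty.2 hn)
    have h2 := h.dimH_le
    rw [h1] at h2
    simp only [Module.finrank_fintype_fun_eq_card, Fintype.card_fin] at h2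
    have : d + 1 ≤ d := by exact_mod_cast h2
    omega

theorem Thin.low {n : ℕ} {S : Set (Fin n → ℝ)} (hS : Dmap L fun x => x ∈ S) (hSQ : S ⊆ Q n)
    (h : Thin S) : Low L n S := by
  obtain ⟨𝒞, hfin, rfl, hC⟩ := cellular L 0 n S hSQ hS
  have := hfin.to_subtype
  rw [sUnion_eq_iUnion]
  refine .iUnion fun C => ?_
  rcases hC C C.2 with hT | ⟨j, hj, f, hf, -, e⟩
  · exact absurd (h.mono (subset_sUnion_of_mem C.2)) hT.not_thin
  · rw [e]; exact .image hj f hf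

/-- A definable map that is injective on a definable set has a definable left inverse there. -/
theorem Dmap.exists_leftInvOn [Nonempty X] {e : X → Y} (he : Dmap L e) {A : Set X}
    (hA : Dmap L fun x => x ∈ A) (hi : InjOn e A) :
    ∃ w : Y → X, Dmap L w ∧ ∀ x ∈ A, w (e x) = x := by
  classical
  let x₀ : X := Classical.arbitrary X
  let w : Y → X := fun y => if h : ∃ x ∈ A, e x = y then h.choose else x₀
  have hw : ∀ x ∈ A, w (e x) = x := fun x hx => by
    have h : ∃ x' ∈ A, e x' = e x := ⟨x, hx, rfl⟩
    simp only [w, dif_pos h]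
    exact hi h.choose_spec.1 hx h.choose_spec.2
  refine ⟨w, of_graph' (P := fun y x => (x ∈ A ∧ e x = y) ∨
    (¬ (∃ x : X, x ∈ A ∧ e x = y) ∧ x = x₀)) .auto fun y x => ?_, hw⟩
  constructor
  · rintro rfl
    by_cases h : ∃ x ∈ A, e x = y
    · obtain ⟨x, hx, rfl⟩ := h
      rw [hw x hx]; exact Or.inl ⟨hx, rfl⟩
    · right; exact ⟨h, by simp only [w, dif_neg h]⟩
  · rintro (⟨hx, rfl⟩ | ⟨h, rfl⟩)
    · exact hw x hx
    · simp only [w, dif_neg h]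

variable (L X) in
theorem exists_squeeze : ∃ (n : ℕ) (e : X → Fin n → ℝ), Dmap L e ∧ Function.Injective e ∧
    ∀ x, e x ∈ Q n := by
  obtain ⟨n, ⟨σ⟩⟩ := Finite.exists_equiv_fin (Dt.idx L X)
  have hem : Dmap L fun x : X => fun i => em L x (σ.symm i) :=
    .of_reindex _ (fun i => σ.symm i.1) fun x => rfl
  obtain ⟨m, hm, hm'⟩ : ∃ m : X → Fin n → ℝ, Dmap L m ∧ ∀ x i, m x i = em L x (σ.symm i) :=
    ⟨_, hem, fun _ _ => rfl⟩
  have hpos : ∀ t : ℝ, 0 < 1 + |t| := fun t => by positivity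
  have habs : ∀ t : ℝ, |t / (1 + |t|)| < 1 := fun t => by
    rw [abs_div, abs_of_pos (hpos t), div_lt_one (hpos t)]; linarith
  refine ⟨n, fun x i => (1 + m x i / (1 + |m x i|)) / 2, .auto, fun x y h => ?_, fun x i => ?_⟩
  · have hinj : ∀ s t : ℝ, s / (1 + |s|) = t / (1 + |t|) → s = t := fun s t h => by
      have h0 : |s| = |t| := by
        have := congrArg abs h
        rw [abs_div, abs_div, abs_of_pos (hpos t), abs_of_pos (hpos s),
          div_eq_div_iff (hpos s).ne' (hpos t).ne'] at this
        linarith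
      rw [h0] at h
      exact (div_left_inj' (hpos t).ne').1 h
    refine (em_inj (L := L)).1 (funext fun k => ?_)
    have := congrFun h (σ k)
    simp only [hm', Equiv.symm_apply_apply] at this
    exact hinj _ _ (by linarith)
  · have := abs_lt.1 (habs (m x i))
    constructor <;> simp only <;> linarith

variable (L X) in
/-- A definable type is a finite disjoint union of injective images of cubes. -/
theorem exists_cells [Nonempty X] : ∃ (κ : Type) (_ : Finite κ) (dm : κ → ℕ)
    (u : ∀ k, (Fin (dm k) → ℝ) → X), (∀ k, Dmap L (u k)) ∧ (∀ k, InjOn (u k) (Q (dm k))) ∧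
    ∀ x, ∃ k, x ∈ u k '' Q (dm k) := by
  obtain ⟨n, e, he, hei, heQ⟩ := exists_squeeze L X
  obtain ⟨w, hw, hwe⟩ := he.exists_leftInvOn (A := univ) (by simpa using Dmap.const True) hei.injOn
  obtain ⟨𝒞, hfin, hU, hC⟩ := cellular L 0 n (range e) (range_subset_iff.2 heQ)
    (by simp only [mem_range]; exact .auto)
  have := hfin.to_subtype
  choose dm _ h hh hi hCe using fun C : 𝒞 => exists_param (hC C C.2)
  have hr : ∀ C : 𝒞, ∀ s ∈ Q (dm C), e (w (h C s)) = h C s := fun C s hs => by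
    have h1 : h C s ∈ range e := hU ▸ mem_sUnion.2 ⟨C, C.2, by rw [hCe C]; exact ⟨s, hs, rfl⟩⟩
    obtain ⟨x, hx⟩ := h1
    rw [← hx, hwe x (mem_univ x)]
  refine ⟨𝒞, this, dm, fun C s => w (h C s), fun C => Dmap.comp hw (hh C), fun C s hs t ht hst =>
    hi C hs ht ?_, fun x => ?_⟩
  · rw [← hr C s hs, ← hr C t ht]; exact congrArg e hst
  · obtain ⟨C, hCm, hx⟩ := mem_sUnion.1 (hU.symm ▸ mem_range_self x : e x ∈ ⋃₀ 𝒞)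
    obtain ⟨s, hs, hsx⟩ := (hCe ⟨C, hCm⟩).subset hx
    exact ⟨⟨C, hCm⟩, s, hs, by simp only [hsx, hwe x (mem_univ x)]⟩

theorem Low.preimage_thin {n : ℕ} {S : Set X} (h : Low L n S) {u : (Fin n → ℝ) → X}
    (hu : Dmap L u) {A : Set (Fin n → ℝ)} (hA : Dmap L fun x => x ∈ A) (hi : InjOn u A) :
    Thin {x | x ∈ A ∧ u x ∈ S} := by
  obtain ⟨w, hw, hwu⟩ := hu.exists_leftInvOn hA hi
  exact (h.map hw).thin.mono fun x hx => ⟨u x, hx.2, hwu x hx.1⟩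

end Dimension

section Groups

variable (L : FirstOrder.Language) [L.Structure ℝ]

/-- A group on a definable type with definable operations. -/
class DGrp (Γ : Type) [Group Γ] [Dt L Γ] : Prop where
  mul : Dmap L fun p : Γ × Γ => p.1 * p.2
  inv : Dmap L fun x : Γ => x⁻¹

/-- Finitely many cells of dimension `d` with a complement of smaller dimension. -/
structure TopCells (Γ : Type) [Dt L Γ] (d : ℕ) where
  κ : Type
  fin : Finite κ
  k₀ : κ
  u : κ → (Fin d → ℝ) → Γ
  w : κ → Γ → (Fin d → ℝ)
  hu : ∀ k, Dmap L (u k)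
  hw : ∀ k, Dmap L (w k)
  w_u : ∀ k, ∀ s ∈ Q d, w k (u k s) = s
  low : Low L d (⋃ k, u k '' Q d)ᶜ

attribute [instance] TopCells.fin

/-- A definable `C^r` chart at the identity in which translations are `C^r`. -/
structure LChart (Γ : Type) [Group Γ] [Dt L Γ] (r d : ℕ) where
  u : (Fin d → ℝ) → Γ
  v : Γ → (Fin d → ℝ)
  B : Set (Fin d → ℝ)
  t₀ : Fin d → ℝ
  hu : Dmap L u
  hv : Dmap L v
  hB : Dmap L fun x => x ∈ B
  isOpen : IsOpen B
  mem : t₀ ∈ B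
  u_t₀ : u t₀ = 1
  v_u : ∀ t ∈ B, v (u t) = t
  trans : ∀ x ∈ B, ∀ y ∈ B, (∀ᶠ x' in 𝓝 x, u y * (u x)⁻¹ * u x' ∈ u '' B) ∧
    ContDiffAt ℝ r (fun x' => v (u y * (u x)⁻¹ * u x')) x

variable {L} {Γ X : Type} [Dt L X] [Dt L Γ]

theorem Dmap.mem_image {Y : Type} [Dt L Y] {f : Y → Γ} {S : Set Y} (hf : Dmap L f)
    (hS : Dmap L fun y => y ∈ S) : Dmap L fun x => x ∈ f '' S := by
  simp only [Set.mem_image]; exact .auto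

variable (L Γ) in
theorem exists_topCells [OM L] [Nonempty Γ] : ∃ d, Nonempty (TopCells L Γ d) := by
  classical
  obtain ⟨κ, hκ, dm, u, hu, hi, hc⟩ := exists_cells L Γ
  obtain ⟨x⟩ : Nonempty Γ := inferInstance
  obtain ⟨k, -⟩ := hc x
  have : Nonempty κ := ⟨k⟩
  obtain ⟨k₀, hk₀⟩ := Finite.exists_max dm
  have hcast : ∀ k : κ, dm k = dm k₀ → ∃ u' : (Fin (dm k₀) → ℝ) → Γ, ∃ w' : Γ → (Fin (dm k₀) → ℝ),
      Dmap L u' ∧ Dmap L w' ∧ (∀ s ∈ Q (dm k₀), w' (u' s) = s) ∧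
      u k '' Q (dm k) = u' '' Q (dm k₀) := fun k h => by
    obtain ⟨w, hw, hwu⟩ := (hu k).exists_leftInvOn (dmap_mem_Q L _) (hi k)
    rw [← h]
    exact ⟨u k, w, hu k, hw, hwu, rfl⟩
  choose u' w' hu' hw' hwu' him using fun k : {k // dm k = dm k₀} => hcast k k.2
  refine ⟨dm k₀, ⟨⟨{k // dm k = dm k₀}, inferInstance, ⟨k₀, rfl⟩, u', w', hu', hw', hwu', ?_⟩⟩⟩
  have h1 : Low L (dm k₀) (⋃ k : {k // dm k < dm k₀}, u k '' Q (dm k)) :=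
    .iUnion fun k => .image k.2 _ (hu k)
  refine h1.mono fun x hx => ?_
  obtain ⟨k, hk⟩ := hc x
  rcases (hk₀ k).lt_or_eq with h | h
  · exact mem_iUnion.2 ⟨⟨k, h⟩, hk⟩
  · exact absurd (mem_iUnion.2 ⟨⟨k, h⟩, him ⟨k, h⟩ ▸ hk⟩) hx

theorem TopCells.low_of_thin [OM L] {d : ℕ} (T : TopCells L Γ d) {S : Set Γ}
    (hS : Dmap L fun x => x ∈ S) (h : ∀ k, Thin {t | t ∈ Q d ∧ T.u k t ∈ S}) : Low L d S := by
  have h1 : ∀ k, Low L d (T.u k '' {t | t ∈ Q d ∧ T.u k t ∈ S}) := fun k => by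
    have := T.hu k
    refine ((h k).low ?_ fun t ht => ht.1).map (T.hu k)
    simp only [mem_ofPred_eq]; exact .auto
  refine (T.low.union (.iUnion h1)).mono fun x hx => ?_
  by_cases hc : x ∈ ⋃ k, T.u k '' Q d
  · obtain ⟨k, t, ht, rfl⟩ := mem_iUnion.1 hc
    exact Or.inr (mem_iUnion.2 ⟨k, t, ⟨ht, hx⟩, rfl⟩)
  · exact Or.inl hc

/-- Exchanging the order of two genericity conditions. -/
theorem TopCells.thin_not_low [OM L] {d n : ℕ} (T : TopCells L Γ d) {P : Γ → (Fin n → ℝ) → Prop}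
    (hP : Dmap L fun p : Γ × (Fin n → ℝ) => P p.1 p.2) (h : ∀ a, Thin {x | P a x}) :
    Thin {x | ¬ Low L d {a | P a x}} := by
  have hu := T.hu
  have hd : ∀ k, Dmap L fun x : Fin n → ℝ => Thin {t | t ∈ Q d ∧ P (T.u k t) x} := fun k =>
    Dmap.thin (P := fun x t => t ∈ Q d ∧ P (T.u k t) x)
      (.and .auto (.comp (g := fun p : Γ × (Fin n → ℝ) => P p.1 p.2)
        (f := fun p : (Fin n → ℝ) × (Fin d → ℝ) => (T.u k p.2, p.1)) hP
        (.prodMk (.comp (hu k) .auto) .auto)))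
  refine (thin_forall_fin (L := L) hd fun k => thin_swap (L := L)
    (P := fun t x => t ∈ Q d ∧ P (T.u k t) x) (.and .auto
      (.comp (g := fun p : Γ × (Fin n → ℝ) => P p.1 p.2)
        (f := fun p : (Fin d → ℝ) × (Fin n → ℝ) => (T.u k p.1, p.2)) hP
        (.prodMk (.comp (hu k) .auto) .auto))) ?_).mono ?_
  · have : {t | ¬ Thin {x | t ∈ Q d ∧ P (T.u k t) x}} = ∅ :=
      eq_empty_of_forall_notMem fun t ht => ht ((h (T.u k t)).mono fun x hx => hx.2)
    rw [this]; exact interior_empty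
  · intro x hx hx'
    refine hx (T.low_of_thin ?_ hx')
    simp only [mem_ofPred_eq]
    exact .comp (g := fun p : Γ × (Fin n → ℝ) => P p.1 p.2) (f := fun a => (a, x)) hP .auto

variable [Group Γ] [DGrp L Γ]

@[fun_prop] theorem Dmap.gmul {f g : X → Γ} (hf : Dmap L f) (hg : Dmap L g) :
    Dmap L fun x => f x * g x := Dmap.comp (DGrp.mul (L := L)) (hf.prodMk hg)

@[fun_prop] theorem Dmap.ginv {f : X → Γ} (hf : Dmap L f) :
    Dmap L fun x => (f x)⁻¹ := Dmap.comp (DGrp.inv (L := L)) hf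

variable (L Γ) in
theorem exists_lChart [OM L] (r : ℕ) : ∃ d, Nonempty (TopCells L Γ d) ∧
    Nonempty (LChart L Γ r d) := by
  obtain ⟨d, ⟨T⟩⟩ := exists_topCells L Γ
  refine ⟨d, ⟨T⟩, ?_⟩
  obtain ⟨u, hu, w, hw, hwu⟩ : ∃ u, Dmap L u ∧ ∃ w, Dmap L w ∧ ∀ s ∈ Q d, w (u s) = s :=
    ⟨T.u T.k₀, T.hu _, T.w T.k₀, T.hw _, T.w_u T.k₀⟩
  have hui : InjOn u (Q d) := fun s hs t ht h => by rw [← hwu s hs, h, hwu t ht]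
  have hV := hu.mem_image (dmap_mem_Q L d)
  obtain ⟨V, hVd, hVu⟩ : ∃ V : Set Γ, (Dmap L fun x => x ∈ V) ∧ V = u '' Q d := ⟨_, hV, rfl⟩
  let R : Γ → (Fin d → ℝ) → Prop := fun a x =>
    (∀ᶠ x' in 𝓝 x, a * u x' ∈ V) ∧ ContDiffAt ℝ r (fun x' => w (a * u x')) x
  have hR : Dmap L fun p : Γ × (Fin d → ℝ) => R p.1 p.2 :=
    .and (.eventually_nhds (P := fun (p : Γ × (Fin d → ℝ)) x' => p.1 * u x' ∈ V) .auto .auto)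
      (.contDiffAt r (F := fun (p : Γ × (Fin d → ℝ)) x' => w (p.1 * u x')) .auto .auto)
  obtain ⟨P, hPd, hP⟩ : ∃ P : (Fin d → ℝ) → (Fin d → ℝ) → Prop,
      (Dmap L fun p : (Fin d → ℝ) × (Fin d → ℝ) => P p.1 p.2) ∧
      ∀ x z, P x z = R (u z * (u x)⁻¹) x :=
    ⟨fun x z => R (u z * (u x)⁻¹) x, .comp (g := fun p : Γ × (Fin d → ℝ) => R p.1 p.2)
      (f := fun p : (Fin d → ℝ) × (Fin d → ℝ) => (u p.2 * (u p.1)⁻¹, p.1)) hR .auto,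
      fun _ _ => rfl⟩
  have htr : ∀ x y z, z ∈ Q d → P x z → P z y → P x y := fun x y z hz h1 h2 => by
    rw [hP] at h1 h2 ⊢
    have hc : w (u z * (u x)⁻¹ * u x) = z := by rw [inv_mul_cancel_right, hwu z hz]
    have he : ∀ᶠ x' in 𝓝 x, u y * (u x)⁻¹ * u x' =
        u y * (u z)⁻¹ * u (w (u z * (u x)⁻¹ * u x')) := by
      filter_upwards [h1.1] with x' hx'
      rw [hVu] at hx'
      obtain ⟨s, hs, e⟩ := hx'
      rw [← e, hwu s hs, e]; group
    have ht := h1.2.continuousAt.tendsto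
    rw [hc] at ht
    constructor
    · filter_upwards [he, ht.eventually h2.1] with x' h h'
      rw [h]; exact h'
    · have h3 := h2.2
      rw [← hc] at h3
      refine ContDiffAt.congr_of_eventuallyEq (ContDiffAt.comp x h3 h1.2) ?_
      filter_upwards [he] with x' h
      rw [h]
      simp only [Function.comp_apply, hc]
  have hX : ∀ a, Thin {x | x ∈ Q d ∧ a * u x ∈ V ∧ ¬ R a x} := fun a => by
    have h1 : Dmap L fun x => a * u x ∈ V ∧ ¬ ∀ᶠ x' in 𝓝 x, a * u x' ∈ V :=
      .and .auto (.not (.eventually_nhds (P := fun _ x' => a * u x' ∈ V) (f := fun x => x)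
        .auto .auto))
    have h2 : Dmap L fun x => ¬ ContDiffAt ℝ r (fun x' => w (a * u x')) x :=
      .not (.contDiffAt r (F := fun _ x' => w (a * u x')) (a := fun x => x) .auto .auto)
    refine (thin_union (L := L) h1 h2 ?_ (thin_not_contDiffAt r (by fun_prop))).mono ?_
    · by_contra hn
      obtain ⟨O, hO, hOo, x, hx⟩ := not_thin_iff.1 hn
      exact (hO hx).2 (Filter.mem_of_superset (hOo.mem_nhds hx) fun y hy => (hO hy).1)
    · rintro x ⟨-, hxV, hx⟩
      by_cases h : ∀ᶠ x' in 𝓝 x, a * u x' ∈ V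
      · exact Or.inr fun h' => hx ⟨h, h'⟩
      · exact Or.inl ⟨hxV, h⟩
  have hXd : Dmap L fun p : Γ × (Fin d → ℝ) => p.2 ∈ Q d ∧ p.1 * u p.2 ∈ V ∧ ¬ R p.1 p.2 := by
    have := hR.not
    exact .and .auto (.and .auto this)
  have hd1 : Dmap L fun x => Thin {z | z ∈ Q d ∧ ¬ P x z} :=
    Dmap.thin (P := fun x z => z ∈ Q d ∧ ¬ P x z) (.and .auto hPd.not)
  have hPd' : Dmap L fun p : (Fin d → ℝ) × (Fin d → ℝ) => P p.2 p.1 :=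
    .comp (g := fun p : (Fin d → ℝ) × (Fin d → ℝ) => P p.1 p.2)
      (f := fun p : (Fin d → ℝ) × (Fin d → ℝ) => (p.2, p.1)) hPd .auto
  have hd2 : Dmap L fun x => Thin {z | z ∈ Q d ∧ ¬ P z x} :=
    Dmap.thin (P := fun x z => z ∈ Q d ∧ ¬ P z x) (.and .auto hPd'.not)
  have ht1 : Thin {x | x ∈ Q d ∧ ¬ Thin {z | z ∈ Q d ∧ ¬ P x z}} := by
    refine (T.thin_not_low hXd hX).mono fun x hx hl => hx.2 ?_
    have hi : InjOn (fun z => u z * (u x)⁻¹) (Q d) := fun s hs t ht h => hui hs ht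
      (mul_right_cancel h)
    refine (hl.preimage_thin (u := fun z => u z * (u x)⁻¹) .auto (dmap_mem_Q L d) hi).mono ?_
    rintro z ⟨hz, hPz⟩
    rw [hP] at hPz
    refine ⟨hz, hx.1, ?_, hPz⟩
    rw [inv_mul_cancel_right, hVu]
    exact ⟨z, hz, rfl⟩
  have ht2 : Thin {x | x ∈ Q d ∧ ¬ Thin {z | z ∈ Q d ∧ ¬ P z x}} := by
    have hPn := hPd.not
    refine (thin_swap (L := L) (P := fun z x => z ∈ Q d ∧ x ∈ Q d ∧ ¬ P z x)
      (.and .auto (.and .auto hPn)) (ht1.mono fun z hz => ?_)).mono ?_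
    · by_cases hzQ : z ∈ Q d
      · exact ⟨hzQ, fun h => hz (h.mono fun x hx => hx.2)⟩
      · refine absurd ?_ hz
        exact Thin.mono (T := ∅) interior_empty fun x hx => hzQ hx.1
    · rintro x ⟨hx, hxt⟩ h
      exact hxt (h.mono fun z hz => ⟨hz.1, hx, hz.2⟩)
  obtain ⟨B, hB, hBo, ⟨t₀, ht₀⟩, hBd⟩ : ∃ B : Set (Fin d → ℝ), (∀ x ∈ B, x ∈ Q d ∧
      Thin {z | z ∈ Q d ∧ ¬ P x z} ∧ Thin {z | z ∈ Q d ∧ ¬ P z x}) ∧ IsOpen B ∧ B.Nonempty ∧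
      Dmap L fun x => x ∈ B := by
    have hd : Dmap L fun x => x ∈ Q d ∧
      Thin {z | z ∈ Q d ∧ ¬ P x z} ∧ Thin {z | z ∈ Q d ∧ ¬ P z x} := .and .auto (.and hd1 hd2)
    refine ⟨interior {x | x ∈ Q d ∧ Thin {z | z ∈ Q d ∧ ¬ P x z} ∧
      Thin {z | z ∈ Q d ∧ ¬ P z x}}, fun x hx => by have := interior_subset hx; exact this, isOpen_interior, ?_,
      Dmap.mem_interior hd⟩
    obtain ⟨O, hOQ, hO, ⟨x, hx⟩, h⟩ := Thin.exists_open (L := L)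
      (P := fun x => x ∈ Q d → Thin {z | z ∈ Q d ∧ ¬ P x z} ∧ Thin {z | z ∈ Q d ∧ ¬ P z x})
      (.imp .auto (.and hd1 hd2))
      ((thin_union (L := L) (.and .auto hd1.not) (.and .auto hd2.not) ht1 ht2).mono fun x hx => by
        simp only [mem_ofPred_eq, Classical.not_imp, not_and_or] at hx
        exact hx.2.imp (fun h => ⟨hx.1, h⟩) fun h => ⟨hx.1, h⟩) (isOpen_Q d) (nonempty_Q d)
    exact ⟨x, mem_interior.2 ⟨O, fun y hy => ⟨hOQ hy, h y hy (hOQ hy)⟩, hO, hx⟩⟩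
  have hPB : ∀ x ∈ B, ∀ y ∈ B, P x y := fun x hx y hy => by
    have h1 := (hB x hx).2.1
    have h2 := (hB y hy).2.2
    have hp1 : Dmap L fun z => P x z := .comp (g := fun p : (Fin d → ℝ) × (Fin d → ℝ) => P p.1 p.2)
      (f := fun z => (x, z)) hPd .auto
    have hp2 : Dmap L fun z => P z y := .comp (g := fun p : (Fin d → ℝ) × (Fin d → ℝ) => P p.1 p.2)
      (f := fun z => (z, y)) hPd .auto
    obtain ⟨z, hz, hn⟩ := (thin_union (L := L) (.and .auto hp1.not) (.and .auto hp2.not)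
      h1 h2).exists_notMem (isOpen_Q d) (nonempty_Q d)
    have hn' := not_or.1 hn
    exact htr x y z hz (by_contra fun h => hn'.1 ⟨hz, h⟩) (by_contra fun h => hn'.2 ⟨hz, h⟩)
  refine ⟨⟨fun t => (u t₀)⁻¹ * u t, fun g => w (u t₀ * g), B, t₀, .auto, .auto, hBd, hBo, ht₀,
    inv_mul_cancel _, fun t ht => by simp only [mul_inv_cancel_left, hwu t (hB t ht).1],
    fun x hx y hy => ?_⟩⟩
  have h := hPB x hx y hy
  rw [hP] at h
  have he : ∀ x', (u t₀)⁻¹ * u y * ((u t₀)⁻¹ * u x)⁻¹ * ((u t₀)⁻¹ * u x') =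
    (u t₀)⁻¹ * (u y * (u x)⁻¹ * u x') := fun x' => by group
  simp only [he, mul_inv_cancel_left]
  refine ⟨?_, h.2⟩
  have hc := h.2.continuousAt.tendsto
  rw [inv_mul_cancel_right, hwu y (hB y hy).1] at hc
  filter_upwards [h.1, hc.eventually_mem (hBo.mem_nhds hy)] with x' h1 h2
  refine ⟨_, h2, ?_⟩
  rw [hVu] at h1
  obtain ⟨s, hs, e⟩ := h1
  rw [← e, hwu s hs]

end Groups

section Smoothness

variable {L : FirstOrder.Language} [L.Structure ℝ] {Γ : Type} [Group Γ] [Dt L Γ]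
  {r d : ℕ} (C : LChart L Γ r d)
variable {E F : Type} [NormedAddCommGroup E] [NormedSpace ℝ E] [NormedAddCommGroup F]
  [NormedSpace ℝ F]

namespace LChart

theorem v_one : C.v 1 = C.t₀ := by rw [← C.u_t₀, C.v_u _ C.mem]

theorem u_v {g : Γ} (hg : g ∈ C.u '' C.B) : C.u (C.v g) = g := by
  obtain ⟨t, ht, rfl⟩ := hg
  rw [C.v_u t ht]

theorem v_mem {g : Γ} (hg : g ∈ C.u '' C.B) : C.v g ∈ C.B := by
  obtain ⟨t, ht, rfl⟩ := hg
  rwa [C.v_u t ht]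

/-- `f` is `C^r` at `p` with respect to the left translates of the chart. -/
def Sm (f : E → Γ) (p : E) : Prop :=
  (∀ᶠ x in 𝓝 p, (f p)⁻¹ * f x ∈ C.u '' C.B) ∧ ContDiffAt ℝ r (fun x => C.v ((f p)⁻¹ * f x)) p

variable {C} {f : E → Γ} {p : E}

theorem Sm.exists (hf : C.Sm f p) : ∃ g : E → Fin d → ℝ, ContDiffAt ℝ r g p ∧ g p = C.t₀ ∧
    ∀ᶠ x in 𝓝 p, g x ∈ C.B ∧ f x = f p * C.u (g x) :=
  ⟨_, hf.2, by simp [v_one], hf.1.mono fun x hx => ⟨C.v_mem hx, by rw [C.u_v hx]; group⟩⟩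

theorem sm_of {h : Γ} {g : E → Fin d → ℝ} (hg : ContDiffAt ℝ r g p) (hgp : g p ∈ C.B)
    (hf : ∀ᶠ x in 𝓝 p, f x = h * C.u (g x)) : C.Sm f p := by
  have h0 := hf.self_of_nhds
  obtain ⟨h1, h2⟩ := C.trans _ hgp _ C.mem
  have he : ∀ᶠ x in 𝓝 p, (f p)⁻¹ * f x = C.u C.t₀ * (C.u (g p))⁻¹ * C.u (g x) :=
    hf.mono fun x hx => by rw [h0, hx, C.u_t₀]; group
  constructor
  · filter_upwards [he, hg.continuousAt.tendsto.eventually h1] with x hx hx'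
    rw [hx]; exact hx'
  · refine ContDiffAt.congr_of_eventuallyEq (ContDiffAt.comp p h2 hg) ?_
    filter_upwards [he] with x hx
    rw [hx]; rfl

theorem Sm.base (hf : C.Sm f p) {h : Γ} (hU : h⁻¹ * f p ∈ C.u '' C.B) :
    (∀ᶠ x in 𝓝 p, h⁻¹ * f x ∈ C.u '' C.B) ∧ ContDiffAt ℝ r (fun x => C.v (h⁻¹ * f x)) p := by
  obtain ⟨g, hg, hgp, he⟩ := hf.exists
  obtain ⟨y, hy, hyu⟩ := hU
  have he' : ∀ᶠ x in 𝓝 p, h⁻¹ * f x = C.u y * (C.u C.t₀)⁻¹ * C.u (g x) :=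
    he.mono fun x hx => by rw [hx.2, hyu, C.u_t₀]; group
  obtain ⟨h1, h2⟩ := C.trans _ C.mem _ hy
  rw [← hgp] at h1 h2
  constructor
  · filter_upwards [he', hg.continuousAt.tendsto.eventually h1] with x hx hx'
    rw [hx, ← hgp]; exact hx'
  · refine ContDiffAt.congr_of_eventuallyEq (ContDiffAt.comp p h2 hg) ?_
    filter_upwards [he'] with x hx
    rw [hx, ← hgp]; rfl

/-- The coordinate form of smoothness at a point mapped into the chart. -/
theorem Sm.exists_of_mem (hf : C.Sm f p) {h : Γ} {y : Fin d → ℝ} (hy : y ∈ C.B)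
    (hU : f p = h * C.u y) : ∃ g : E → Fin d → ℝ, ContDiffAt ℝ r g p ∧ g p = y ∧
    ∀ᶠ x in 𝓝 p, g x ∈ C.B ∧ f x = h * C.u (g x) := by
  have h0 : h⁻¹ * f p = C.u y := by rw [hU]; group
  obtain ⟨h1, h2⟩ := hf.base (h := h) (h0 ▸ ⟨y, hy, rfl⟩)
  exact ⟨_, h2, by simp only [h0, C.v_u y hy], h1.mono fun x hx =>
    ⟨C.v_mem hx, by rw [C.u_v hx]; group⟩⟩

theorem Sm.congr {f' : E → Γ} (hf : C.Sm f p) (h : f' =ᶠ[𝓝 p] f) : C.Sm f' p := by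
  obtain ⟨g, hg, hgp, he⟩ := hf.exists
  refine sm_of (h := f p) hg (hgp ▸ C.mem) ?_
  filter_upwards [he, h] with x hx hx'
  rw [hx', hx.2]

theorem Sm.comp {φ : F → E} {q : F} (hf : C.Sm f (φ q)) (hφ : ContDiffAt ℝ r φ q) :
    C.Sm (fun x => f (φ x)) q := by
  obtain ⟨g, hg, hgp, he⟩ := hf.exists
  refine sm_of (h := f (φ q)) (ContDiffAt.comp q hg hφ) (by simp [hgp, C.mem]) ?_
  filter_upwards [hφ.continuousAt.tendsto.eventually he] with x hx
  exact hx.2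

theorem Sm.mul_left (hf : C.Sm f p) (a : Γ) : C.Sm (fun x => a * f x) p := by
  obtain ⟨g, hg, hgp, he⟩ := hf.exists
  refine sm_of (h := a * f p) hg (hgp ▸ C.mem) ?_
  filter_upwards [he] with x hx
  rw [hx.2, mul_assoc]

theorem sm_u {t : Fin d → ℝ} (ht : t ∈ C.B) : C.Sm C.u t :=
  sm_of (h := 1) (g := id) contDiffAt_id ht (by simp)

theorem Sm.of_chain {ψ : Γ → Γ} (hf : C.Sm f p) (hψ : C.Sm (fun t => ψ (f p * C.u t)) C.t₀) :
    C.Sm (fun x => ψ (f x)) p := by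
  obtain ⟨g, hg, hgp, he⟩ := hf.exists
  rw [← hgp] at hψ
  exact (hψ.comp hg).congr (he.mono fun x hx => congrArg ψ hx.2)

theorem Sm.contDiffAt {ψ : Γ → F} (hf : C.Sm f p)
    (hψ : ContDiffAt ℝ r (fun t => ψ (f p * C.u t)) C.t₀) : ContDiffAt ℝ r (fun x => ψ (f x)) p := by
  obtain ⟨g, hg, hgp, he⟩ := hf.exists
  rw [← hgp] at hψ
  exact (ContDiffAt.comp p hψ hg).congr_of_eventuallyEq (he.mono fun x hx => congrArg ψ hx.2)

variable [OM L] [DGrp L Γ] {X : Type} [Dt L X]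

theorem _root_.Paper.Dmap.sm {n : ℕ} {f : X → (Fin n → ℝ) → Γ} {a : X → Fin n → ℝ}
    (hf : Dmap L fun p : X × (Fin n → ℝ) => f p.1 p.2) (ha : Dmap L a) :
    Dmap L fun x => C.Sm (f x) (a x) := by
  have hfa : Dmap L fun x => f x (a x) :=
    .comp (g := fun p : X × (Fin n → ℝ) => f p.1 p.2) (f := fun x => (x, a x)) hf .auto
  have hU := C.hu.mem_image C.hB
  obtain ⟨U, hU, hUe⟩ : ∃ U : Set Γ, (Dmap L fun x => x ∈ U) ∧ U = C.u '' C.B := ⟨_, hU, rfl⟩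
  have hm : Dmap L fun p : X × (Fin n → ℝ) => (f p.1 (a p.1))⁻¹ * f p.1 p.2 :=
    .gmul (.ginv (.comp (g := fun x => f x (a x)) hfa .auto)) hf
  unfold Sm
  rw [← hUe]
  exact .and (.eventually_nhds (P := fun x y => (f x (a x))⁻¹ * f x y ∈ U)
    (.comp (g := fun x => x ∈ U) hU hm) ha) (.contDiffAt r
      (F := fun x y => C.v ((f x (a x))⁻¹ * f x y)) (.comp C.hv hm) ha)

variable (C) in
theorem exists_sm (T : TopCells L Γ d) {n : ℕ} {f : (Fin n → ℝ) → Γ} (hf : Dmap L f)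
    {O : Set (Fin n → ℝ)} (hO : IsOpen O) (hne : O.Nonempty) (hOd : Dmap L fun x => x ∈ O) :
    ∃ x ∈ O, C.Sm f x := by
  obtain ⟨U, hU, hUe⟩ : ∃ U : Set Γ, (Dmap L fun x => x ∈ U) ∧ U = C.u '' C.B :=
    ⟨_, C.hu.mem_image C.hB, rfl⟩
  have hu := C.hu
  have hv := C.hv
  by_cases h : ∀ a : Γ, Thin {x | x ∈ O ∧ a⁻¹ * f x ∈ U}
  · exfalso
    obtain ⟨x, hx, hxt⟩ := (T.thin_not_low (P := fun a x => x ∈ O ∧ a⁻¹ * f x ∈ U)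
      .auto h).exists_notMem hO hne
    have hl : Low L d {a | x ∈ O ∧ a⁻¹ * f x ∈ U} := by_contra hxt
    have hi : InjOn (fun t => f x * (C.u t)⁻¹) C.B := fun s hs t ht e => by
      have := inv_injective (mul_left_cancel e)
      rw [← C.v_u s hs, this, C.v_u t ht]
    have := hl.preimage_thin (u := fun t => f x * (C.u t)⁻¹) .auto C.hB hi
    refine not_thin_iff.2 ⟨C.B, fun t ht => ?_, C.isOpen, ⟨C.t₀, C.mem⟩⟩ this
    have h1 : (f x * (C.u t)⁻¹)⁻¹ * f x ∈ U := by
      rw [hUe]; exact ⟨t, ht, by group⟩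
    exact ⟨ht, hx, h1⟩
  · obtain ⟨a, ha⟩ := not_forall.1 h
    obtain ⟨V, hV, hVo, hVne⟩ := not_thin_iff.1 ha
    obtain ⟨x, hx, hxc⟩ := (thin_not_contDiffAt (L := L) r
      (f := fun x => C.v (a⁻¹ * f x)) .auto).exists_notMem hVo hVne
    refine ⟨x, (hV hx).1, sm_of (h := a) (not_not.1 hxc) (C.v_mem (hUe ▸ (hV hx).2)) ?_⟩
    filter_upwards [hVo.mem_nhds hx] with y hy
    rw [C.u_v (hUe ▸ (hV hy).2)]; group

/-- Near a point of the chart, the chart is a translate of itself near any other point. -/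
theorem exists_shift {x y : Fin d → ℝ} (hx : x ∈ C.B) (hy : y ∈ C.B) :
    ∃ σ : (Fin d → ℝ) → (Fin d → ℝ), ContDiffAt ℝ r σ x ∧ σ x = y ∧
      ∀ᶠ t in 𝓝 x, C.u t = C.u x * (C.u y)⁻¹ * C.u (σ t) := by
  obtain ⟨g, hg, hgx, he⟩ := ((sm_u hx).mul_left (C.u y * (C.u x)⁻¹)).exists_of_mem
    (h := 1) hy (by group)
  refine ⟨g, hg, hgx, he.mono fun t ht => ?_⟩
  have := ht.2
  rw [one_mul] at this
  rw [← this]; group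

theorem Sm.mul_right (T : TopCells L Γ d) (hf : C.Sm f p) (q : Γ) : C.Sm (fun x => f x * q) p := by
  have hu := C.hu
  obtain ⟨t₁, ht₁, h1⟩ := C.exists_sm T (f := fun t => C.u t * q) .auto C.isOpen ⟨_, C.mem⟩ C.hB
  refine hf.of_chain (ψ := fun x => x * q) ?_
  obtain ⟨σ, hσ, hσx, he⟩ := exists_shift C.mem ht₁
  rw [← hσx] at h1
  refine ((h1.comp hσ).mul_left (f p * (C.u C.t₀ * (C.u t₁)⁻¹))).congr (he.mono fun t ht => ?_)
  simp only
  rw [ht]; group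

theorem Sm.mul (T : TopCells L Γ d) {f' : E → Γ} (hf : C.Sm f p) (hf' : C.Sm f' p) :
    C.Sm (fun x => f x * f' x) p := by
  have hu := C.hu
  let α : (Fin (d + d) → ℝ) → (Fin d → ℝ) := fun z i => z (Fin.castAdd d i)
  let β : (Fin (d + d) → ℝ) → (Fin d → ℝ) := fun z i => z (Fin.natAdd d i)
  have hα : Dmap L α := .auto
  have hβ : Dmap L β := .auto
  have hB := C.hB
  have hαc : Continuous α := by fun_prop
  have hβc : Continuous β := by fun_prop
  have happ : ∀ a b : Fin d → ℝ, α (Fin.append a b) = a ∧ β (Fin.append a b) = b := fun a b =>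
    ⟨funext fun i => Fin.append_left a b i, funext fun i => Fin.append_right a b i⟩
  have hcd : ∀ {s t : E → Fin d → ℝ}, ContDiffAt ℝ r s p → ContDiffAt ℝ r t p →
      ContDiffAt ℝ r (fun x => Fin.append (s x) (t x)) p := fun {s t} hs ht =>
    contDiffAt_pi.2 fun i => Fin.addCases
      (fun i => by simpa only [Fin.append_left] using contDiffAt_pi.1 hs i)
      (fun i => by simpa only [Fin.append_right] using contDiffAt_pi.1 ht i) i
  obtain ⟨z, ⟨hzα, hzβ⟩, hz⟩ := C.exists_sm T (f := fun z => C.u (α z) * C.u (β z)) .auto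
    (O := {z | α z ∈ C.B ∧ β z ∈ C.B}) ((C.isOpen.preimage hαc).inter (C.isOpen.preimage hβc))
    ⟨Fin.append C.t₀ C.t₀, by simp [happ, C.mem]⟩ (by simp only [mem_ofPred_eq]; exact .auto)
  set b := f' p * (C.u (β z))⁻¹ with hb
  set a := C.u (α z) * b⁻¹ * (f p)⁻¹ with ha
  obtain ⟨σ, hσ, hσp, hσe⟩ := ((hf.mul_right T b).mul_left a).exists_of_mem
    (h := 1) hzα (by rw [ha]; group)
  obtain ⟨τ, hτ, hτp, hτe⟩ := (hf'.mul_left b⁻¹).exists_of_mem (h := 1) hzβ (by rw [hb]; group)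
  have hap : Fin.append (σ p) (τ p) = z := by
    rw [hσp, hτp]
    exact funext fun i => Fin.addCases (fun i => Fin.append_left _ _ i)
      (fun i => Fin.append_right _ _ i) i
  rw [← hap] at hz
  refine ((hz.comp (φ := fun x => Fin.append (σ x) (τ x)) (hcd hσ hτ)).mul_left a⁻¹).congr ?_
  filter_upwards [hσe, hτe] with x h1 h2
  have h1 := h1.2
  have h2 := h2.2
  rw [one_mul] at h1 h2
  simp only [happ, ← h1, ← h2]; group

theorem Sm.inv (T : TopCells L Γ d) (hf : C.Sm f p) : C.Sm (fun x => (f x)⁻¹) p := by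
  have hu := C.hu
  obtain ⟨t₁, ht₁, h1⟩ := C.exists_sm T (f := fun t => (C.u t)⁻¹) .auto C.isOpen ⟨_, C.mem⟩ C.hB
  obtain ⟨g, hg, hgp, he⟩ := (hf.mul_left (C.u t₁ * (f p)⁻¹)).exists_of_mem (h := 1) ht₁ (by group)
  rw [← hgp] at h1
  refine ((h1.comp hg).mul_right T (C.u t₁ * (f p)⁻¹)).congr (he.mono fun t ht => ?_)
  have := ht.2
  rw [one_mul] at this
  simp only [← this]; group

end LChart
end Smoothness

section Charts

variable {L : FirstOrder.Language} [L.Structure ℝ] {X Y : Type} [Dt L X] [Dt L Y]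

theorem Low.weaken {a b : ℕ} {S : Set X} (h : Low L a S) (hab : a ≤ b) : Low L b S := by
  induction h with
  | image hj f hf => exact .image (hj.trans_le hab) f hf
  | empty => exact .empty
  | union _ _ h h' => exact h.union h'
  | mono _ h ih => exact ih.mono h

theorem Low.prod {a b : ℕ} {S : Set X} {T : Set Y} (hS : Low L (a + 1) S) (hT : Low L (b + 1) T) :
    Low L (a + b + 1) (S ×ˢ T) := by
  induction hS with
  | empty => rw [empty_prod]; exact .empty
  | union _ _ h h' => rw [union_prod]; exact h.union h'
  | mono _ h ih => exact ih.mono (prod_mono h Subset.rfl)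
  | @image j hj f hf =>
    induction hT with
    | empty => rw [prod_empty]; exact .empty
    | union _ _ h h' => rw [prod_union]; exact h.union h'
    | mono _ h ih => exact ih.mono (prod_mono Subset.rfl h)
    | @image k hk g hg =>
      refine (Low.image (X := X × Y) (j := j + k) (by omega)
        (fun z => (f fun i => z (Fin.castAdd k i), g fun i => z (Fin.natAdd j i))) .auto).mono ?_
      rintro ⟨_, _⟩ ⟨⟨s, hs, rfl⟩, ⟨t, ht, rfl⟩⟩
      have h : ∀ i, 0 < Fin.append s t i ∧ Fin.append s t i < 1 :=
        Fin.addCases (fun i => by rw [Fin.append_left]; exact hs i)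
          (fun i => by rw [Fin.append_right]; exact ht i)
      exact ⟨Fin.append s t, h, by simp only [Fin.append_left, Fin.append_right]⟩

theorem Low.pow [OM L] {e : ℕ} {Z : Set X} (hZ : Low L (e + 1) Z) (m : ℕ) :
    Low L (m * e + 1) {z : Fin m → X | ∀ i, z i ∈ Z} := by
  induction m with
  | zero =>
    exact (Low.image (j := 0) (by simp) (fun _ => Fin.elim0 : (Fin 0 → ℝ) → Fin 0 → X)
      (.pi fun k => k.elim0)).mono fun z _ =>
        ⟨Fin.elim0, fun i => i.elim0, funext fun i => i.elim0⟩
  | succ m ih =>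
    have h1 := (ih.prod hZ).map (f := fun p : (Fin m → X) × X => (Fin.snoc p.1 p.2 : Fin (m + 1) → X))
      (.pi fun k => Fin.lastCases (by simp only [Fin.snoc_last]; exact .auto)
        (fun k => by simp only [Fin.snoc_castSucc]; exact .auto) k)
    refine Low.weaken (h1.mono fun z (hz : ∀ i, z i ∈ Z) => ⟨(Fin.init z, z (Fin.last m)),
      ⟨fun i => hz i.castSucc, hz (Fin.last m)⟩, Fin.snoc_init_self z⟩) (by rw [Nat.succ_mul])

theorem TopCells.low_univ [OM L] {d : ℕ} (T : TopCells L X d) : Low L (d + 1) (univ : Set X) := by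
  refine ((T.low.weaken d.le_succ).union (.iUnion fun k => .image d.lt_succ_self _ (T.hu k))).mono
    fun x _ => ?_
  exact (Classical.em (x ∈ ⋃ k, T.u k '' Q d)).symm

variable {Γ : Type} [Group Γ] [Dt L Γ] {r d : ℕ}

/-- Finitely many translates of the complement of a small set cover the group. -/
theorem LChart.exists_translates [OM L] [DGrp L Γ] (C : LChart L Γ r d) (T : TopCells L Γ d)
    {Z : Set Γ} (hZ : Low L d Z) : ∃ (m : ℕ) (g : Fin m → Γ), ∀ x, ∃ i, (g i)⁻¹ * x ∉ Z := by
  cases d with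
  | zero =>
    rw [hZ.of_low_zero]
    exact ⟨1, fun _ => 1, fun x => ⟨0, notMem_empty _⟩⟩
  | succ e =>
    by_contra! hcon
    specialize hcon (e + 2)
    have hv := C.hv
    let σ := finProdFinEquiv (m := e + 2) (n := e + 1)
    have h1 := (T.low_univ.prod (hZ.pow (e + 2))).map
      (f := fun p : Γ × (Fin (e + 2) → Γ) => fun k : Fin ((e + 2) * (e + 1)) =>
        C.v (p.1 * (p.2 (σ.symm k).1)⁻¹) (σ.symm k).2) .auto
    have h2 := (h1.weaken (b := (e + 2) * (e + 1)) (by ring_nf; omega)).thin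
    refine not_thin_iff.2 ⟨{y | ∀ i, (fun j => y (σ (i, j))) ∈ C.B}, ?_, ?_,
      fun k => C.t₀ (σ.symm k).2, by simp [C.mem]⟩ h2
    · intro y hy
      obtain ⟨x, hx⟩ := hcon fun i => C.u fun j => y (σ (i, j))
      refine ⟨(x, fun i => (C.u fun j => y (σ (i, j)))⁻¹ * x), ⟨mem_univ _, hx⟩, ?_⟩
      funext k
      have : x * ((C.u fun j => y (σ ((σ.symm k).1, j)))⁻¹ * x)⁻¹ =
        C.u fun j => y (σ ((σ.symm k).1, j)) := by group
      simp only [this, C.v_u _ (hy _), Prod.mk.eta, Equiv.apply_symm_apply]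
    · simp only [ofPred_forall]
      exact isOpen_iInter_of_finite fun i => C.isOpen.preimage (by fun_prop)

/-- A cube chart compatible with the smooth structure. -/
structure LChart.CubeChart (C : LChart L Γ r d) where
  c : (Fin d → ℝ) → Γ
  w : Γ → (Fin d → ℝ)
  hc : Dmap L c
  hw : Dmap L w
  w_c : ∀ s ∈ Q d, w (c s) = s
  sm : ∀ s ∈ Q d, C.Sm c s
  nhds : ∀ s ∈ Q d, ∀ᶠ t in 𝓝 C.t₀, c s * C.u t ∈ c '' Q d
  smooth : ∀ s ∈ Q d, ContDiffAt ℝ r (fun t => w (c s * C.u t)) C.t₀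

variable {C : LChart L Γ r d}

/-- The left translate of a cube chart. -/
def LChart.CubeChart.translate [DGrp L Γ] (A : C.CubeChart) (g : Γ) : C.CubeChart where
  c s := g * A.c s
  w x := A.w (g⁻¹ * x)
  hc := by have := A.hc; exact .auto
  hw := by have := A.hw; exact .auto
  w_c s hs := by simp only [inv_mul_cancel_left]; exact A.w_c s hs
  sm s hs := (A.sm s hs).mul_left g
  nhds s hs := (A.nhds s hs).mono fun t ⟨s', hs', e⟩ => ⟨s', hs', by simp only [e, mul_assoc]⟩
  smooth s hs := by simpa only [mul_assoc, inv_mul_cancel_left] using A.smooth s hs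

variable [OM L] [DGrp L Γ]

theorem LChart.thin_not_good (C : LChart L Γ r d) (T : TopCells L Γ d) {c : (Fin d → ℝ) → Γ}
    {w : Γ → (Fin d → ℝ)} (hc : Dmap L c) (hw : Dmap L w) (hwc : ∀ s ∈ Q d, w (c s) = s) :
    Thin {s | s ∈ Q d ∧ ¬ ((∀ᶠ t in 𝓝 C.t₀, c s * C.u t ∈ c '' Q d) ∧
      ContDiffAt ℝ r (fun t => w (c s * C.u t)) C.t₀)} := by
  have hci : InjOn c (Q d) := fun s hs t ht h => by rw [← hwc s hs, h, hwc t ht]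
  obtain ⟨V, hV, hVe⟩ : ∃ V : Set Γ, (Dmap L fun x => x ∈ V) ∧ V = c '' Q d :=
    ⟨_, hc.mem_image (dmap_mem_Q L d), rfl⟩
  have hu := C.hu
  let R : Γ → (Fin d → ℝ) → Prop := fun a t =>
    (∀ᶠ t' in 𝓝 t, a * C.u t' ∈ V) ∧ ContDiffAt ℝ r (fun t' => w (a * C.u t')) t
  have hR : Dmap L fun p : Γ × (Fin d → ℝ) => R p.1 p.2 :=
    .and (.eventually_nhds (P := fun (p : Γ × (Fin d → ℝ)) x' => p.1 * C.u x' ∈ V) .auto .auto)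
      (.contDiffAt r (F := fun (p : Γ × (Fin d → ℝ)) x' => w (p.1 * C.u x')) .auto .auto)
  have hX : ∀ a, Thin {x | a * C.u x ∈ V ∧ ¬ R a x} := fun a => by
    have h1 : Dmap L fun x => a * C.u x ∈ V ∧ ¬ ∀ᶠ x' in 𝓝 x, a * C.u x' ∈ V :=
      .and .auto (.not (.eventually_nhds (P := fun _ x' => a * C.u x' ∈ V) (f := fun x => x)
        .auto .auto))
    have h2 : Dmap L fun x => ¬ ContDiffAt ℝ r (fun x' => w (a * C.u x')) x :=
      .not (.contDiffAt r (F := fun _ x' => w (a * C.u x')) (a := fun x => x) .auto .auto)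
    refine (thin_union (L := L) h1 h2 ?_ (thin_not_contDiffAt r (by fun_prop))).mono ?_
    · by_contra hn
      obtain ⟨O, hO, hOo, x, hx⟩ := not_thin_iff.1 hn
      exact (hO hx).2 (Filter.mem_of_superset (hOo.mem_nhds hx) fun y hy => (hO hy).1)
    · rintro x ⟨hxV, hx⟩
      by_cases h : ∀ᶠ x' in 𝓝 x, a * C.u x' ∈ V
      · exact Or.inr fun h' => hx ⟨h, h'⟩
      · exact Or.inl ⟨hxV, h⟩
  have hXd : Dmap L fun p : Γ × (Fin d → ℝ) => p.1 * C.u p.2 ∈ V ∧ ¬ R p.1 p.2 := by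
    have := hR.not
    exact .and .auto this
  obtain ⟨t, ht, hlow⟩ := (T.thin_not_low hXd hX).exists_notMem C.isOpen ⟨_, C.mem⟩
  have hlow : Low L d {a | a * C.u t ∈ V ∧ ¬ R a t} := by_contra hlow
  refine (hlow.preimage_thin (u := fun s => c s * (C.u t)⁻¹) .auto (dmap_mem_Q L d)
    fun s hs s' hs' h => hci hs hs' (mul_right_cancel h)).mono fun s hs => ⟨hs.1, ?_, ?_⟩
  · rw [inv_mul_cancel_right, hVe]; exact ⟨s, hs.1, rfl⟩
  · intro h
    refine hs.2 ?_
    obtain ⟨σ, hσ, hσt, he⟩ := LChart.exists_shift C.mem ht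
    have he' : ∀ᶠ t' in 𝓝 C.t₀, c s * C.u t' = c s * (C.u t)⁻¹ * C.u (σ t') :=
      he.mono fun t' h => by rw [h, C.u_t₀]; group
    rw [← hVe]
    rw [← hσt] at h
    constructor
    · filter_upwards [he', hσ.continuousAt.tendsto.eventually h.1] with t' h1 h2
      rw [h1, ← hσt]; exact h2
    · refine (ContDiffAt.comp C.t₀ h.2 hσ).congr_of_eventuallyEq ?_
      filter_upwards [he'] with t' h1
      rw [h1, ← hσt]; rfl

theorem LChart.exists_cubeCharts_low (C : LChart L Γ r d) (T : TopCells L Γ d) :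
    ∃ (κ : Type) (_ : Finite κ) (A : κ → C.CubeChart), Low L d (⋃ k, (A k).c '' Q d)ᶜ := by
  let G : T.κ → (Fin d → ℝ) → Prop := fun k s => C.Sm (T.u k) s ∧
    (∀ᶠ t in 𝓝 C.t₀, T.u k s * C.u t ∈ T.u k '' Q d) ∧
      ContDiffAt ℝ r (fun t => T.w k (T.u k s * C.u t)) C.t₀
  have hG : ∀ k, Dmap L (G k) := fun k => by
    have := T.hu k
    have := T.hw k
    have hu := C.hu
    obtain ⟨V, hV, hVe⟩ : ∃ V : Set Γ, (Dmap L fun x => x ∈ V) ∧ V = T.u k '' Q d :=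
      ⟨_, (T.hu k).mem_image (dmap_mem_Q L d), rfl⟩
    simp only [G, ← hVe]
    exact .and (.sm (f := fun _ => T.u k) (a := fun x => x) .auto .auto)
      (.and (.eventually_nhds (P := fun s t => T.u k s * C.u t ∈ V) .auto .auto)
      (.contDiffAt r (F := fun s t => T.w k (T.u k s * C.u t)) .auto .auto))
  let O : T.κ → Set (Fin d → ℝ) := fun k => interior {s | s ∈ Q d ∧ G k s}
  have hO : ∀ k, Dmap L fun s => s ∈ O k := fun k => Dmap.mem_interior (.and .auto (hG k))
  have hOt : ∀ k, Thin {s | s ∈ Q d ∧ s ∉ O k} := fun k => by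
    have h1 : Thin {s | ¬ (s ∈ Q d → G k s)} := by
      have hd : Dmap L fun s => C.Sm (T.u k) s :=
        .sm (f := fun _ => T.u k) (a := fun x => x) (by have := T.hu k; exact .auto) .auto
      have h3 : Thin {s | ¬ C.Sm (T.u k) s} := by
        by_contra hn
        obtain ⟨W, hW, hWo, hWne⟩ := not_thin_iff.1 hn
        obtain ⟨B, hBo, hBne, hBd, hB⟩ := exists_definable_basis L d
        obtain ⟨i, hi⟩ := hB W hWo hWne
        obtain ⟨s, hs, hs'⟩ := C.exists_sm T (T.hu k) (hBo i) (hBne i) (hBd i)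
        exact hW (hi hs) hs'
      have hd2 : Dmap L fun s => s ∈ Q d ∧ ¬ ((∀ᶠ t in 𝓝 C.t₀, T.u k s * C.u t ∈ T.u k '' Q d) ∧
          ContDiffAt ℝ r (fun t => T.w k (T.u k s * C.u t)) C.t₀) := by
        have := T.hu k
        have := T.hw k
        have hu := C.hu
        obtain ⟨V, hV, hVe⟩ : ∃ V : Set Γ, (Dmap L fun x => x ∈ V) ∧ V = T.u k '' Q d :=
          ⟨_, (T.hu k).mem_image (dmap_mem_Q L d), rfl⟩
        rw [← hVe]
        exact .and .auto (.not (.and (.eventually_nhds (P := fun s t => T.u k s * C.u t ∈ V)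
          .auto .auto) (.contDiffAt r (F := fun s t => T.w k (T.u k s * C.u t)) .auto .auto)))
      refine (thin_union (L := L) hd.not hd2 h3
        (C.thin_not_good T (T.hu k) (T.hw k) (T.w_u k))).mono fun s hs => ?_
      simp only [mem_ofPred_eq, Classical.not_imp] at hs
      by_cases h : C.Sm (T.u k) s
      · exact Or.inr ⟨hs.1, fun h' => hs.2 ⟨h, h'⟩⟩
      · exact Or.inl h
    have h2 := h1.not_eventually (.imp .auto (hG k))
    refine h2.mono fun s hs hev => hs.2 (mem_interior_iff_mem_nhds.2 ?_)
    filter_upwards [hev, (isOpen_Q d).mem_nhds hs.1] with s' h h' using ⟨h', h h'⟩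
  have hOQ : ∀ k, ∀ s ∈ O k, s ∈ Q d ∧ G k s := fun k s hs => by
    have := interior_subset hs
    exact this
  choose 𝒞 hfin hU hC using fun k => cellular L r d (O k) (fun s hs => (hOQ k s hs).1) (hO k)
  have := fun k => (hfin k).to_subtype
  have hch : ∀ k, ∀ D ∈ 𝒞 k, IsTop L r D → ∃ A : C.CubeChart, T.u k '' D = A.c '' Q d := by
    intro k D hD hT
    obtain ⟨h, w, hh, hw, ho, rfl, h1, h2⟩ := hT
    have hDO : h '' Q d ⊆ O k := hU k ▸ subset_sUnion_of_mem hD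
    have hhs : ∀ s ∈ Q d, h s ∈ Q d ∧ G k (h s) := fun s hs => hOQ k _ (hDO ⟨s, hs, rfl⟩)
    have hwk : ∀ s ∈ Q d, T.w k (T.u k (h s)) = h s := fun s hs => T.w_u k _ (hhs s hs).1
    have hlim : ∀ s ∈ Q d, T.w k (T.u k (h s) * C.u C.t₀) = h s := fun s hs => by
      rw [C.u_t₀, mul_one, hwk s hs]
    refine ⟨⟨fun s => T.u k (h s), fun x => w (T.w k x), .comp (T.hu k) hh, .comp hw (T.hw k),
      fun s hs => by simp only [hwk s hs, (h1 s hs).2], fun s hs => (hhs s hs).2.1.comp (h1 s hs).1,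
      fun s hs => ?_, fun s hs => ?_⟩, image_image _ _ _⟩
    · have hcont := (hhs s hs).2.2.2.continuousAt.tendsto
      rw [hlim s hs] at hcont
      filter_upwards [(hhs s hs).2.2.1, hcont.eventually_mem (ho.mem_nhds ⟨s, hs, rfl⟩)]
        with t ht ⟨s', hs', e⟩
      obtain ⟨q, hq, e'⟩ := ht
      rw [← e', T.w_u k q hq] at e
      exact ⟨s', hs', by simp only [e, e']⟩
    · have h3 := h2 (h s) ⟨s, hs, rfl⟩
      rw [← hlim s hs] at h3
      exact ContDiffAt.comp C.t₀ h3 (hhs s hs).2.2.2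
  choose A hA using hch
  refine ⟨Σ k, {D : 𝒞 k // IsTop L r D.1}, inferInstance, fun i => A i.1 i.2.1 i.2.1.2 i.2.2, ?_⟩
  have hl1 : ∀ k, Low L d (T.u k '' {s | s ∈ Q d ∧ s ∉ O k}) := fun k => by
    refine ((hOt k).low ?_ fun s hs => hs.1).map (T.hu k)
    have := hO k
    simp only [mem_ofPred_eq]; exact .auto
  have hl2 : ∀ i : Σ k, {D : 𝒞 k // IsLow L D.1}, Low L d (T.u i.1 '' i.2.1.1) := fun i => by
    obtain ⟨k, D, j, hj, h, hh, -, e⟩ := i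
    simp only [e]
    exact (Low.image hj h hh).map (T.hu k)
  refine (T.low.union ((Low.iUnion hl1).union (.iUnion hl2))).mono fun x hx => ?_
  by_cases hxT : x ∈ ⋃ k, T.u k '' Q d
  · right
    obtain ⟨k, s, hs, rfl⟩ := mem_iUnion.1 hxT
    by_cases hsO : s ∈ O k
    · rw [← hU k] at hsO
      obtain ⟨D, hD, hsD⟩ := hsO
      rcases hC k D hD with h | h
      · refine absurd (mem_iUnion.2 ⟨⟨k, ⟨D, hD⟩, h⟩, ?_⟩) hx
        rw [← hA]; exact ⟨s, hsD, rfl⟩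
      · exact Or.inr (mem_iUnion.2 ⟨⟨k, ⟨D, hD⟩, h⟩, s, hsD, rfl⟩)
    · exact Or.inl (mem_iUnion.2 ⟨k, s, ⟨hs, hsO⟩, rfl⟩)
  · exact Or.inl hxT

/-- A definable group is covered by finitely many compatible cube charts. -/
theorem LChart.exists_cubeCharts (C : LChart L Γ r d) (T : TopCells L Γ d) :
    ∃ (q : ℕ) (A : Fin q → C.CubeChart), ∀ x, ∃ k, x ∈ (A k).c '' Q d := by
  obtain ⟨κ, hκ, A, hA⟩ := C.exists_cubeCharts_low T
  obtain ⟨m, g, hg⟩ := C.exists_translates T hA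
  obtain ⟨q, ⟨e⟩⟩ := Finite.exists_equiv_fin (κ × Fin m)
  refine ⟨q, fun l => (A (e.symm l).1).translate (g (e.symm l).2), fun x => ?_⟩
  obtain ⟨i, hi⟩ := hg x
  obtain ⟨k, s, hs, h⟩ := mem_iUnion.1 (not_not.1 hi)
  refine ⟨e (k, i), s, hs, ?_⟩
  simp only [Equiv.symm_apply_apply]
  show g i * (A k).c s = x
  rw [h, mul_inv_cancel_left]

end Charts

section Flat

variable {L : FirstOrder.Language} [L.Structure ℝ] [OM L]

theorem eventually_differentiableAt {g : ℝ → ℝ} (hg : Dmap L g) :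
    ∀ᶠ t in 𝓝[>] 0, DifferentiableAt ℝ g t := by
  have hd : Dmap L fun t => DifferentiableAt ℝ g t := by
    have : Dmap L fun t => ∃ y : ℝ, HasDerivAt g y t := by
      have : Dmap L fun p : ℝ × ℝ => HasDerivAt g p.2 p.1 :=
        .hasDerivAt (F := fun _ => g) (a := fun p : ℝ × ℝ => p.1) .auto .auto .auto
      exact .auto
    refine (congrArg (Dmap L) (funext fun t => propext ?_)).mp this
    exact ⟨fun ⟨y, h⟩ => h.differentiableAt, fun h => ⟨_, h.hasDerivAt⟩⟩
  refine (eventually_or_eventually_not hd 0).resolve_right fun h => ?_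
  obtain ⟨b, hb, h⟩ := mem_nhdsGT_iff_exists_Ioo_subset.1 h
  obtain ⟨t, ht, h'⟩ := exists_differentiableAt hg (show (0 : ℝ) < b from hb)
  exact h ht h'

theorem not_eventually_lt_deriv {g : ℝ → ℝ} (hg : Dmap L g) (hb : ∀ᶠ t in 𝓝[>] 0, |g t| ≤ 1) :
    ¬ ∀ᶠ t in 𝓝[>] 0, 1 / t ^ 2 < deriv g t := by
  intro h
  obtain ⟨b, hb0, hI⟩ := mem_nhdsGT_iff_exists_Ioo_subset.1
    ((hb.and h).and (eventually_differentiableAt hg))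
  have hb0 : 0 < b := hb0
  have hd : ∀ t ∈ Ioo 0 b, HasDerivAt (fun t => g t - -t⁻¹) (deriv g t - 1 / t ^ 2) t := by
    intro t ht
    have := (hI ht).2.hasDerivAt.fun_sub (hasDerivAt_inv ht.1.ne').fun_neg
    simpa only [one_div, neg_neg] using this
  have hm : MonotoneOn (fun t => g t - -t⁻¹) (Ioo 0 b) := by
    refine monotoneOn_of_deriv_nonneg (convex_Ioo 0 b)
      (fun t ht => (hd t ht).continuousAt.continuousWithinAt) ?_ ?_
    · rw [interior_Ioo]; exact fun t ht => (hd t ht).differentiableAt.differentiableWithinAt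
    · rw [interior_Ioo]; intro t ht
      rw [(hd t ht).deriv]
      exact sub_nonneg.2 (hI ht).1.2.le
  have h1 : b / 2 ∈ Ioo 0 b := ⟨by positivity, by linarith⟩
  set c := (b / 2)⁻¹ with hc
  have hcp : 0 < c := by positivity
  have h2 : (c + 3)⁻¹ ∈ Ioo 0 b := by
    refine ⟨by positivity, lt_trans ?_ h1.2⟩
    rw [inv_lt_comm₀ (by positivity) h1.1]
    linarith
  have h3 : (c + 3)⁻¹ ≤ b / 2 := by
    rw [inv_le_comm₀ (by positivity) h1.1]
    linarith
  have h4 := hm h2 h1 h3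
  simp only [inv_inv, ← hc] at h4
  have h5 := abs_le.1 (hI h1).1.1
  have h6 := abs_le.1 (hI h2).1.1
  linarith

/-- The derivative of a bounded definable function is bounded by `1 / t ^ 2` near `0`. -/
theorem eventually_abs_deriv_le {g : ℝ → ℝ} (hg : Dmap L g)
    (hb : ∀ᶠ t in 𝓝[>] 0, |g t| ≤ 1) : ∀ᶠ t in 𝓝[>] 0, |deriv g t| ≤ 1 / t ^ 2 := by
  have hd : Dmap L fun t => deriv g t := .deriv (F := fun _ => g) (a := fun t => t) .auto .auto
  have hc : ∀ g' : ℝ → ℝ, Dmap L g' → Dmap L (fun t => 1 / t ^ 2 < g' t) ∧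
    Dmap L (fun t => 1 / t ^ 2 < -g' t) := fun g' h => ⟨.auto, .auto⟩
  have h1 := (eventually_or_eventually_not (hc _ hd).1 0).resolve_left
    (not_eventually_lt_deriv hg hb)
  have h2 := (eventually_or_eventually_not (P := fun t => 1 / t ^ 2 < deriv (fun t => - g t) t) (by
    simp only [deriv.fun_neg]
    exact (hc _ hd).2) 0).resolve_left
      (not_eventually_lt_deriv (L := L) (by fun_prop) (by simpa using hb))
  filter_upwards [h1, h2] with t h1 h2
  rw [deriv.fun_neg] at h2
  exact abs_le.2 ⟨by linarith, by linarith⟩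

theorem eventually_abs_deriv_le_pow {h p : ℝ → ℝ} (hh : Dmap L h) (hp : Dmap L p)
    (hpos : ∀ᶠ t in 𝓝[>] 0, 0 < h t ∧ h t ≤ t) (m : ℕ)
    (hb : ∀ᶠ t in 𝓝[>] 0, |p t| ≤ h t ^ (m + 4)) :
    ∀ᶠ t in 𝓝[>] 0, |deriv p t| ≤ h t ^ m := by
  have h1 := eventually_abs_deriv_le hh (by
    filter_upwards [hpos, Ioo_mem_nhdsGT (show (0 : ℝ) < 1 by norm_num)] with t h1 h2
    rw [abs_of_pos h1.1]; linarith [h2.2])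
  have h2 := eventually_abs_deriv_le (L := L) (g := fun t => p t / h t ^ (m + 4)) (by fun_prop) (by
    filter_upwards [hpos, hb] with t h1 h2
    rw [abs_div, abs_of_pos (pow_pos h1.1 _)]
    exact div_le_one_of_le₀ h2 (pow_nonneg h1.1.le _))
  have hm : (0 : ℝ) < 1 / (m + 5) := by positivity
  filter_upwards [hpos, hb, h1, h2, Ioo_mem_nhdsGT hm, eventually_differentiableAt hh,
    eventually_differentiableAt hp] with t h0 hb h1 h2 ht hdh hdp
  have hp0 := h0.1
  have hht : 1 / t ^ 2 ≤ 1 / h t ^ 2 := by gcongr; exact h0.2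
  have hd : deriv (fun t => p t / h t ^ (m + 4)) t =
      deriv p t / h t ^ (m + 4) - (m + 4) * (p t / h t ^ (m + 4)) * (deriv h t / h t) := by
    have h3 : HasDerivAt (fun t => h t ^ (m + 4)) (((m + 4 : ℕ) : ℝ) * h t ^ (m + 3) * deriv h t) t :=
      hdh.hasDerivAt.pow (m + 4)
    rw [(hdp.hasDerivAt.fun_div h3 (pow_ne_zero _ hp0.ne')).deriv]
    push_cast
    field_simp
    ring
  rw [hd] at h2
  have h4 : |p t / h t ^ (m + 4)| ≤ 1 := by
    rw [abs_div, abs_of_pos (pow_pos hp0 _)]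
    exact div_le_one_of_le₀ hb (pow_nonneg hp0.le _)
  have h5 : |deriv h t / h t| ≤ 1 / h t ^ 3 := by
    rw [abs_div, abs_of_pos hp0, div_le_iff₀ hp0]
    refine (h1.trans hht).trans (le_of_eq ?_)
    field_simp
  have h6 : |(m + 4) * (p t / h t ^ (m + 4)) * (deriv h t / h t)| ≤ (m + 4) * (1 / h t ^ 3) := by
    rw [abs_mul, abs_mul, abs_of_pos (by positivity : (0 : ℝ) < m + 4)]
    calc _ ≤ ((m : ℝ) + 4) * 1 * (1 / h t ^ 3) := by gcongr
      _ = _ := by ring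
  have h7 : |deriv p t / h t ^ (m + 4)| ≤ 1 / h t ^ 4 := by
    have hle : |deriv p t / h t ^ (m + 4)| ≤ 1 / h t ^ 2 + (m + 4) * (1 / h t ^ 3) := by
      have := abs_sub_abs_le_abs_sub (deriv p t / h t ^ (m + 4))
        ((m + 4) * (p t / h t ^ (m + 4)) * (deriv h t / h t))
      linarith
    refine hle.trans ?_
    have h8 : h t * (m + 5) ≤ 1 := by
      have := h0.2.trans ht.2.le
      rwa [le_div_iff₀ (by positivity)] at this
    have h9 : h t ≤ 1 := by nlinarith
    have : 1 / h t ^ 2 + (m + 4) * (1 / h t ^ 3) = (h t ^ 2 + (m + 4) * h t) * (1 / h t ^ 4) := by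
      field_simp
    rw [this]
    refine mul_le_of_le_one_left (by positivity) ?_
    nlinarith
  rw [abs_div, abs_of_pos (pow_pos hp0 _), div_le_iff₀ (pow_pos hp0 _)] at h7
  refine h7.trans (le_of_eq ?_)
  field_simp
  ring

/-- A definable function whose derivatives are all small near `0`. -/
theorem exists_flat_nhds {h : ℝ → ℝ} (hh : Dmap L h)
    (hpos : ∀ᶠ t in 𝓝[>] 0, 0 < h t ∧ h t ≤ t) (r : ℕ) :
    ∃ θ : ℕ → ℝ → ℝ, (∀ j, Dmap L (θ j)) ∧ (∀ᶠ t in 𝓝[>] 0, 0 < θ 0 t) ∧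
      ∀ᶠ t in 𝓝[>] 0, ∀ j ≤ r, HasDerivAt (θ j) (θ (j + 1) t) t ∧ |θ j t| ≤ h t := by
  let θ : ℕ → ℝ → ℝ := fun j => deriv^[j] fun t => h t ^ (4 * r + 1)
  have hs : ∀ j, θ (j + 1) = deriv (θ j) := fun j => Function.iterate_succ_apply' _ _ _
  have hd : ∀ j, Dmap L (θ j) := by
    intro j
    induction j with
    | zero => exact (.auto : Dmap L fun t => h t ^ (4 * r + 1))
    | succ j ih => rw [hs]; exact .deriv (F := fun _ => θ j) (a := fun t => t) .auto .auto
  have hb : ∀ j k, j + k = r → ∀ᶠ t in 𝓝[>] 0, |θ j t| ≤ h t ^ (4 * k + 1) := by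
    intro j
    induction j with
    | zero =>
      intro k hk
      obtain rfl : k = r := by omega
      filter_upwards [hpos] with t ht
      exact (abs_of_pos (pow_pos ht.1 _)).le
    | succ j ih =>
      intro k hk
      rw [hs]
      exact eventually_abs_deriv_le_pow hh (hd j) hpos _ (ih (k + 1) (by omega))
  refine ⟨θ, hd, by filter_upwards [hpos] with t ht using pow_pos ht.1 _, ?_⟩
  have h1 : ∀ j, ∀ᶠ t in 𝓝[>] 0, j ≤ r → HasDerivAt (θ j) (θ (j + 1) t) t ∧ |θ j t| ≤ h t := by
    intro j
    by_cases hj : j ≤ r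
    · filter_upwards [hb j (r - j) (by omega), eventually_differentiableAt (hd j), hpos,
        Ioo_mem_nhdsGT (show (0 : ℝ) < 1 by norm_num)] with t h1 h2 h3 h4 _
      rw [hs]
      refine ⟨h2.hasDerivAt, h1.trans ?_⟩
      exact pow_le_of_le_one h3.1.le (h3.2.trans h4.2.le) (by omega)
    · exact .of_forall fun _ h => absurd h hj
  have h2 : ∀ᶠ t in 𝓝[>] 0, ∀ j ∈ Finset.range (r + 1), j ≤ r →
      HasDerivAt (θ j) (θ (j + 1) t) t ∧ |θ j t| ≤ h t :=
    (Finset.eventually_all _).2 fun j _ => h1 j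
  filter_upwards [h2] with t ht j hj
  exact ht j (Finset.mem_range.2 (by omega)) hj

/-- A definable positive function on `(0, 2)` whose derivatives are dominated by a given function. -/
theorem exists_flat {M : ℝ → ℝ} (hM : Dmap L M) (hmono : ∀ s t, 0 < s → s ≤ t → M s ≤ M t)
    (hpos : ∀ t, 0 < t → 0 < M t) (r : ℕ) :
    ∃ θ : ℕ → ℝ → ℝ, Dmap L (θ 0) ∧ ∀ t ∈ Ioo (0 : ℝ) 2, 0 < θ 0 t ∧
      ∀ j ≤ r, HasDerivAt (θ j) (θ (j + 1) t) t ∧ |θ j t| ≤ M t := by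
  obtain ⟨θ, hd, h0, h1⟩ := exists_flat_nhds (h := fun t => min (M t) t) (L := L) .auto (by
    filter_upwards [self_mem_nhdsWithin] with t ht
    exact ⟨lt_min (hpos t ht) ht, min_le_right _ _⟩) r
  obtain ⟨b, hb, hI⟩ := mem_nhdsGT_iff_exists_Ioo_subset.1 ((h0.and h1).and
    (Ioo_mem_nhdsGT (show (0 : ℝ) < 1 by norm_num)))
  have hb : 0 < b := hb
  set c := min (b / 2) (1 / 2) with hc
  have hc0 : 0 < c := by positivity
  have hc1 : c ≤ 1 / 2 := min_le_right _ _
  refine ⟨fun j t => c ^ j * θ j (c * t), by have := hd 0; exact .auto, fun t ht => ?_⟩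
  have hct : c * t ∈ Ioo 0 b := by
    refine ⟨mul_pos hc0 ht.1, ?_⟩
    have : c ≤ b / 2 := min_le_left _ _
    nlinarith [ht.1, ht.2]
  obtain ⟨⟨h2, h3⟩, h4⟩ := hI hct
  refine ⟨by simpa using h2, fun j hj => ⟨?_, ?_⟩⟩
  · have h5 := (h3 j hj).1.comp t ((hasDerivAt_id t).const_mul c)
    have h6 := h5.const_mul (c ^ j)
    refine h6.congr_deriv ?_
    simp only [mul_one]
    ring
  · rw [abs_mul, abs_of_pos (pow_pos hc0 j)]
    have h5 : c ^ j ≤ 1 := pow_le_one₀ hc0.le (by linarith)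
    have h6 : |θ j (c * t)| ≤ M t := by
      refine (h3 j hj).2.trans ((min_le_left _ _).trans (hmono _ _ hct.1 ?_))
      nlinarith [ht.1]
    calc c ^ j * |θ j (c * t)| ≤ 1 * |θ j (c * t)| := by gcongr
      _ ≤ M t := by rwa [one_mul]

end Flat

section FlatExtension

variable {L : FirstOrder.Language} [L.Structure ℝ]

/-- A definable positive increasing function on `(0, ∞)`. -/
structure Modulus (L : FirstOrder.Language) [L.Structure ℝ] (M : ℝ → ℝ) : Prop where
  dmap : Dmap L M
  mono : ∀ s t, 0 < s → s ≤ t → M s ≤ M t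
  pos : ∀ t, 0 < t → 0 < M t

variable [OM L]

theorem Modulus.exists_le {ι : Type*} [Finite ι] {M : ι → ℝ → ℝ} (h : ∀ i, Modulus L (M i)) :
    ∃ M', Modulus L M' ∧ ∀ i t, M' t ≤ M i t := by
  classical
  have := Fintype.ofFinite ι
  suffices ∀ s : Finset ι, ∃ M', Modulus L M' ∧ ∀ i ∈ s, ∀ t, M' t ≤ M i t by
    obtain ⟨M', h1, h2⟩ := this Finset.univ
    exact ⟨M', h1, fun i => h2 i (Finset.mem_univ i)⟩
  intro s
  induction s using Finset.induction_on with
  | empty => exact ⟨fun _ => 1, ⟨.auto, fun _ _ _ _ => le_rfl, fun _ _ => one_pos⟩, by simp⟩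
  | insert a s _ ih =>
    obtain ⟨M', h1, h2⟩ := ih
    have hd := h1.dmap
    have hd' := (h a).dmap
    refine ⟨fun t => min (M a t) (M' t), ⟨.auto, fun s t hs hst =>
      min_le_min ((h a).mono s t hs hst) (h1.mono s t hs hst),
      fun t ht => lt_min ((h a).pos t ht) (h1.pos t ht)⟩, fun i hi t => ?_⟩
    rcases Finset.mem_insert.1 hi with rfl | hi
    · exact min_le_left _ _
    · exact (min_le_right _ _).trans (h2 i hi t)

variable {d : ℕ}

/-- A polynomial positive on the open unit cube and vanishing on its boundary. -/
def rho {d : ℕ} (s : Fin d → ℝ) : ℝ := ∏ i, s i * (1 - s i)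

@[fun_prop]
theorem dmap_rho : Dmap L (rho (d := d)) := by unfold rho; exact .auto

theorem contDiff_rho {n : WithTop ℕ∞} : ContDiff ℝ n (rho (d := d)) := by
  unfold rho
  exact contDiff_prod fun i _ => by fun_prop

theorem rho_pos {s : Fin d → ℝ} (hs : s ∈ Q d) : 0 < rho s :=
  Finset.prod_pos fun i _ => mul_pos (hs i).1 (sub_pos.2 (hs i).2)

theorem rho_le_one {s : Fin d → ℝ} (hs : s ∈ Q d) : rho s ≤ 1 :=
  Finset.prod_le_one (fun i _ => (mul_pos (hs i).1 (sub_pos.2 (hs i).2)).le)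
    fun i _ => by nlinarith [(hs i).1, (hs i).2]

theorem isCompact_rho_ge {t : ℝ} (ht : 0 < t) : IsCompact {s : Fin d → ℝ | s ∈ Q d ∧ t ≤ rho s} := by
  have h : {s : Fin d → ℝ | s ∈ Q d ∧ t ≤ rho s} = Icc 0 1 ∩ {s | t ≤ rho s} := by
    ext s
    refine ⟨fun h => ⟨⟨fun i => (h.1 i).1.le, fun i => (h.1 i).2.le⟩, h.2⟩,
      fun ⟨h1, h2⟩ => ⟨fun i => ?_, h2⟩⟩
    have h3 : s i * (1 - s i) ≠ 0 := fun h0 => by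
      have : rho s = 0 := Finset.prod_eq_zero (Finset.mem_univ i) h0
      have h2 : t ≤ rho s := h2
      linarith
    have h4 := h1.1 i
    have h5 := h1.2 i
    exact ⟨lt_of_le_of_ne h4 fun h => h3 (by rw [← h]; simp),
      lt_of_le_of_ne h5 fun h => h3 (by rw [h]; simp)⟩
  rw [h]
  exact isCompact_Icc.inter_right (isClosed_le continuous_const (contDiff_rho (n := 0)).continuous)

theorem exists_modulus {Ω : Set (Fin d → ℝ)} (hΩ : Dmap L fun s => s ∈ Ω) (hΩo : IsOpen Ω)
    (hΩQ : Ω ⊆ Q d) {δ f : (Fin d → ℝ) → ℝ} (hδ : Dmap L δ) (hδc : ContinuousOn δ Ω)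
    (hδ0 : ∀ s ∈ Ω, 0 < δ s)
    (hlim : ∀ s ∈ Q d, s ∉ Ω → ∀ ε > 0, ∀ᶠ t in 𝓝 s, t ∈ Ω → δ t < ε)
    (hf : Dmap L f) (hfc : ContinuousOn f Ω) :
    ∃ M, Modulus L M ∧ ∀ s ∈ Q d, s ∉ Ω → ∀ᶠ t in 𝓝 s, t ∈ Ω →
      M (δ t) * |f t| ≤ ‖t - s‖ ^ 2 := by
  let A : ℝ → Set ℝ := fun t => {y | 0 ≤ y ∧ y ≤ 1 ∧ ∀ s s' : Fin d → ℝ, s ∈ Ω → t ≤ rho s →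
    t ≤ δ s → s' ∈ Q d → s' ∉ Ω → y * |f s| ≤ ‖s - s'‖ ^ 2}
  have h0 : ∀ t, (0 : ℝ) ∈ A t := fun t =>
    ⟨le_rfl, zero_le_one, fun s s' _ _ _ _ _ => by rw [zero_mul]; positivity⟩
  have hbd : ∀ t, BddAbove (A t) := fun t => ⟨1, fun y hy => hy.2.1⟩
  have hlub : ∀ t, IsLUB (A t) (sSup (A t)) := fun t => isLUB_csSup ⟨0, h0 t⟩ (hbd t)
  have hA : Dmap L fun p : ℝ × ℝ => p.2 ∈ A p.1 := by
    simp only [A, mem_ofPred_eq]; exact .auto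
  refine ⟨fun t => sSup (A t), ⟨?_, fun s t _ hst => csSup_le_csSup (hbd t) ⟨0, h0 s⟩
    fun y hy => ⟨hy.1, hy.2.1, fun s s' h1 h2 h3 => hy.2.2 s s' h1 (hst.trans h2) (hst.trans h3)⟩,
    fun t ht => ?_⟩, fun s hs hsΩ => ?_⟩
  · have hA' : Dmap L fun p : (ℝ × ℝ) × ℝ => p.2 ∈ A p.1.1 :=
      Dmap.comp (f := fun p : (ℝ × ℝ) × ℝ => (p.1.1, p.2)) hA .auto
    have hA'' : Dmap L fun p : ((ℝ × ℝ) × ℝ) × ℝ => p.2 ∈ A p.1.1.1 :=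
      Dmap.comp (f := fun p : ((ℝ × ℝ) × ℝ) × ℝ => (p.1.1.1, p.2)) hA .auto
    refine .of_graph' (P := fun t y => (∀ z : ℝ, z ∈ A t → z ≤ y) ∧
      ∀ b : ℝ, (∀ z : ℝ, z ∈ A t → z ≤ b) → y ≤ b) ?_ fun t y => ?_
    · exact .auto
    · constructor
      · rintro rfl
        exact ⟨fun z hz => (hlub t).1 hz, fun b hb => (hlub t).2 fun z hz => hb z hz⟩
      · rintro ⟨h1, h2⟩
        exact (hlub t).unique ⟨fun z hz => h1 z hz, fun b hb => h2 b fun z hz => hb hz⟩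
  · have hK : IsCompact {s | s ∈ Ω ∧ t ≤ rho s ∧ t ≤ δ s} := by
      refine (isCompact_rho_ge ht).of_isClosed_subset ?_ fun s hs => ⟨hΩQ hs.1, hs.2.1⟩
      rw [← isOpen_compl_iff, isOpen_iff_mem_nhds]
      intro s hs
      by_cases h1 : s ∈ {s : Fin d → ℝ | s ∈ Q d ∧ t ≤ rho s}
      · by_cases h2 : s ∈ Ω
        · have h3 : δ s < t := by
            by_contra! h3
            exact hs ⟨h2, h1.2, h3⟩
          filter_upwards [(hδc.continuousAt (hΩo.mem_nhds h2)).eventually (gt_mem_nhds h3)]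
            with t' h4 h5
          exact absurd h5.2.2 (not_le.2 h4)
        · filter_upwards [hlim s h1.1 h2 t ht] with t' h4 h5
          exact absurd h5.2.2 (not_le.2 (h4 h5.1))
      · filter_upwards [(isCompact_rho_ge ht).isClosed.isOpen_compl.mem_nhds h1] with t' h4 h5
        exact h4 ⟨hΩQ h5.1, h5.2.1⟩
    obtain ⟨B, hB⟩ := hK.exists_bound_of_continuousOn (hfc.mono fun s hs => hs.1)
    obtain ⟨η, hη, hη'⟩ := hK.exists_thickening_subset_open hΩo fun s hs => hs.1
    have hy : min 1 (η ^ 2 / (|B| + 1)) ∈ A t := by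
      refine ⟨by positivity, min_le_left _ _, fun s s' h1 h2 h3 h4 h5 => ?_⟩
      have h6 : η ≤ ‖s - s'‖ := by
        by_contra! h
        refine h5 (hη' (Metric.mem_thickening_iff.2 ⟨s, ⟨h1, h2, h3⟩, ?_⟩))
        rwa [dist_comm, dist_eq_norm]
      have h7 : |f s| ≤ |B| + 1 := (hB s ⟨h1, h2, h3⟩).trans (by linarith [le_abs_self B])
      calc min 1 (η ^ 2 / (|B| + 1)) * |f s| ≤ η ^ 2 / (|B| + 1) * (|B| + 1) := by
            gcongr; exact min_le_right _ _
        _ = η ^ 2 := by field_simp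
        _ ≤ _ := by gcongr
    exact lt_of_lt_of_le (by positivity) ((hlub t).1 hy)
  · have hρ := rho_pos hs
    filter_upwards [hlim s hs hsΩ _ (half_pos hρ),
      (contDiff_rho (n := 0)).continuous.continuousAt.eventually (lt_mem_nhds (half_lt_self hρ))]
      with t h1 h2 htΩ
    have h3 := h1 htΩ
    rcases (abs_nonneg (f t)).eq_or_lt with h4 | h4
    · rw [← h4, mul_zero]; positivity
    · rw [← le_div_iff₀ h4]
      exact (hlub _).2 fun y hy => (le_div_iff₀ h4).2
        (hy.2.2 t s htΩ (h3.le.trans h2.le) le_rfl hs hsΩ)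

theorem hasFDerivAt_zero_of_sq {f : (Fin d → ℝ) → ℝ} {s : Fin d → ℝ}
    (h : ∀ᶠ t in 𝓝 s, |f t| ≤ ‖t - s‖ ^ 2) : HasFDerivAt f (0 : (Fin d → ℝ) →L[ℝ] ℝ) s := by
  refine Asymptotics.IsBigO.hasFDerivAt (n := 2) (.of_bound 1 ?_) one_lt_two
  filter_upwards [h] with t ht
  rw [one_mul, Real.norm_eq_abs]
  exact ht.trans (le_abs_self _)

/-- Multiplication by a sufficiently flat function of `δ` makes the extension by zero smooth. -/
theorem exists_modulus_contDiffAt (r : ℕ) {Ω : Set (Fin d → ℝ)} (hΩ : Dmap L fun s => s ∈ Ω)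
    (hΩo : IsOpen Ω) (hΩQ : Ω ⊆ Q d) {δ f : (Fin d → ℝ) → ℝ} (hδ : Dmap L δ)
    (hδr : ∀ s ∈ Ω, ContDiffAt ℝ r δ s) (hδ0 : ∀ s ∈ Ω, δ s ∈ Ioo 0 2)
    (hlim : ∀ s ∈ Q d, s ∉ Ω → ∀ ε > 0, ∀ᶠ t in 𝓝 s, t ∈ Ω → δ t < ε)
    (hf : Dmap L f) (hfr : ∀ s ∈ Ω, ContDiffAt ℝ r f s) :
    ∃ M, Modulus L M ∧ ∀ θ : ℕ → ℝ → ℝ, (∀ t ∈ Ioo (0 : ℝ) 2, ∀ j ≤ r,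
      HasDerivAt (θ j) (θ (j + 1) t) t ∧ |θ j t| ≤ M t) →
      ∀ s ∈ Q d, ContDiffAt ℝ r (Ω.indicator fun s => θ 0 (δ s) * f s) s := by
  have hδc : ContinuousOn δ Ω := fun s hs => (hδr s hs).continuousAt.continuousWithinAt
  have hzero : ∀ f : (Fin d → ℝ) → ℝ, Dmap L f → ContinuousOn f Ω → ∃ M, Modulus L M ∧
      ∀ θ : ℝ → ℝ, (∀ t ∈ Ioo (0 : ℝ) 2, |θ t| ≤ M t) → ∀ s ∈ Q d, s ∉ Ω →
      HasFDerivAt (Ω.indicator fun s => θ (δ s) * f s) (0 : (Fin d → ℝ) →L[ℝ] ℝ) s := by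
    intro f hf hfc
    obtain ⟨M, hM, hMs⟩ := exists_modulus hΩ hΩo hΩQ hδ hδc (fun s hs => (hδ0 s hs).1) hlim hf hfc
    refine ⟨M, hM, fun θ hθ s hs hsΩ => hasFDerivAt_zero_of_sq ?_⟩
    filter_upwards [hMs s hs hsΩ] with t ht
    by_cases htΩ : t ∈ Ω
    · rw [indicator_of_mem htΩ, abs_mul]
      refine le_trans ?_ (ht htΩ)
      gcongr
      exact hθ _ (hδ0 t htΩ)
    · rw [indicator_of_notMem htΩ, abs_zero]; positivity
  have hin : ∀ g : (Fin d → ℝ) → ℝ, ∀ s ∈ Ω, Ω.indicator g =ᶠ[𝓝 s] g := fun g s hs => by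
    filter_upwards [hΩo.mem_nhds hs] with t ht using indicator_of_mem ht _
  induction r generalizing f with
  | zero =>
    obtain ⟨M, hM, hMz⟩ := hzero f hf fun s hs => (hfr s hs).continuousAt.continuousWithinAt
    refine ⟨M, hM, fun θ hθ s hs => ?_⟩
    rw [Nat.cast_zero, contDiffAt_zero]
    refine ⟨Q d, (isOpen_Q d).mem_nhds hs, fun t ht => ContinuousAt.continuousWithinAt ?_⟩
    by_cases htΩ : t ∈ Ω
    · refine ContinuousAt.congr ?_ (hin _ t htΩ).symm
      exact (((hθ _ (hδ0 t htΩ) 0 le_rfl).1.continuousAt).comp (hδr t htΩ).continuousAt).mul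
        (hfr t htΩ).continuousAt
    · exact (hMz (θ 0) (fun t ht => (hθ t ht 0 le_rfl).2) t ht htΩ).continuousAt
  | succ r ih =>
    have hle : ((r : ℕ) : WithTop ℕ∞) ≤ ((r + 1 : ℕ) : WithTop ℕ∞) := by
      exact_mod_cast Nat.le_succ r
    have hδr' : ∀ s ∈ Ω, ContDiffAt ℝ r δ s := fun s hs => (hδr s hs).of_le hle
    obtain ⟨M, hM, hMz⟩ := hzero f hf fun s hs => (hfr s hs).continuousAt.continuousWithinAt
    have hpd : ∀ {g : (Fin d → ℝ) → ℝ}, Dmap L g → ∀ i, Dmap L (pd g i) := fun {g} hg i =>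
      .pd (F := fun _ => g) (a := fun s => s) i .auto .auto
    have hpdδ := hpd hδ
    have hpdf := hpd hf
    choose M₁ hM₁ hM₁' using fun i => ih hδr' (f := fun s => pd δ i s * f s) (Dmap.mul (hpdδ i) hf)
      fun s hs => (((contDiffAt_succ_iff_pd.1 (hδr s hs)).2 i).mul ((hfr s hs).of_le hle))
    choose M₂ hM₂ hM₂' using fun i => ih hδr' (f := pd f i) (hpdf i)
      fun s hs => (contDiffAt_succ_iff_pd.1 (hfr s hs)).2 i
    obtain ⟨M₃, hM₃, hM₃'⟩ := Modulus.exists_le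
      (M := fun o : Option (Fin d ⊕ Fin d) => o.elim M (Sum.elim M₁ M₂)) (L := L) (by
        rintro (_ | _ | _)
        exacts [hM, hM₁ _, hM₂ _])
    refine ⟨M₃, hM₃, fun θ hθ s hs => ?_⟩
    have hin' : ∀ s ∈ Ω, HasFDerivAt (Ω.indicator fun s => θ 0 (δ s) * f s)
        (θ 0 (δ s) • fderiv ℝ f s + f s • (θ 1 (δ s) • fderiv ℝ δ s)) s := fun s hs => by
      have h1 := (hfr s hs).differentiableAt (by simp)
      have h2 := (hδr s hs).differentiableAt (by simp)
      have h3 := (hθ _ (hδ0 s hs) 0 (by omega)).1.comp_hasFDerivAt s h2.hasFDerivAt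
      exact (h3.mul h1.hasFDerivAt).congr_of_eventuallyEq (hin _ s hs)
    have hout := hMz (θ 0) fun t ht => (hθ t ht 0 (by omega)).2.trans (hM₃' none t)
    refine contDiffAt_succ_iff_pd.2 ⟨?_, fun i => ?_⟩
    · filter_upwards [(isOpen_Q d).mem_nhds hs] with t ht
      by_cases htΩ : t ∈ Ω
      · exact (hin' t htΩ).differentiableAt
      · exact (hout t ht htΩ).differentiableAt
    · refine ((hM₁' i (fun j => θ (j + 1)) (fun t ht j hj => ⟨(hθ t ht (j + 1) (by omega)).1,
        (hθ t ht (j + 1) (by omega)).2.trans (hM₃' (some (.inl i)) t)⟩) s hs).add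
        (hM₂' i θ (fun t ht j hj => ⟨(hθ t ht j (by omega)).1,
        (hθ t ht j (by omega)).2.trans (hM₃' (some (.inr i)) t)⟩) s hs)).congr_of_eventuallyEq ?_
      filter_upwards [(isOpen_Q d).mem_nhds hs] with t ht
      by_cases htΩ : t ∈ Ω
      · rw [pd, (hin' t htΩ).fderiv]
        simp only [indicator_of_mem htΩ, pd, ContinuousLinearMap.add_apply,
          ContinuousLinearMap.smul_apply, smul_eq_mul]
        ring
      · rw [pd, (hout t ht htΩ).fderiv]
        simp only [indicator_of_notMem htΩ, zero_apply, add_zero]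

end FlatExtension

section Bumps

variable {L : FirstOrder.Language} [L.Structure ℝ] {Γ : Type} [Group Γ] [Dt L Γ] {r d : ℕ}
  {C : LChart L Γ r d} {E : Type} [NormedAddCommGroup E] [NormedSpace ℝ E]

namespace LChart

theorem Sm.exists_ultrafilter {f : E → Γ} {p : E} (hf : C.Sm f p) {ι : Type*}
    {U : Ultrafilter ι} {x : ι → E} (hx : Filter.Tendsto x U (𝓝 p)) :
    ∃ g : ι → Fin d → ℝ, Filter.Tendsto g U (𝓝 C.t₀) ∧ ∀ᶠ i in U, f (x i) = f p * C.u (g i) := by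
  obtain ⟨g, hg, hgp, he⟩ := hf.exists
  have h := hg.continuousAt.tendsto
  rw [hgp] at h
  exact ⟨fun i => g (x i), h.comp hx, (hx.eventually he).mono fun i hi => hi.2⟩

namespace CubeChart

theorem eventually_mem_image (B : C.CubeChart) {f : E → Γ} {p : E} (hf : C.Sm f p)
    (h : f p ∈ B.c '' Q d) : ∀ᶠ x in 𝓝 p, f x ∈ B.c '' Q d := by
  obtain ⟨s, hs, e⟩ := h
  obtain ⟨g, hg, hgp, he⟩ := hf.exists
  have h := hg.continuousAt.tendsto
  rw [hgp] at h
  filter_upwards [he, h.eventually (B.nhds s hs)] with x h1 h2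
  rw [h1.2, ← e]; exact h2

theorem contDiffAt_w (B : C.CubeChart) {f : E → Γ} {p : E} (hf : C.Sm f p)
    (h : f p ∈ B.c '' Q d) : ContDiffAt ℝ r (fun x => B.w (f x)) p := by
  obtain ⟨s, hs, e⟩ := h
  exact hf.contDiffAt (ψ := B.w) (by rw [← e]; exact B.smooth s hs)

theorem sm_mul_u [OM L] [DGrp L Γ] (x : Γ) : C.Sm (fun t => x * C.u t) C.t₀ :=
  (sm_u C.mem).mul_left x

variable [OM L] [DGrp L Γ]

/-- Points staying in a compact part of the target chart have limits in the target chart. -/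
theorem mem_image_of_ultrafilter (T : TopCells L Γ d) (A B : C.CubeChart) {s s' : Fin d → ℝ}
    (hs : s ∈ Q d) (hs' : s' ∈ Q d) {U : Ultrafilter (Fin d → ℝ)} (hU : ↑U ≤ 𝓝 s)
    {y : (Fin d → ℝ) → (Fin d → ℝ)} (hy : Filter.Tendsto y U (𝓝 s'))
    (he : ∀ᶠ t in U, A.c t = B.c (y t)) : A.c s = B.c s' := by
  obtain ⟨g, hg, hg'⟩ := (A.sm s hs).exists_ultrafilter (x := fun t => t) (U := U) hU
  obtain ⟨h, hh, hh'⟩ := (B.sm s' hs').exists_ultrafilter hy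
  have h1 : C.Sm (fun p : (Fin d → ℝ) × (Fin d → ℝ) => C.u p.1 * (C.u p.2)⁻¹) (C.t₀, C.t₀) :=
    ((sm_u C.mem).comp (φ := Prod.fst) (q := (C.t₀, C.t₀)) contDiffAt_fst).mul T
      (((sm_u C.mem).comp (φ := Prod.snd) (q := (C.t₀, C.t₀)) contDiffAt_snd).inv T)
  obtain ⟨G, hG, hG0, hGe⟩ := h1.exists
  have h2 : Filter.Tendsto (fun t => (h t, g t)) U (𝓝 (C.t₀, C.t₀)) := hh.prodMk_nhds hg
  have h3 := hG.continuousAt.tendsto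
  rw [hG0] at h3
  have h4 : ∀ᶠ t in U, G (h t, g t) = C.v ((B.c s')⁻¹ * A.c s) ∧
      (B.c s')⁻¹ * A.c s ∈ C.u '' C.B := by
    filter_upwards [he, hg', hh', h2.eventually hGe] with t e1 e2 e3 e4
    rw [e2, e3] at e1
    have e5 : (B.c s')⁻¹ * A.c s = C.u (G (h t, g t)) := by
      have e6 := e4.2
      rw [mul_inv_cancel, one_mul] at e6
      rw [← e6, eq_mul_inv_iff_mul_eq, mul_assoc, e1, inv_mul_cancel_left]
    rw [e5, C.v_u _ e4.1]
    exact ⟨rfl, _, e4.1, rfl⟩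
  have h5 : C.v ((B.c s')⁻¹ * A.c s) = C.t₀ :=
    tendsto_nhds_unique tendsto_const_nhds (Filter.Tendsto.congr' (h4.mono fun t ht => ht.1)
      (h3.comp h2))
  obtain ⟨t, ht⟩ := h4.exists
  have h6 := C.u_v ht.2
  rw [h5, C.u_t₀] at h6
  rw [eq_inv_mul_iff_mul_eq, mul_one] at h6
  exact h6.symm

/-- The coordinate domain of `B` seen in `A`. -/
def overlap (A B : C.CubeChart) : Set (Fin d → ℝ) := {s | s ∈ Q d ∧ A.c s ∈ B.c '' Q d}

theorem dmap_overlap (A B : C.CubeChart) : Dmap L fun s => s ∈ overlap A B := by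
  obtain ⟨V, hV, hVe⟩ : ∃ V : Set Γ, (Dmap L fun x => x ∈ V) ∧ V = B.c '' Q d :=
    ⟨_, B.hc.mem_image (dmap_mem_Q L d), rfl⟩
  have := A.hc
  simp only [overlap, mem_ofPred_eq, ← hVe]
  exact .auto

theorem isOpen_overlap (A B : C.CubeChart) : IsOpen (overlap A B) := by
  rw [isOpen_iff_mem_nhds]
  rintro s ⟨hs, h⟩
  filter_upwards [(isOpen_Q d).mem_nhds hs, B.eventually_mem_image (A.sm s hs) h] with t h1 h2
    using ⟨h1, h2⟩

theorem w_mem (A : C.CubeChart) {x : Γ} (hx : x ∈ A.c '' Q d) : A.w x ∈ Q d ∧ A.c (A.w x) = x := by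
  obtain ⟨s, hs, rfl⟩ := hx
  rw [A.w_c s hs]
  exact ⟨hs, rfl⟩

theorem eventually_rho_lt (T : TopCells L Γ d) (A B : C.CubeChart) {s : Fin d → ℝ} (hs : s ∈ Q d)
    (hsΩ : s ∉ overlap A B) {ε : ℝ} (hε : 0 < ε) :
    ∀ᶠ t in 𝓝 s, t ∈ overlap A B → rho (B.w (A.c t)) < ε := by
  by_contra hcon
  have hne : (𝓝 s ⊓ Filter.principal {t | t ∈ overlap A B ∧ ε ≤ rho (B.w (A.c t))}).NeBot := by
    rw [← Filter.frequently_mem_iff_neBot]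
    refine (Filter.not_eventually.1 hcon).mono fun t ht => ?_
    simpa using ht
  have hU := Ultrafilter.of_le (𝓝 s ⊓ Filter.principal
    {t | t ∈ overlap A B ∧ ε ≤ rho (B.w (A.c t))})
  set U := Ultrafilter.of (𝓝 s ⊓ Filter.principal
    {t | t ∈ overlap A B ∧ ε ≤ rho (B.w (A.c t))})
  have h1 : ∀ᶠ t in U, t ∈ overlap A B ∧ ε ≤ rho (B.w (A.c t)) :=
    hU (Filter.mem_inf_of_right (Filter.mem_principal_self _))
  obtain ⟨s', hs', hlim⟩ := (isCompact_rho_ge (d := d) hε).ultrafilter_le_nhds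
    (U.map fun t => B.w (A.c t)) (by
      rw [Filter.le_principal_iff]
      exact h1.mono fun t ht => ⟨(B.w_mem ht.1.2).1, ht.2⟩)
  have h2 := mem_image_of_ultrafilter T A B hs hs'.1 (hU.trans inf_le_left) hlim
    (h1.mono fun t ht => (B.w_mem ht.1.2).2.symm)
  exact hsΩ ⟨hs, s', hs'.1, h2.symm⟩

/-- A smooth definable function vanishing exactly outside of each chart. -/
theorem exists_bumps (T : TopCells L Γ d) {q : ℕ} (A : Fin q → C.CubeChart)
    (hA : ∀ x, ∃ k, x ∈ (A k).c '' Q d) :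
    ∃ β : Fin q → Γ → ℝ, (∀ l, Dmap L (β l)) ∧ (∀ l, ∀ x ∈ (A l).c '' Q d, 0 < β l x) ∧
      (∀ l, ∀ x ∉ (A l).c '' Q d, β l x = 0) ∧
      (∀ l x, ContDiffAt ℝ r (fun t => β l (x * C.u t)) C.t₀) ∧
      ∀ l j x, ContDiffAt ℝ r (fun t => β l (x * C.u t) * (A l).w (x * C.u t) j) C.t₀ := by
  have hc := fun l => (A l).hc
  have hw := fun l => (A l).hw
  let f : Fin q → Fin q → Option (Fin d) → (Fin d → ℝ) → ℝ := fun m l o s =>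
    o.elim 1 fun j => (A l).w ((A m).c s) j
  have hwc : ∀ m l, ∀ s ∈ overlap (A m) (A l), ContDiffAt ℝ r (fun s => (A l).w ((A m).c s)) s :=
    fun m l s hs => (A l).contDiffAt_w ((A m).sm s hs.1) hs.2
  have hfd : ∀ m l o, Dmap L (f m l o) := by
    rintro m l (_ | j)
    · exact (.auto : Dmap L fun _ : Fin d → ℝ => (1 : ℝ))
    · have := hc m
      have := hw l
      exact (.auto : Dmap L fun s => (A l).w ((A m).c s) j)
  have hfr : ∀ m l o, ∀ s ∈ overlap (A m) (A l), ContDiffAt ℝ r (f m l o) s := by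
    rintro m l (_ | j) s hs
    · exact contDiffAt_const
    · exact contDiffAt_pi.1 (hwc m l s hs) j
  choose M hM hM' using fun m l o => exists_modulus_contDiffAt r (dmap_overlap (A m) (A l))
    (isOpen_overlap _ _) (fun s hs => hs.1) (δ := fun s => rho ((A l).w ((A m).c s)))
    (Dmap.comp dmap_rho (Dmap.comp (hw l) (hc m)))
    (fun s hs => contDiff_rho.contDiffAt.comp s (hwc m l s hs))
    (fun s hs => ⟨rho_pos ((A l).w_mem hs.2).1,
      (rho_le_one ((A l).w_mem hs.2).1).trans_lt one_lt_two⟩)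
    (fun s hs hsΩ ε hε => eventually_rho_lt T _ _ hs hsΩ hε) (hfd m l o) (hfr m l o)
  obtain ⟨M', hM'd, hM''⟩ := Modulus.exists_le (M := fun p : Fin q × Fin q × Option (Fin d) =>
    M p.1 p.2.1 p.2.2) fun p => hM _ _ _
  obtain ⟨θ, hθd, hθ⟩ := exists_flat hM'd.dmap hM'd.mono hM'd.pos r
  have hsm := fun m l o => hM' m l o θ fun t ht j hj => ⟨((hθ t ht).2 j hj).1,
    ((hθ t ht).2 j hj).2.trans (hM'' (m, l, o) t)⟩
  let β : Fin q → Γ → ℝ := fun l => ((A l).c '' Q d).indicator fun x => θ 0 (rho ((A l).w x))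
  have hfix : ∀ (ψ : Γ → ℝ), (∀ m, ∀ s ∈ Q d, ContDiffAt ℝ r (fun s => ψ ((A m).c s)) s) →
      ∀ x, ContDiffAt ℝ r (fun t => ψ (x * C.u t)) C.t₀ := by
    intro ψ hψ x
    obtain ⟨m, hm⟩ := hA x
    have h1 : x * C.u C.t₀ ∈ (A m).c '' Q d := by rwa [C.u_t₀, mul_one]
    have h2 := (A m).contDiffAt_w (sm_mul_u x) h1
    refine (ContDiffAt.comp C.t₀ (hψ m _ ((A m).w_mem h1).1) h2).congr_of_eventuallyEq ?_
    filter_upwards [(A m).eventually_mem_image (sm_mul_u x) h1] with t ht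
    show ψ _ = ψ _
    rw [((A m).w_mem ht).2]
  refine ⟨β, fun l => ?_, fun l x hx => ?_, fun l x hx => indicator_of_notMem hx _,
    fun l => hfix _ fun m s hs => ?_, fun l j => hfix (fun x => β l x * (A l).w x j)
      fun m s hs => ?_⟩
  · classical
    obtain ⟨V, hV, hVe⟩ : ∃ V : Set Γ, (Dmap L fun x => x ∈ V) ∧ V = (A l).c '' Q d :=
      ⟨_, (hc l).mem_image (dmap_mem_Q L d), rfl⟩
    have h1 : Dmap L fun x => θ 0 (rho ((A l).w x)) := Dmap.comp hθd (Dmap.comp dmap_rho (hw l))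
    have : β l = fun x => if x ∈ V then θ 0 (rho ((A l).w x)) else 0 := by
      funext x; simp only [β, ← hVe, indicator_apply]
    rw [this]
    exact .ite hV h1 .auto
  · simp only [β, indicator_of_mem hx]
    have h := ((A l).w_mem hx).1
    exact (hθ _ ⟨rho_pos h, (rho_le_one h).trans_lt one_lt_two⟩).1
  · refine (hsm m l none s hs).congr_of_eventuallyEq ?_
    filter_upwards [(isOpen_Q d).mem_nhds hs] with t ht
    by_cases h : (A m).c t ∈ (A l).c '' Q d
    · have h' : t ∈ overlap (A m) (A l) := ⟨ht, h⟩
      simp [β, f, indicator_of_mem h, indicator_of_mem h']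
    · have h' : t ∉ overlap (A m) (A l) := fun h' => h h'.2
      simp only [β, indicator_of_notMem h, indicator_of_notMem h']
  · refine (hsm m l (some j) s hs).congr_of_eventuallyEq ?_
    filter_upwards [(isOpen_Q d).mem_nhds hs] with t ht
    by_cases h : (A m).c t ∈ (A l).c '' Q d
    · have h' : t ∈ overlap (A m) (A l) := ⟨ht, h⟩
      simp [β, f, indicator_of_mem h, indicator_of_mem h']
    · have h' : t ∉ overlap (A m) (A l) := fun h' => h h'.2
      simp only [β, indicator_of_notMem h, indicator_of_notMem h', zero_mul]

end CubeChart
end LChart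
end Bumps

section Interface

variable {L : FirstOrder.Language} [L.Structure ℝ] [OM L]

theorem Dmap.fstFun {m n : ℕ} : Dmap L (fstFun : (Fin (m + n) → ℝ) → Fin m → ℝ) := by
  unfold Paper.fstFun; exact .auto

theorem Dmap.sndFun {m n : ℕ} : Dmap L (sndFun : (Fin (m + n) → ℝ) → Fin n → ℝ) := by
  unfold Paper.sndFun; exact .auto

theorem dmap_append {m n : ℕ} :
    Dmap L fun p : (Fin m → ℝ) × (Fin n → ℝ) => Fin.append p.1 p.2 :=
  .pi fun k => Fin.addCases (fun i => by simp only [Fin.append_left]; exact .auto)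
    (fun i => by simp only [Fin.append_right]; exact .auto) k

theorem fstFun_append {m n : ℕ} (x : Fin m → ℝ) (y : Fin n → ℝ) : fstFun (Fin.append x y) = x :=
  funext fun i => by simp only [Paper.fstFun, Fin.append_left]

theorem sndFun_append {m n : ℕ} (x : Fin m → ℝ) (y : Fin n → ℝ) : sndFun (Fin.append x y) = y :=
  funext fun i => by simp only [Paper.sndFun, Fin.append_right]

theorem Dmap.defMapOn {m n : ℕ} {X : Set (Fin m → ℝ)} {f : (Fin m → ℝ) → (Fin n → ℝ)}
    (hf : Dmap L f) (hX : Dmap L fun x => x ∈ X) : DefMapOn L m n X f := by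
  have h1 : Dmap L (Paper.fstFun : (Fin (m + n) → ℝ) → Fin m → ℝ) := .fstFun
  have h2 : Dmap L (Paper.sndFun : (Fin (m + n) → ℝ) → Fin n → ℝ) := .sndFun
  refine def_iff.2 ?_
  simp only [mem_ofPred_eq]
  generalize (Paper.fstFun : (Fin (m + n) → ℝ) → Fin m → ℝ) = a at *
  generalize (Paper.sndFun : (Fin (m + n) → ℝ) → Fin n → ℝ) = b at *
  exact .auto

theorem DefMapOn.exists_dmap {m n : ℕ} {X : Set (Fin m → ℝ)} {f : (Fin m → ℝ) → (Fin n → ℝ)}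
    (hf : DefMapOn L m n X f) (hX : Dmap L fun x => x ∈ X) : ∃ g, Dmap L g ∧ EqOn f g X := by
  classical
  refine ⟨fun x => if x ∈ X then f x else 0, ?_, fun x hx => (if_pos hx).symm⟩
  have h1 := def_iff.1 hf
  have h2 : Dmap L fun p : (Fin m → ℝ) × (Fin n → ℝ) => p.1 ∈ X ∧ p.2 = f p.1 := by
    have h3 := Dmap.comp h1 dmap_append
    simpa only [mem_ofPred_eq, fstFun_append, sndFun_append] using h3
  refine .of_graph' (P := fun x y => (x ∈ X ∧ y = f x) ∨ (x ∉ X ∧ y = 0)) ?_ fun x y => ?_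
  · exact .or h2 .auto
  · by_cases hx : x ∈ X <;> simp [hx, eq_comm]

end Interface

section Straighten

variable {L : FirstOrder.Language} [L.Structure ℝ] [OM L]

theorem exists_perm_castLE {d k : ℕ} {b : Fin d → Fin k} (hb : b.Injective) :
    ∃ (h : d ≤ k) (P : Equiv.Perm (Fin k)), ∀ j, P (Fin.castLE h j) = b j := by
  have h : d ≤ k := by simpa using Fintype.card_le_of_injective b hb
  let e : {i // i ∈ range (Fin.castLE h)} ≃ {i // i ∈ range b} :=
    (Equiv.ofInjective _ (Fin.castLE_injective h)).symm.trans (Equiv.ofInjective _ hb)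
  classical
  refine ⟨h, e.extendSubtype, fun j => ?_⟩
  rw [Equiv.extendSubtype_apply_of_mem _ _ ⟨j, rfl⟩]
  show ((Equiv.ofInjective b hb ((Equiv.ofInjective _ (Fin.castLE_injective h)).symm
    (Equiv.ofInjective _ (Fin.castLE_injective h) j))) : Fin k) = b j
  rw [Equiv.symm_apply_apply, Equiv.ofInjective_apply]

/-- Straightening the image of a map `G` from which the parameters can be read off as quotients
of coordinates. -/
theorem exists_straightening {r d k : ℕ} {b : Option (Fin d) → Fin k} (hb : b.Injective)
    {G : (Fin d → ℝ) → (Fin k → ℝ)} (hGd : Dmap L G) (hG : ∀ s ∈ Q d, ContDiffAt ℝ r G s)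
    (hpos : ∀ s ∈ Q d, 0 < G s (b none)) (hmul : ∀ s ∈ Q d, ∀ j, G s (b (some j)) =
      G s (b none) * s j) {H : Set (Fin k → ℝ)} {s₀ : Fin d → ℝ} (hs₀ : s₀ ∈ Q d)
    (hH : ∀ z : Fin k → ℝ, 0 < z (b none) → (fun j => z (b (some j)) / z (b none)) ∈ Q d →
      (z ∈ H ↔ G (fun j => z (b (some j)) / z (b none)) = z)) :
    ∃ (U V : Set (Fin k → ℝ)) (φ ψ : (Fin k → ℝ) → (Fin k → ℝ)),
      G s₀ ∈ U ∧ IsOpen U ∧ Def L k U ∧ (0 : Fin k → ℝ) ∈ V ∧ IsOpen V ∧ Def L k V ∧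
      DefMapOn L k k U φ ∧ DefMapOn L k k V ψ ∧ ContDiffOn ℝ r φ U ∧ ContDiffOn ℝ r ψ V ∧
      Set.BijOn φ U V ∧ Set.InvOn ψ φ U V ∧ φ (G s₀) = 0 ∧
      φ '' (H ∩ U) = {x ∈ V | ∀ i : Fin k, d ≤ (i : ℕ) → x i = 0} := by
  obtain ⟨hdk, P, hP⟩ := exists_perm_castLE (hb.comp (Option.some_injective _))
  simp only [Function.comp_apply] at hP
  have hP' : ∀ i (h : (P.symm i : ℕ) < d), b (some ⟨P.symm i, h⟩) = i := fun i h => by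
    rw [← hP]; exact P.apply_symm_apply i
  have hPn : ¬ (P.symm (b none) : ℕ) < d := fun h => by
    simpa using hb (hP' _ h)
  have hQd : Dmap L fun x => x ∈ Q d := dmap_mem_Q L d
  let π : (Fin k → ℝ) → (Fin d → ℝ) := fun z j => z (b (some j)) / z (b none)
  let σ : (Fin k → ℝ) → (Fin d → ℝ) := fun x j => s₀ j + x (Fin.castLE hdk j)
  let τ : (Fin k → ℝ) → (Fin k → ℝ) := fun x i => x (P.symm i) + G (σ x) i
  let φ : (Fin k → ℝ) → (Fin k → ℝ) := fun z i =>
    if h : (i : ℕ) < d then π z ⟨i, h⟩ - s₀ ⟨i, h⟩ else z (P i) - G (π z) (P i)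
  let ψ : (Fin k → ℝ) → (Fin k → ℝ) := fun x i =>
    if h : (P.symm i : ℕ) < d then σ x ⟨P.symm i, h⟩ * τ x (b none) else τ x i
  let U : Set (Fin k → ℝ) := {z | 0 < z (b none) ∧ π z ∈ Q d}
  let V : Set (Fin k → ℝ) := {x | σ x ∈ Q d ∧ 0 < τ x (b none)}
  have hπd : Dmap L π := by simp only [π]; exact .auto
  have hσd : Dmap L σ := by simp only [σ]; exact .auto
  have hτd : Dmap L τ := by simp only [τ]; exact .auto
  have hφd : Dmap L φ := .pi fun i => by
    by_cases h : (i : ℕ) < d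
    · exact (congrArg (Dmap L) (funext fun z => dif_pos h)).mpr
        (.auto : Dmap L fun z => π z ⟨i, h⟩ - s₀ ⟨i, h⟩)
    · exact (congrArg (Dmap L) (funext fun z => dif_neg h)).mpr
        (.auto : Dmap L fun z : Fin k → ℝ => z (P i) - G (π z) (P i))
  have hψd : Dmap L ψ := .pi fun i => by
    by_cases h : (P.symm i : ℕ) < d
    · exact (congrArg (Dmap L) (funext fun z => dif_pos h)).mpr
        (.auto : Dmap L fun x => σ x ⟨P.symm i, h⟩ * τ x (b none))
    · exact (congrArg (Dmap L) (funext fun z => dif_neg h)).mpr (.auto : Dmap L fun x => τ x i)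
  have hUd : Dmap L fun x => x ∈ U := by simp only [U, mem_ofPred_eq]; exact .auto
  have hVd : Dmap L fun x => x ∈ V := by simp only [V, mem_ofPred_eq]; exact .auto
  have hπ : ∀ z ∈ U, ContDiffAt ℝ r π z := fun z hz => contDiffAt_pi.2 fun j =>
    (contDiff_apply ℝ ℝ _).contDiffAt.div (contDiff_apply ℝ ℝ _).contDiffAt hz.1.ne'
  have hσ : ContDiff ℝ r σ := contDiff_pi.2 fun j => contDiff_const.add (contDiff_apply ℝ ℝ _)
  have hτ : ∀ x ∈ V, ContDiffAt ℝ r τ x := fun x hx => contDiffAt_pi.2 fun i =>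
    (contDiff_apply ℝ ℝ _).contDiffAt.add
      (contDiffAt_pi.1 (ContDiffAt.comp x (hG _ hx.1) hσ.contDiffAt) i)
  have hφ : ∀ z ∈ U, ContDiffAt ℝ r φ z := fun z hz => contDiffAt_pi.2 fun i => by
    simp only [φ]
    split_ifs with h
    · exact (contDiffAt_pi.1 (hπ z hz) _).sub contDiffAt_const
    · exact (contDiff_apply ℝ ℝ _).contDiffAt.sub
        (contDiffAt_pi.1 (ContDiffAt.comp z (hG _ hz.2) (hπ z hz)) _)
  have hψ : ∀ x ∈ V, ContDiffAt ℝ r ψ x := fun x hx => contDiffAt_pi.2 fun i => by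
    simp only [ψ]
    split_ifs with h
    · exact (contDiffAt_pi.1 hσ.contDiffAt _).mul (contDiffAt_pi.1 (hτ x hx) _)
    · exact contDiffAt_pi.1 (hτ x hx) _
  have hψn : ∀ x, ψ x (b none) = τ x (b none) := fun x => dif_neg hPn
  have hπψ : ∀ x ∈ V, π (ψ x) = σ x := fun x hx => funext fun j => by
    have h1 : P.symm (b (some j)) = Fin.castLE hdk j := by rw [← hP, P.symm_apply_apply]
    have h2 : ((P.symm (b (some j)) : Fin k) : ℕ) < d := by rw [h1]; exact j.2
    have h3 : (⟨(P.symm (b (some j)) : Fin k), h2⟩ : Fin d) = j := by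
      ext; simp [h1]
    have h4 : ψ x (b (some j)) = σ x j * τ x (b none) := by simp only [ψ, dif_pos h2, h3]
    simp only [π, hψn, h4]
    exact mul_div_cancel_right₀ _ hx.2.ne'
  have hσφ : ∀ z, σ (φ z) = π z := fun z => funext fun j => by
    simp [σ, φ]
  have hτφ : ∀ z i, ¬ (P.symm i : ℕ) < d → τ (φ z) i = z i := fun z i h => by
    simp only [τ, hσφ, φ, dif_neg h, P.apply_symm_apply]; ring
  have hUV : MapsTo φ U V := fun z hz => by
    refine ⟨(hσφ z).symm ▸ hz.2, ?_⟩
    rw [hτφ z _ hPn]; exact hz.1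
  have hVU : MapsTo ψ V U := fun x hx => by
    refine ⟨(hψn x).symm ▸ hx.2, (hπψ x hx).symm ▸ hx.1⟩
  have hl : LeftInvOn ψ φ U := fun z hz => funext fun i => by
    by_cases h : (P.symm i : ℕ) < d
    · simp only [ψ, dif_pos h, hσφ, hτφ z _ hPn, π, hP' i h]
      exact div_mul_cancel₀ _ hz.1.ne'
    · simp only [ψ, dif_neg h]; exact hτφ z i h
  have hr : RightInvOn ψ φ V := fun x hx => funext fun i => by
    by_cases h : (i : ℕ) < d
    · simp only [φ, dif_pos h, hπψ x hx, σ]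
      simp
    · have h' : ¬ (P.symm (P i) : ℕ) < d := by rwa [P.symm_apply_apply]
      simp only [φ, dif_neg h, hπψ x hx]
      simp only [ψ, dif_neg h', τ, P.symm_apply_apply]; ring
  have hπG : ∀ s ∈ Q d, π (G s) = s := fun s hs => funext fun j => by
    simp only [π, hmul s hs]
    exact mul_div_cancel_left₀ _ (hpos s hs).ne'
  have hGU : G s₀ ∈ U := ⟨hpos _ hs₀, (hπG _ hs₀).symm ▸ hs₀⟩
  have hφ0 : φ (G s₀) = 0 := funext fun i => by
    simp only [φ, hπG _ hs₀]; split_ifs <;> simp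
  have hUo : IsOpen U := by
    rw [isOpen_iff_mem_nhds]
    intro z hz
    filter_upwards [(continuous_apply (b none)).continuousAt.eventually (lt_mem_nhds hz.1),
      (hπ z hz).continuousAt.eventually ((isOpen_Q d).mem_nhds hz.2)] with y h1 h2 using ⟨h1, h2⟩
  have hVo : IsOpen V := by
    rw [isOpen_iff_mem_nhds]
    intro x hx
    filter_upwards [hσ.continuous.continuousAt.eventually ((isOpen_Q d).mem_nhds hx.1),
      (contDiffAt_pi.1 (hτ x hx) (b none)).continuousAt.eventually (lt_mem_nhds hx.2)]
      with y h1 h2 using ⟨h1, h2⟩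
  refine ⟨U, V, φ, ψ, hGU, hUo, def_iff.2 hUd, hφ0 ▸ hUV hGU, hVo, def_iff.2 hVd,
    hφd.defMapOn hUd, hψd.defMapOn hVd, fun z hz => (hφ z hz).contDiffWithinAt,
    fun z hz => (hψ z hz).contDiffWithinAt, InvOn.bijOn ⟨hl, hr⟩ hUV hVU, ⟨hl, hr⟩, hφ0, ?_⟩
  ext x
  constructor
  · rintro ⟨z, ⟨hzH, hzU⟩, rfl⟩
    refine ⟨hUV hzU, fun i hi => ?_⟩
    have := (hH z hzU.1 hzU.2).1 hzH
    simp only [φ, dif_neg hi.not_gt]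
    exact sub_eq_zero.2 (congrFun this (P i)).symm
  · rintro ⟨hxV, hx⟩
    have hx' : ∀ i, ¬ (P.symm i : ℕ) < d → τ x i = G (σ x) i := fun i hi => by
      simp only [τ, hx _ (not_lt.1 hi), zero_add]
    refine ⟨ψ x, ⟨(hH _ (hVU hxV).1 (hVU hxV).2).2 ?_, hVU hxV⟩, hr hxV⟩
    show G (π (ψ x)) = ψ x
    rw [hπψ x hxV]
    funext i
    by_cases h : (P.symm i : ℕ) < d
    · simp only [ψ, dif_pos h, hx' _ hPn]
      have := hmul _ hxV.1 ⟨P.symm i, h⟩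
      rw [hP' i h] at this
      rw [this, mul_comm]
    · simp only [ψ, dif_neg h, hx' i h]

end Straighten

section Embedding

variable {L : FirstOrder.Language} [L.Structure ℝ] {Γ : Type} [Group Γ] [Dt L Γ] {r d : ℕ}
  {C : LChart L Γ r d} [OM L] [DGrp L Γ]

/-- Embedding the group as a submanifold. -/
theorem LChart.exists_embedding (C : LChart L Γ r d) (T : TopCells L Γ d) :
    ∃ (k : ℕ) (F : Γ → Fin k → ℝ), Dmap L F ∧ F.Injective ∧
      (∀ x, ContDiffAt ℝ r (fun t => F (x * C.u t)) C.t₀) ∧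
      IsDefCrSubmanifold L r k d (range F) ∧
      ∀ a, ∃ (U : Set (Fin k → ℝ)) (π : (Fin k → ℝ) → Γ), IsOpen U ∧ F a ∈ U ∧
        (∀ z ∈ U, C.Sm π z) ∧ ∀ x, F x ∈ U → π (F x) = x := by
  obtain ⟨q, A, hA⟩ := exists_cubeCharts C T
  obtain ⟨β, hβd, hβp, hβ0, hβs, hβw⟩ := CubeChart.exists_bumps T A hA
  let e := Fintype.equivFin (Fin q × Option (Fin d))
  let f : Γ → Fin q × Option (Fin d) → ℝ := fun x p =>
    β p.1 x * p.2.elim 1 fun j => (A p.1).w x j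
  let F : Γ → Fin (Fintype.card (Fin q × Option (Fin d))) → ℝ := fun x i => f x (e.symm i)
  have hFn : ∀ x l, F x (e (l, none)) = β l x := fun x l => by simp [F, f]
  have hFs : ∀ x l j, F x (e (l, some j)) = β l x * (A l).w x j := fun x l j => by simp [F, f]
  have hfd : ∀ p, Dmap L fun x => f x p := by
    rintro ⟨l, _ | j⟩
    · have := hβd l
      exact (.auto : Dmap L fun x => β l x * (1 : ℝ))
    · have := hβd l
      have := (A l).hw
      exact (.auto : Dmap L fun x => β l x * (A l).w x j)
  have hFd : Dmap L F := .pi fun i => hfd (e.symm i)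
  have hFr : ∀ x, ContDiffAt ℝ r (fun t => F (x * C.u t)) C.t₀ := fun x => contDiffAt_pi.2 fun i => by
    have : ∀ p, ContDiffAt ℝ r (fun t => f (x * C.u t) p) C.t₀ := by
      rintro ⟨l, _ | j⟩
      · simpa [f] using hβs l x
      · exact hβw l j x
    exact this (e.symm i)
  have hmem : ∀ x l, 0 < F x (e (l, none)) → x ∈ (A l).c '' Q d := fun x l h => by
    by_contra hx
    rw [hFn, hβ0 l x hx] at h
    exact h.false
  have hquot : ∀ x l, x ∈ (A l).c '' Q d →
      (fun j => F x (e (l, some j)) / F x (e (l, none))) = (A l).w x := fun x l hx => by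
    funext j
    rw [hFs, hFn]
    exact mul_div_cancel_left₀ _ (hβp l x hx).ne'
  have hpos : ∀ x l, x ∈ (A l).c '' Q d → 0 < F x (e (l, none)) := fun x l hx => by
    rw [hFn]; exact hβp l x hx
  have hFi : F.Injective := by
    intro x y hxy
    obtain ⟨l, hl⟩ := hA x
    have hl' := hmem y l (hxy ▸ hpos x l hl)
    have h := hquot x l hl
    rw [hxy, hquot y l hl'] at h
    rw [← ((A l).w_mem hl).2, ← h, ((A l).w_mem hl').2]
  have hb : ∀ l, Function.Injective fun o => e (l, o) := fun l o o' h => by simpa using h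
  refine ⟨_, F, hFd, hFi, hFr, ⟨?_, ?_⟩, fun a => ?_⟩
  · refine def_iff.2 ?_
    simp only [mem_range]
    exact .auto
  · rintro _ ⟨a, rfl⟩
    obtain ⟨l, hl⟩ := hA a
    obtain ⟨s₀, hs₀, rfl⟩ := hl
    refine exists_straightening (G := fun s => F ((A l).c s)) (hb l) (.comp hFd (A l).hc)
      (fun s hs => ((A l).sm s hs).contDiffAt (hFr _)) (fun s hs => hpos _ _ ⟨s, hs, rfl⟩)
      (fun s hs j => by rw [hFs, hFn, (A l).w_c s hs]) hs₀ fun z h1 h2 => ⟨?_, fun h => ⟨_, h⟩⟩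
    rintro ⟨x, rfl⟩
    have hx := hmem _ _ h1
    simp only [hquot x l hx, ((A l).w_mem hx).2]
  · obtain ⟨l, hl⟩ := hA a
    let π : (Fin (Fintype.card (Fin q × Option (Fin d))) → ℝ) → (Fin d → ℝ) :=
      fun z j => z (e (l, some j)) / z (e (l, none))
    let U : Set (Fin (Fintype.card (Fin q × Option (Fin d))) → ℝ) :=
      {z | 0 < z (e (l, none)) ∧ π z ∈ Q d}
    have hπ : ∀ z ∈ U, ContDiffAt ℝ r π z := fun z hz => contDiffAt_pi.2 fun j =>
      (contDiff_apply ℝ ℝ _).contDiffAt.div (contDiff_apply ℝ ℝ _).contDiffAt hz.1.ne'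
    refine ⟨U, fun z => (A l).c (π z), ?_, ⟨hpos a l hl, ?_⟩, fun z hz =>
      ((A l).sm _ hz.2).comp (hπ z hz), fun x hx => ?_⟩
    · rw [isOpen_iff_mem_nhds]
      intro z hz
      filter_upwards [(continuous_apply (e (l, none))).continuousAt.eventually (lt_mem_nhds hz.1),
        (hπ z hz).continuousAt.eventually ((isOpen_Q d).mem_nhds hz.2)] with y h1 h2 using ⟨h1, h2⟩
    · show (fun j => F a (e (l, some j)) / F a (e (l, none))) ∈ Q d
      rw [hquot a l hl]
      exact ((A l).w_mem hl).1
    · have hx' := hmem _ _ hx.1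
      show (A l).c (fun j => F x (e (l, some j)) / F x (e (l, none))) = x
      rw [hquot x l hx', ((A l).w_mem hx').2]

end Embedding

section Existence

variable {L : FirstOrder.Language} [L.Structure ℝ] {Γ : Type} [Group Γ] [Dt L Γ] [OM L] [DGrp L Γ]

/-- A definable group is isomorphic to a definable `C^r` group. -/
theorem exists_crGroup (L : FirstOrder.Language) [L.Structure ℝ] (Γ : Type) [Group Γ] [Dt L Γ]
    [OM L] [DGrp L Γ] (r : ℕ) : ∃ (k d : ℕ) (F : Γ → Fin k → ℝ)
      (mulH : (Fin k → ℝ) → (Fin k → ℝ) → (Fin k → ℝ)) (invH : (Fin k → ℝ) → (Fin k → ℝ)),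
      Dmap L F ∧ F.Injective ∧ IsDefCrSubmanifold L r k d (range F) ∧
      (∀ x y, mulH (F x) (F y) = F (x * y)) ∧ (∀ x, invH (F x) = F x⁻¹) ∧
      DefCrMapOn L r (k + k) k {z | fstFun z ∈ range F ∧ sndFun z ∈ range F}
        (fun z => mulH (fstFun z) (sndFun z)) ∧
      DefCrMapOn L r k k (range F) invH := by
  obtain ⟨d, ⟨T⟩, ⟨C⟩⟩ := exists_lChart L Γ r
  obtain ⟨k, F, hFd, hFi, hFr, hsub, hloc⟩ := C.exists_embedding T
  obtain ⟨w, hw, hw'⟩ := Dmap.exists_leftInvOn hFd (A := univ)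
    (by simpa using Dmap.const True) hFi.injOn
  have hwF : ∀ x, w (F x) = x := fun x => hw' x (mem_univ x)
  have hH : Dmap L fun z => z ∈ range F := def_iff.1 hsub.1
  have h1 : Dmap L (fstFun : (Fin (k + k) → ℝ) → Fin k → ℝ) := .fstFun
  have h2 : Dmap L (sndFun : (Fin (k + k) → ℝ) → Fin k → ℝ) := .sndFun
  have h1r : ContDiff ℝ r (fstFun : (Fin (k + k) → ℝ) → Fin k → ℝ) :=
    contDiff_pi.2 fun i => contDiff_apply ℝ ℝ _
  have h2r : ContDiff ℝ r (sndFun : (Fin (k + k) → ℝ) → Fin k → ℝ) :=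
    contDiff_pi.2 fun i => contDiff_apply ℝ ℝ _
  refine ⟨k, d, F, fun z z' => F (w z * w z'), fun z => F (w z)⁻¹, hFd, hFi, hsub,
    fun x y => by simp only [hwF], fun x => by simp only [hwF],
    ⟨Dmap.defMapOn (.comp hFd (.gmul (.comp hw h1) (.comp hw h2)))
      (.and (.comp hH h1) (.comp hH h2)), ?_⟩,
    ⟨Dmap.defMapOn (.comp hFd (.ginv hw)) hH, ?_⟩⟩
  · rintro z ⟨⟨a, ha⟩, ⟨b, hb⟩⟩
    obtain ⟨U, π, hU, haU, hπ, hπF⟩ := hloc a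
    obtain ⟨U', π', hU', hbU', hπ', hπF'⟩ := hloc b
    refine ⟨fstFun ⁻¹' U ∩ sndFun ⁻¹' U', fun z => F (π (fstFun z) * π' (sndFun z)),
      ⟨by rwa [mem_preimage, ← ha], by rwa [mem_preimage, ← hb]⟩,
      (hU.preimage h1r.continuous).inter (hU'.preimage h2r.continuous), fun y hy => ?_, ?_⟩
    · exact ((((hπ _ hy.1).comp h1r.contDiffAt).mul T ((hπ' _ hy.2).comp h2r.contDiffAt)).contDiffAt
        (hFr _)).contDiffWithinAt
    · rintro y ⟨⟨⟨x, hx⟩, ⟨x', hx'⟩⟩, hy, hy'⟩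
      rw [mem_preimage, ← hx] at hy
      rw [mem_preimage, ← hx'] at hy'
      simp only [← hx, ← hx', hwF, hπF x hy, hπF' x' hy']
  · rintro z ⟨a, rfl⟩
    obtain ⟨U, π, hU, haU, hπ, hπF⟩ := hloc a
    refine ⟨U, fun z => F (π z)⁻¹, haU, hU, fun y hy => ?_, ?_⟩
    · exact (((hπ _ hy).inv T).contDiffAt (hFr _)).contDiffWithinAt
    · rintro y ⟨⟨x, rfl⟩, hy⟩
      simp only [hwF, hπF x hy]

end Existence

section CrAt

variable {r m n l : ℕ}

/-- Near `a`, the restriction of `f` to `X` extends to a map which is `C^r` at `a`. -/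
def CrAt (r : ℕ) (X : Set (Fin m → ℝ)) (f : (Fin m → ℝ) → (Fin n → ℝ)) (a : Fin m → ℝ) : Prop :=
  ∃ g : (Fin m → ℝ) → (Fin n → ℝ), ContDiffAt ℝ r g a ∧ f =ᶠ[𝓝[X] a] g

theorem crMapOn_iff {X : Set (Fin m → ℝ)} {f : (Fin m → ℝ) → (Fin n → ℝ)} :
    CrMapOn r m n X f ↔ ∀ a ∈ X, CrAt r X f a := by
  refine forall₂_congr fun a _ => ⟨?_, ?_⟩
  · rintro ⟨W, g, haW, hW, hg, he⟩
    exact ⟨g, hg.contDiffAt (hW.mem_nhds haW),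
      Filter.mem_of_superset (inter_mem_nhdsWithin X (hW.mem_nhds haW)) he⟩
  · rintro ⟨g, hg, he⟩
    obtain ⟨V, hVs, hV, haV⟩ := mem_nhds_iff.1
      (hg.eventually (by simp) |>.and (eventually_nhdsWithin_iff.1 he))
    exact ⟨V, g, haV, hV, fun x hx => (hVs hx).1.contDiffWithinAt, fun x hx => (hVs hx.2).2 hx.1⟩

theorem _root_.ContDiffAt.crAt {X : Set (Fin m → ℝ)} {f : (Fin m → ℝ) → (Fin n → ℝ)}
    {a : Fin m → ℝ} (hf : ContDiffAt ℝ r f a) : CrAt r X f a := ⟨f, hf, .rfl⟩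

theorem CrAt.comp {X : Set (Fin m → ℝ)} {Y : Set (Fin n → ℝ)} {h : (Fin m → ℝ) → (Fin n → ℝ)}
    {f : (Fin n → ℝ) → (Fin l → ℝ)} {a : Fin m → ℝ} (hf : CrAt r Y f (h a)) (hh : CrAt r X h a)
    (hXY : MapsTo h X Y) (ha : a ∈ X) : CrAt r X (fun x => f (h x)) a := by
  obtain ⟨f', hf', hfe⟩ := hf
  obtain ⟨h', hh', hhe⟩ := hh
  have hha : h a = h' a := hhe.self_of_nhdsWithin ha
  refine ⟨fun x => f' (h' x), ContDiffAt.comp a (hha ▸ hf') hh', ?_⟩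
  have h1 : Filter.Tendsto h (𝓝[X] a) (𝓝[Y] (h a)) := by
    refine tendsto_nhdsWithin_iff.2 ⟨?_, Filter.mem_of_superset self_mem_nhdsWithin hXY⟩
    rw [hha]
    exact (hh'.continuousAt.tendsto.mono_left nhdsWithin_le_nhds).congr' hhe.symm
  filter_upwards [h1.eventually hfe, hhe] with x hx hx'
  rw [hx, hx']

theorem CrAt.congr {X : Set (Fin m → ℝ)} {f g : (Fin m → ℝ) → (Fin n → ℝ)} {a : Fin m → ℝ}
    (hf : CrAt r X f a) (h : EqOn g f X) : CrAt r X g a := by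
  obtain ⟨f', hf', hfe⟩ := hf
  refine ⟨f', hf', ?_⟩
  filter_upwards [hfe, self_mem_nhdsWithin] with x hx hxX
  rw [h hxX, hx]

end CrAt

section Uniqueness

variable {L : FirstOrder.Language} [L.Structure ℝ] [OM L]

/-- Definable maps on a submanifold are `C^r` somewhere. -/
theorem IsDefCrSubmanifold.exists_crAt {r k d l : ℕ} {M : Set (Fin k → ℝ)}
    (hM : IsDefCrSubmanifold L r k d M) (hne : M.Nonempty) {f : (Fin k → ℝ) → (Fin l → ℝ)}
    (hf : Dmap L f) : ∃ p ∈ M, CrAt r M f p := by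
  classical
  obtain ⟨a, ha⟩ := hne
  obtain ⟨U, V, φ, ψ, haU, hU, hUd, h0, hV, hVd, hφd, hψd, hφ, hψ, hbij, hinv, hφa, himg⟩ := hM.2 a ha
  obtain ⟨ψ', hψ'd, hψ'⟩ := hψd.exists_dmap (def_iff.1 hVd)
  let μ : (Fin k → ℝ) → (Fin k → ℝ) := fun x i => if (i : ℕ) < d then x i else 0
  have hμd : Dmap L μ := .pi fun i => by
    by_cases h : (i : ℕ) < d
    · exact (congrArg (Dmap L) (funext fun z => if_pos h)).mpr (.auto : Dmap L fun z : Fin k → ℝ => z i)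
    · exact (congrArg (Dmap L) (funext fun z => if_neg h)).mpr
        (.auto : Dmap L fun z : Fin k → ℝ => (0 : ℝ))
  have hμc : Continuous μ := continuous_pi fun i => by
    by_cases h : (i : ℕ) < d <;> simp only [μ, h, if_true, if_false] <;> fun_prop
  have hfγ : Dmap L fun x => f (ψ' (μ x)) := .comp hf (.comp hψ'd hμd)
  obtain ⟨x₁, hx₁, hr⟩ := Thin.exists_notMem (thin_not_contDiffAt r hfγ) (hV.preimage hμc)
    ⟨0, by
      have : μ 0 = 0 := funext fun i => by simp [μ]
      rwa [mem_preimage, this]⟩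
  have hr : ContDiffAt ℝ r (fun x => f (ψ' (μ x))) x₁ := by simpa using hr
  obtain ⟨p, ⟨hpM, hpU⟩, hp⟩ : μ x₁ ∈ φ '' (M ∩ U) := by
    rw [himg]
    exact ⟨hx₁, fun i hi => if_neg hi.not_gt⟩
  let θ : (Fin k → ℝ) → (Fin k → ℝ) := fun y => φ y + (x₁ - μ x₁)
  have hθp : θ p = x₁ := by simp [θ, hp]
  have hθ : ContDiffAt ℝ r θ p := (hφ.contDiffAt (hU.mem_nhds hpU)).add contDiffAt_const
  refine ⟨p, hpM, fun y => f (ψ' (μ (θ y))), (show ContDiffAt ℝ r (fun x => f (ψ' (μ x))) (θ p) by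
    rwa [hθp]).comp p hθ, ?_⟩
  filter_upwards [inter_mem_nhdsWithin M (hU.mem_nhds hpU)] with y hy
  have h1 : φ y ∈ φ '' (M ∩ U) := ⟨y, hy, rfl⟩
  rw [himg] at h1
  have h2 : μ (θ y) = φ y := by
    funext i
    by_cases h : (i : ℕ) < d
    · simp [μ, θ, h]
    · simp [μ, h, h1.2 i (not_lt.1 h)]
  rw [h2, ← hψ' h1.1, hinv.1 hy.2]

variable {Γ : Type} [Group Γ]

theorem crAt_mul_left {r k : ℕ} {F : Γ → Fin k → ℝ}
    {mulH : (Fin k → ℝ) → (Fin k → ℝ) → (Fin k → ℝ)} (hcr : CrMapOn r (k + k) k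
      {z | fstFun z ∈ range F ∧ sndFun z ∈ range F} (fun z => mulH (fstFun z) (sndFun z)))
    (b x : Γ) : CrAt r (range F) (mulH (F b)) (F x) := by
  have h1 : ContDiff ℝ r (fun y : Fin k → ℝ => Fin.append (F b) y) :=
    contDiff_pi.2 fun i => Fin.addCases
      (fun i => by simp only [Fin.append_left]; exact contDiff_const)
      (fun i => by simp only [Fin.append_right]; exact contDiff_apply ℝ ℝ i) i
  have h2 : ∀ y ∈ range F, Fin.append (F b) y ∈
      {z : Fin (k + k) → ℝ | fstFun z ∈ range F ∧ sndFun z ∈ range F} :=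
    fun y hy => ⟨by rw [fstFun_append]; exact ⟨b, rfl⟩, by rwa [sndFun_append]⟩
  have := (crMapOn_iff.1 hcr _ (h2 (F x) ⟨x, rfl⟩)).comp h1.contDiffAt.crAt h2 ⟨x, rfl⟩
  simpa only [fstFun_append, sndFun_append] using this

/-- Definable homomorphisms between definable `C^r` groups are `C^r`. -/
theorem crMapOn_of_hom {r k l d : ℕ} {F : Γ → Fin k → ℝ} {F' : Γ → Fin l → ℝ}
    {mulH : (Fin k → ℝ) → (Fin k → ℝ) → (Fin k → ℝ)}
    {mulH' : (Fin l → ℝ) → (Fin l → ℝ) → (Fin l → ℝ)}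
    (hM : IsDefCrSubmanifold L r k d (range F))
    (hmul : ∀ x y, mulH (F x) (F y) = F (x * y)) (hmul' : ∀ x y, mulH' (F' x) (F' y) = F' (x * y))
    (hcr : CrMapOn r (k + k) k {z | fstFun z ∈ range F ∧ sndFun z ∈ range F}
      (fun z => mulH (fstFun z) (sndFun z)))
    (hcr' : CrMapOn r (l + l) l {z | fstFun z ∈ range F' ∧ sndFun z ∈ range F'}
      (fun z => mulH' (fstFun z) (sndFun z)))
    {f : (Fin k → ℝ) → (Fin l → ℝ)} (hf : Dmap L f) (hfF : ∀ x, f (F x) = F' x) :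
    CrMapOn r k l (range F) f := by
  obtain ⟨_, ⟨p, rfl⟩, hp⟩ := hM.exists_crAt ⟨F 1, 1, rfl⟩ hf
  refine crMapOn_iff.2 ?_
  rintro _ ⟨a, rfl⟩
  have h1 : MapsTo (mulH (F (p * a⁻¹))) (range F) (range F) := by
    rintro _ ⟨x, rfl⟩
    exact ⟨_, (hmul _ _).symm⟩
  have h2 : CrAt r (range F) (fun x => f (mulH (F (p * a⁻¹)) x)) (F a) := by
    refine CrAt.comp (Y := range F) ?_ (crAt_mul_left hcr _ _) h1 ⟨a, rfl⟩
    rwa [hmul, inv_mul_cancel_right]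
  have h3 : MapsTo (fun x => f (mulH (F (p * a⁻¹)) x)) (range F) (range F') := by
    rintro _ ⟨x, rfl⟩
    exact ⟨p * a⁻¹ * x, by simp only [hmul, hfF]⟩
  have h4 : CrAt r (range F) (fun x => mulH' (F' (a * p⁻¹)) (f (mulH (F (p * a⁻¹)) x))) (F a) := by
    refine CrAt.comp (Y := range F') ?_ h2 h3 ⟨a, rfl⟩
    rw [hmul, hfF]
    exact crAt_mul_left hcr' _ _
  refine h4.congr ?_
  rintro _ ⟨x, rfl⟩
  simp only [hmul, hfF, hmul']
  congr 1
  group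

end Uniqueness

/-- every definable group admits a definable `C^r` group structure, and this
structure is unique up to definable `C^r` diffeomorphism. -/
theorem statement8
    (hfield : ExpandsOrderedField L) (hlom : LocallyOMinimal L)
    (r : ℕ) (hr : 1 ≤ r) (N : ℕ)
    (G : Set (Fin N → ℝ)) (hGdef : Def L N G)
    (mul : (Fin N → ℝ) → (Fin N → ℝ) → (Fin N → ℝ))
    (inv : (Fin N → ℝ) → (Fin N → ℝ)) (e : Fin N → ℝ)
    (he : e ∈ G)
    (hmul_mem : ∀ x ∈ G, ∀ y ∈ G, mul x y ∈ G)
    (hinv_mem : ∀ x ∈ G, inv x ∈ G)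
    (hassoc : ∀ x ∈ G, ∀ y ∈ G, ∀ z ∈ G, mul (mul x y) z = mul x (mul y z))
    (hident : ∀ x ∈ G, mul e x = x ∧ mul x e = x)
    (hinverse : ∀ x ∈ G, mul x (inv x) = e ∧ mul (inv x) x = e)
    (hmul_def : DefMapOn L (N + N) N {z | fstFun z ∈ G ∧ sndFun z ∈ G}
      (fun z => mul (fstFun z) (sndFun z)))
    (hinv_def : DefMapOn L N N G inv) :
    Nonempty (DefCrGroupStructure L r N G mul inv) ∧
    ∀ S₁ S₂ : DefCrGroupStructure L r N G mul inv,
      ∃ (f : (Fin S₁.k → ℝ) → (Fin S₂.k → ℝ)) (finv : (Fin S₂.k → ℝ) → (Fin S₁.k → ℝ)),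
        (∀ g ∈ G, f (S₁.iota g) = S₂.iota g) ∧
        DefCrMapOn L r S₁.k S₂.k S₁.H f ∧ DefCrMapOn L r S₂.k S₁.k S₂.H finv ∧
        Set.BijOn f S₁.H S₂.H ∧ Set.InvOn finv f S₁.H S₂.H := by
  have : OM L := ⟨hfield, hlom⟩
  have hG : Dmap L fun x => x ∈ G := def_iff.1 hGdef
  letI : Dt L {x // x ∈ G} := dtSubtype hG.dpred
  have hval : Dmap L fun x : {x // x ∈ G} => x.1 := .coe_subtype hG.dpred
  letI : Group {x // x ∈ G} :=
    { mul x y := ⟨mul x.1 y.1, hmul_mem _ x.2 _ y.2⟩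
      one := ⟨e, he⟩
      inv x := ⟨inv x.1, hinv_mem _ x.2⟩
      mul_assoc x y z := Subtype.ext (hassoc _ x.2 _ y.2 _ z.2)
      one_mul x := Subtype.ext (hident _ x.2).1
      mul_one x := Subtype.ext (hident _ x.2).2
      inv_mul_cancel x := Subtype.ext (hinverse _ x.2).2 }
  have hm : ∀ x y : {x // x ∈ G}, (x * y).1 = mul x.1 y.1 := fun _ _ => rfl
  have hi : ∀ x : {x // x ∈ G}, (x⁻¹).1 = inv x.1 := fun _ => rfl
  have : DGrp L {x // x ∈ G} := by
    have h1 : Dmap L (fstFun : (Fin (N + N) → ℝ) → Fin N → ℝ) := .fstFun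
    have h2 : Dmap L (sndFun : (Fin (N + N) → ℝ) → Fin N → ℝ) := .sndFun
    obtain ⟨m, hmd, hme⟩ := hmul_def.exists_dmap (.and (.comp hG h1) (.comp hG h2))
    obtain ⟨i, hid, hie⟩ := hinv_def.exists_dmap hG
    have h3 : Dmap L fun p : {x // x ∈ G} × {x // x ∈ G} => Fin.append p.1.1 p.2.1 :=
      .comp dmap_append (.prodMk (.comp hval dmap_fst) (.comp hval dmap_snd))
    have h4 : ∀ x y : {x // x ∈ G}, m (Fin.append x.1 y.1) = (x * y).1 := fun x y => by
      have := hme (x := Fin.append x.1 y.1) 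
        ⟨by rw [fstFun_append]; exact x.2, by rw [sndFun_append]; exact y.2⟩
      simp only [fstFun_append, sndFun_append] at this
      exact this.symm
    constructor
    · refine .of_graph' (P := fun p z => m (Fin.append p.1.1 p.2.1) = z.1) ?_ fun p z => ?_
      · exact .eq (.comp hmd (.comp h3 dmap_fst)) (.comp hval dmap_snd)
      · rw [h4, Subtype.ext_iff]
    · refine .of_graph' (P := fun x z => i x.1 = z.1)
        (.eq (.comp hid (.comp hval dmap_fst)) (.comp hval dmap_snd)) fun x z => ?_
      rw [← hie x.2, Subtype.ext_iff, hi]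
  refine ⟨?_, ?_⟩
  · obtain ⟨k, d, F, mulH, invH, hFd, hFi, hsub, hmul, hinv, hmcr, hicr⟩ :=
      exists_crGroup L {x // x ∈ G} r
    classical
    obtain ⟨ι, hF⟩ : ∃ ι : (Fin N → ℝ) → (Fin k → ℝ), ∀ x (hx : x ∈ G), ι x = F ⟨x, hx⟩ :=
      ⟨fun x => if h : x ∈ G then F ⟨x, h⟩ else 0, fun x hx => dif_pos hx⟩
    refine ⟨⟨k, d, range F, hsub, mulH, invH, ?_, ?_, hmcr, hicr,
      ι, ?_, ⟨?_, ?_, ?_⟩, ?_, ?_⟩⟩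
    · rintro _ ⟨x, rfl⟩ _ ⟨y, rfl⟩
      exact ⟨_, (hmul x y).symm⟩
    · rintro _ ⟨x, rfl⟩
      exact ⟨_, (hinv x).symm⟩
    · have h1 : Dmap L (fstFun : (Fin (N + k) → ℝ) → Fin N → ℝ) := .fstFun
      have h2 : Dmap L (sndFun : (Fin (N + k) → ℝ) → Fin k → ℝ) := .sndFun
      have h3 : Dmap L fun z : Fin (N + k) → ℝ => ∃ g : {x // x ∈ G}, g.1 = fstFun z ∧
          sndFun z = F g := by
        generalize (fstFun : (Fin (N + k) → ℝ) → Fin N → ℝ) = a at *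
        generalize (sndFun : (Fin (N + k) → ℝ) → Fin k → ℝ) = b at *
        exact .auto
      refine def_iff.2 ((congrArg (Dmap L) (funext fun z => propext ?_)).mp h3)
      constructor
      · rintro ⟨⟨g, hg⟩, rfl, h⟩
        exact ⟨hg, h.trans (hF _ hg).symm⟩
      · rintro ⟨hz, h⟩
        exact ⟨⟨_, hz⟩, rfl, h.trans (hF _ hz)⟩
    · exact fun x hx => ⟨⟨x, hx⟩, (hF x hx).symm⟩
    · intro x hx y hy h
      rw [hF x hx, hF y hy] at h
      exact Subtype.ext_iff.1 (hFi h)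
    · rintro _ ⟨x, rfl⟩
      exact ⟨x.1, x.2, hF _ x.2⟩
    · intro x hx y hy
      rw [hF x hx, hF y hy, hmul, hF _ (hmul_mem _ hx _ hy)]
      rfl
    · intro x hx
      rw [hF x hx, hinv, hF _ (hinv_mem _ hx)]
      rfl
  · have hF : ∀ S : DefCrGroupStructure L r N G mul inv,
        (range fun x : {x // x ∈ G} => S.iota x.1) = S.H := fun S => by
      rw [← S.hiota_bij.image_eq]
      ext z
      simp
    have hFd : ∀ S : DefCrGroupStructure L r N G mul inv,
        Dmap L fun x : {x // x ∈ G} => S.iota x.1 := fun S => by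
      obtain ⟨j, hj, hje⟩ := S.hiota_def.exists_dmap hG
      have : (fun x : {x // x ∈ G} => S.iota x.1) = fun x => j x.1 := funext fun x => hje x.2
      rw [this]
      exact .comp hj hval
    have hmulF : ∀ (S : DefCrGroupStructure L r N G mul inv) (x y : {x // x ∈ G}),
        S.mulH (S.iota x.1) (S.iota y.1) = S.iota (x * y).1 :=
      fun S x y => (S.hiota_mul _ x.2 _ y.2).symm
    have key : ∀ S S' : DefCrGroupStructure L r N G mul inv,
        ∃ f : (Fin S.k → ℝ) → (Fin S'.k → ℝ), (∀ g ∈ G, f (S.iota g) = S'.iota g) ∧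
          DefCrMapOn L r S.k S'.k S.H f := fun S S' => by
      obtain ⟨w, hw, hwe⟩ := Dmap.exists_leftInvOn (hFd S) (A := univ)
        (by simpa using Dmap.const True) fun x _ y _ h =>
          Subtype.ext (S.hiota_bij.injOn x.2 y.2 h)
      have hf : Dmap L fun z => S'.iota (w z).1 := .comp (g := fun x : {x // x ∈ G} => S'.iota x.1) (hFd S') hw
      have hfF : ∀ x : {x // x ∈ G}, S'.iota (w (S.iota x.1)).1 = S'.iota x.1 :=
        fun x => by rw [hwe x (mem_univ x)]
      refine ⟨_, fun g hg => hfF ⟨g, hg⟩, hf.defMapOn (def_iff.1 S.hsub.1), ?_⟩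
      have := crMapOn_of_hom (F := fun x : {x // x ∈ G} => S.iota x.1)
        (F' := fun x : {x // x ∈ G} => S'.iota x.1) (d := S.d) (by rw [hF]; exact S.hsub)
        (hmulF S) (hmulF S') (by rw [hF]; exact S.hmulH_cr.2) (by rw [hF]; exact S'.hmulH_cr.2)
        hf hfF
      rwa [hF] at this
    intro S₁ S₂
    obtain ⟨f, hf, hf'⟩ := key S₁ S₂
    obtain ⟨f', hg, hg'⟩ := key S₂ S₁
    have h1 : ∀ (S S' : DefCrGroupStructure L r N G mul inv) (f : (Fin S.k → ℝ) → (Fin S'.k → ℝ)),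
        (∀ g ∈ G, f (S.iota g) = S'.iota g) → MapsTo f S.H S'.H := fun S S' f h => by
      rw [← S.hiota_bij.image_eq]
      rintro _ ⟨g, hg, rfl⟩
      rw [h g hg]
      exact S'.hiota_bij.mapsTo hg
    have h2 : ∀ (S S' : DefCrGroupStructure L r N G mul inv) (f : (Fin S.k → ℝ) → (Fin S'.k → ℝ))
        (f' : (Fin S'.k → ℝ) → (Fin S.k → ℝ)), (∀ g ∈ G, f (S.iota g) = S'.iota g) →
        (∀ g ∈ G, f' (S'.iota g) = S.iota g) → LeftInvOn f' f S.H := fun S S' f f' h h' => by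
      rw [← S.hiota_bij.image_eq]
      rintro _ ⟨g, hg, rfl⟩
      rw [h g hg, h' g hg]
    have hinv : InvOn f' f S₁.H S₂.H := ⟨h2 _ _ _ _ hf hg, h2 _ _ _ _ hg hf⟩
    exact ⟨f, f', hf, hf', hg', hinv.bijOn (h1 _ _ _ hf) (h1 _ _ _ hg), hinv⟩

end Paper
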